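/- arXiv:math/9807062 — 3 statements merged into one kernel-verified Lean document; each statement's English description precedes it below -/
import Mathlib

section
/- Let α > 0 and, for a ∈ K, let f_a(x) = χ(⟨a,x⟩), x ∈ K̄ (so f_a ∈ E(K̄)). Then for μ-almost all x ∈ K̄: (D^α f_a)(x) = 0 if ‖a‖ ≤ 1, and (D^α f_a)(x) = ‖a‖^α · f_a(x) if ‖a‖ > 1. -/
open MeasureTheory Module
open scoped Classical

noncomputable section

/-- The topology defined by a translation-invariant "norm" function via open balls. -/
def normTopology {X : Type} [Sub X] (f : X → ℝ) : TopologicalSpace X :=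
  TopologicalSpace.generateFrom
    {U | ∃ x : X, ∃ ε : ℝ, 0 < ε ∧ U = {y : X | f (y - x) < ε}}

variable (p : ℕ) [Fact (Nat.Prime p)]
variable (k : Type) [Field k] [Algebra ℚ_[p] k] [FiniteDimensional ℚ_[p] k]

/-- The normalized absolute value on the local field k. -/
def absk (x : k) : ℝ := ‖(Algebra.norm ℚ_[p] x : ℚ_[p])‖

/-- The topology of k as a local field. -/
def kTop : TopologicalSpace k := normTopology (absk p k)

variable (K : Type) [Field K] [Algebra k K] [CharZero K]
variable (Kn : ℕ → IntermediateField k K)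

/-- The relative trace map between two intermediate fields. -/
def relTrace (E F : IntermediateField k K) (h : E ≤ F) (x : F) : E :=
  (@Algebra.trace E F _ _ (IntermediateField.inclusion h).toRingHom.toAlgebra) x

variable (T : ℕ → K →ₗ[k] K)

/-- The projective limit K̄ of the fields Kₙ along the normalized trace maps. -/
def ProjLim : Type :=
  {x : ℕ → K // (∀ n, x n ∈ Kn n) ∧ ∀ ⦃n ν : ℕ⦄, n ≤ ν → T n (x ν) = x n}

/-- Pointwise addition on K̄. -/
def pladd (x y : ProjLim k K Kn T) : ProjLim k K Kn T :=
  ⟨fun n => x.1 n + y.1 n, by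
    refine ⟨fun n => add_mem (x.2.1 n) (y.2.1 n), ?_⟩
    intro n ν h
    simp [map_add, x.2.2 h, y.2.2 h]⟩

/-- Pointwise scalar multiplication on K̄. -/
def plsmul (c : k) (x : ProjLim k K Kn T) : ProjLim k K Kn T :=
  ⟨fun n => c • x.1 n, by
    refine ⟨fun n => (Kn n).toSubalgebra.smul_mem (x.2.1 n) c, ?_⟩
    intro n ν h
    simp [_root_.map_smul, x.2.2 h]⟩

/-- The topology on K̄ given by the seminorms x ↦ ‖xₙ‖. -/
def projTop (Knorm : K → ℝ) : TopologicalSpace (ProjLim k K Kn T) :=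
  TopologicalSpace.generateFrom
    {U | ∃ x : ProjLim k K Kn T, ∃ n : ℕ, ∃ ε : ℝ, 0 < ε ∧
          U = {y : ProjLim k K Kn T | Knorm (y.1 n - x.1 n) < ε}}

/-- The Borel σ-algebra of the seminorm topology on K̄. -/
def projMeas (Knorm : K → ℝ) : MeasurableSpace (ProjLim k K Kn T) :=
  @borel _ (projTop k K Kn T Knorm)

/-- The topology on Kₙ induced from the absolute value ‖·‖. -/
def KnTop (Knorm : K → ℝ) (n : ℕ) : TopologicalSpace (Kn n) :=
  TopologicalSpace.induced Subtype.val (normTopology Knorm)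

/-- The Borel σ-algebra of Kₙ. -/
def KnMeas (Knorm : K → ℝ) (n : ℕ) : MeasurableSpace (Kn n) :=
  @borel _ (KnTop k K Kn Knorm n)

/-- The canonical embedding of K into K̄. -/
def emb (hTmem : ∀ n x, T n x ∈ Kn n)
    (hTproj : ∀ ⦃n ν : ℕ⦄, n ≤ ν → ∀ x : K, T n (T ν x) = T n x) (x : K) :
    ProjLim k K Kn T :=
  ⟨fun n => T n x, fun n => hTmem n x, fun n ν h => hTproj h x⟩

/-- The weak topology σ(K̄, K) on K̄. -/
def weakTop (pairing : K → ProjLim k K Kn T → k) : TopologicalSpace (ProjLim k K Kn T) :=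
  ⨅ a : K, TopologicalSpace.induced (pairing a) (kTop p k)

/-- Non-archimedean seminorms on K over k. -/
def IsNASeminorm (f : K → ℝ) : Prop :=
  (∀ x, 0 ≤ f x) ∧ (∀ x y, f (x + y) ≤ max (f x) (f y)) ∧
    ∀ (c : k) (x : K), f (c • x) = absk p k c * f x

/-- The locally convex topology determined by a family of seminorms. -/
def seminormFamilyTop (F : Set (K → ℝ)) : TopologicalSpace K :=
  TopologicalSpace.generateFrom
    {U | ∃ f ∈ F, ∃ x : K, ∃ ε : ℝ, 0 < ε ∧ U = {y : K | f (y - x) < ε}}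

/-- The inductive limit topology on K: the finest locally convex topology over k
making all the inclusions Kₙ → K continuous. -/
def indTop (Knorm : K → ℝ) : TopologicalSpace K :=
  sInf {t : TopologicalSpace K |
    (∃ F : Set (K → ℝ), (∀ f ∈ F, IsNASeminorm p k K f) ∧ t = seminormFamilyTop K F) ∧
    ∀ n : ℕ, @Continuous _ _ (KnTop k K Kn Knorm n) t Subtype.val}

/-- Locally constant functions with bounded (hence compact) support on Kₙ. -/
def IsTestFun (Knorm : K → ℝ) (n : ℕ) (φ : Kn n → ℂ) : Prop :=
  @IsLocallyConstant _ _ (KnTop k K Kn Knorm n) φ ∧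
    ∃ R : ℝ, ∀ ξ : Kn n, R < Knorm ↑ξ → φ ξ = 0


/-- The fractional differentiation operator Dᵅ applied to the cylindrical function φ ∘ Tₙ. -/
def Dop (Knorm : K → ℝ) (χ : k → ℂ) (pairing : K → ProjLim k K Kn T → k)
    (vol : ∀ n : ℕ, @MeasureTheory.Measure (Kn n) (KnMeas k K Kn Knorm n))
    (μ : @MeasureTheory.Measure (ProjLim k K Kn T) (projMeas k K Kn T Knorm))
    (α : ℝ) (n : ℕ) (φ : Kn n → ℂ) (x : ProjLim k K Kn T) : ℂ :=
  ∫ ξ : Kn n,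
    χ ((finrank k (Kn n) : k)⁻¹ *
        Algebra.trace k (Kn n) (-(⟨x.1 n, x.2.1 n⟩ * ξ))) *
      (if 1 < Knorm ↑ξ then ((Knorm ↑ξ ^ α : ℝ) : ℂ) else 0) *
      (∫ y, χ (pairing (↑ξ) y) * φ ⟨y.1 n, y.2.1 n⟩ ∂μ) ∂(vol n)
end

section LocalFieldNorm

variable (p : ℕ) [Fact (Nat.Prime p)]

theorem absk_eq_spectralNorm_pow (L : Type) [Field L] [Algebra ℚ_[p] L]
    [FiniteDimensional ℚ_[p] L] (x : L) :
    absk p L x = spectralNorm ℚ_[p] L x ^ finrank ℚ_[p] L := by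
  have hx : IsIntegral ℚ_[p] x := Algebra.IsIntegral.isIntegral x
  have hdeg : finrank ℚ_[p] L = (minpoly ℚ_[p] x).natDegree *
      finrank (IntermediateField.adjoin ℚ_[p] {x}) L := by
    rw [← IntermediateField.adjoin.finrank hx, finrank_mul_finrank]
  have hnorm := Algebra.PowerBasis.norm_gen_eq_coeff_zero_minpoly
    (IntermediateField.adjoin.powerBasis hx)
  rw [IntermediateField.adjoin.powerBasis_gen hx, IntermediateField.minpoly_gen] at hnorm
  have hpos : ((minpoly ℚ_[p] x).natDegree : ℝ) ≠ 0 :=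
    Nat.cast_ne_zero.mpr (minpoly.natDegree_pos hx).ne'
  rw [absk, Algebra.norm_eq_norm_adjoin, hnorm, spectralNorm.spectralNorm_eq_norm_coeff_zero_rpow,
    hdeg, pow_mul, ← Real.rpow_natCast (_ ^ _) (minpoly ℚ_[p] x).natDegree,
    ← Real.rpow_mul (norm_nonneg _), one_div_mul_cancel hpos, Real.rpow_one]
  simp

theorem absk_nonneg (L : Type) [Field L] [Algebra ℚ_[p] L] (x : L) : 0 ≤ absk p L x :=
  norm_nonneg _

theorem absk_add_le (L : Type) [Field L] [Algebra ℚ_[p] L] [FiniteDimensional ℚ_[p] L]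
    (x y : L) : absk p L (x + y) ≤ max (absk p L x) (absk p L y) := by
  simp only [absk_eq_spectralNorm_pow]
  rcases le_max_iff.mp (isNonarchimedean_spectralNorm (K := ℚ_[p]) x y) with h | h
  · exact le_max_of_le_left (pow_le_pow_left₀ (spectralNorm_nonneg _) h _)
  · exact le_max_of_le_right (pow_le_pow_left₀ (spectralNorm_nonneg _) h _)

theorem absk_smul (L : Type) [Field L] [Algebra ℚ_[p] L] [FiniteDimensional ℚ_[p] L]
    (c : ℚ_[p]) (x : L) : absk p L (c • x) = ‖c‖ ^ finrank ℚ_[p] L * absk p L x := by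
  rw [absk, absk, Algebra.smul_def, map_mul, Algebra.norm_algebraMap, norm_mul, norm_pow]

theorem absk_zero (L : Type) [Field L] [Algebra ℚ_[p] L] [FiniteDimensional ℚ_[p] L] :
    absk p L 0 = 0 := by
  simp [absk]

theorem absk_neg (L : Type) [Field L] [Algebra ℚ_[p] L] [FiniteDimensional ℚ_[p] L] (x : L) :
    absk p L (-x) = absk p L x := by
  rw [← neg_one_smul ℚ_[p] x, absk_smul]
  simp

theorem absk_sum_le_one (L : Type) [Field L] [Algebra ℚ_[p] L] [FiniteDimensional ℚ_[p] L]
    {ι : Type*} (s : Finset ι) (f : ι → L) (h : ∀ i ∈ s, absk p L (f i) ≤ 1) :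
    absk p L (∑ i ∈ s, f i) ≤ 1 :=
  Finset.sum_induction f (fun x => absk p L x ≤ 1)
    (fun x y hx hy => (absk_add_le p L x y).trans (max_le hx hy))
    (by simp [absk_zero]) h

theorem absk_smul_le_one (L : Type) [Field L] [Algebra ℚ_[p] L] [FiniteDimensional ℚ_[p] L]
    {c : ℚ_[p]} {x : L} {A : ℝ} (hA : absk p L x ≤ A) (hc : ‖c‖ < (1 + A)⁻¹) :
    absk p L (c • x) ≤ 1 := by
  have hA0 : 0 ≤ A := (absk_nonneg p L x).trans hA
  have hc1 : ‖c‖ ≤ 1 := hc.le.trans (inv_le_one_of_one_le₀ (by linarith))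
  have hpow : ‖c‖ ^ finrank ℚ_[p] L ≤ ‖c‖ :=
    pow_le_of_le_one (norm_nonneg _) hc1 finrank_pos.ne'
  rw [absk_smul]
  calc ‖c‖ ^ finrank ℚ_[p] L * absk p L x ≤ (1 + A)⁻¹ * (1 + A) :=
        mul_le_mul (hpow.trans hc.le) (by linarith) (absk_nonneg p L x) (by positivity)
    _ = 1 := inv_mul_cancel₀ (by positivity)

/-- The unit ball of `L` has a countable subset meeting, for every linear map `l : L → M`, each
coset of the preimage of the unit ball of `M`. -/
theorem exists_countable_absk_map_sub_le_one (L : Type) [Field L] [Algebra ℚ_[p] L]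
    [FiniteDimensional ℚ_[p] L] (M : Type) [Field M] [Algebra ℚ_[p] M]
    [FiniteDimensional ℚ_[p] M] :
    ∃ D : Set L, D.Countable ∧ (∀ d ∈ D, absk p L d ≤ 1) ∧
      ∀ (l : L →ₗ[ℚ_[p]] M) (y : L), absk p L y ≤ 1 → ∃ d ∈ D, absk p M (l (y - d)) ≤ 1 := by
  let b := finBasis ℚ_[p] L
  refine ⟨{x | absk p L x ≤ 1} ∩
      Set.range fun r : Fin (finrank ℚ_[p] L) → ℚ => ∑ i, ((r i : ℚ) : ℚ_[p]) • b i,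
    (Set.countable_range _).mono Set.inter_subset_right, fun d hd => hd.1, fun l y hy => ?_⟩
  have happrox : ∀ i, ∃ r : ℚ,
      ‖b.repr y i - r‖ < (1 + max (absk p L (b i)) (absk p M (l (b i))))⁻¹ := fun i =>
    Padic.rat_dense p _ (inv_pos.mpr (add_pos_of_pos_of_nonneg one_pos
      (le_max_of_le_left (absk_nonneg p L _))))
  choose r hr using happrox
  have hsub : y - ∑ i, ((r i : ℚ) : ℚ_[p]) • b i = ∑ i, (b.repr y i - r i) • b i := by
    simp only [sub_smul, Finset.sum_sub_distrib, b.sum_repr]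
  have hball : absk p L (y - ∑ i, ((r i : ℚ) : ℚ_[p]) • b i) ≤ 1 := by
    rw [hsub]
    exact absk_sum_le_one p L _ _ fun i _ => absk_smul_le_one p L (le_max_left _ _) (hr i)
  refine ⟨_, ⟨?_, r, rfl⟩, ?_⟩
  · have h := absk_add_le p L y (-(y - ∑ i, ((r i : ℚ) : ℚ_[p]) • b i))
    rw [absk_neg, add_neg_eq_iff_eq_add.mpr (add_sub_cancel _ _).symm] at h
    exact h.trans (max_le hy hball)
  · rw [hsub, map_sum]
    refine absk_sum_le_one p M _ _ fun i _ => ?_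
    rw [_root_.map_smul]
    exact absk_smul_le_one p M (le_max_right _ _) (hr i)

variable (k : Type) [Field k] [Algebra ℚ_[p] k] [FiniteDimensional ℚ_[p] k]
variable (L : Type) [Field L] [Algebra k L] [FiniteDimensional k L]

theorem absk_norm_add_le (x y : L) : absk p k (Algebra.norm k (x + y)) ≤
    max (absk p k (Algebra.norm k x)) (absk p k (Algebra.norm k y)) := by
  let _ : Algebra ℚ_[p] L := ((algebraMap k L).comp (algebraMap ℚ_[p] k)).toAlgebra
  have : IsScalarTower ℚ_[p] k L := IsScalarTower.of_algebraMap_eq fun _ => rfl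
  have : FiniteDimensional ℚ_[p] L := FiniteDimensional.trans ℚ_[p] k L
  have h := absk_add_le p L x y
  simp only [absk] at h ⊢
  simpa only [Algebra.norm_norm] using h

theorem absk_norm_neg (x : L) :
    absk p k (Algebra.norm k (-x)) = absk p k (Algebra.norm k x) := by
  let _ : Algebra ℚ_[p] L := ((algebraMap k L).comp (algebraMap ℚ_[p] k)).toAlgebra
  have : IsScalarTower ℚ_[p] k L := IsScalarTower.of_algebraMap_eq fun _ => rfl
  have : FiniteDimensional ℚ_[p] L := FiniteDimensional.trans ℚ_[p] k L
  have h := absk_neg p L x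
  simp only [absk] at h ⊢
  simpa only [Algebra.norm_norm] using h

theorem exists_countable_absk_norm_le_one :
    ∃ D : Set L, D.Countable ∧ (∀ d ∈ D, absk p k (Algebra.norm k d) ≤ 1) ∧
      ∀ (l : L →ₗ[k] k) (y : L), absk p k (Algebra.norm k y) ≤ 1 →
        ∃ d ∈ D, absk p k (l (y - d)) ≤ 1 := by
  let _ : Algebra ℚ_[p] L := ((algebraMap k L).comp (algebraMap ℚ_[p] k)).toAlgebra
  have : IsScalarTower ℚ_[p] k L := IsScalarTower.of_algebraMap_eq fun _ => rfl
  have : FiniteDimensional ℚ_[p] L := FiniteDimensional.trans ℚ_[p] k L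
  have hnorm : ∀ x : L, absk p k (Algebra.norm k x) = absk p L x := fun x => by
    simp only [absk, Algebra.norm_norm]
  obtain ⟨D, hDc, hD, happrox⟩ := exists_countable_absk_map_sub_le_one p L k
  simp only [hnorm]
  exact ⟨D, hDc, hD, fun l => happrox (l.restrictScalars ℚ_[p])⟩

end LocalFieldNorm

theorem ae_eq_one_of_integral_eq_one {X : Type*} {mX : MeasurableSpace X} {μ : Measure X}
    [IsProbabilityMeasure μ] {F : X → ℂ} (hF : ∀ x, ‖F x‖ = 1) (h : ∫ x, F x ∂μ = 1) :
    ∀ᵐ x ∂μ, F x = 1 := by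
  have hint : Integrable F μ := by
    by_contra hn
    rw [integral_undef hn] at h
    exact zero_ne_one h
  have hintre : Integrable (fun x => (F x).re) μ := hint.re
  have hre : ∫ x, (1 - (F x).re) ∂μ = 0 := by
    have hFre : ∫ x, (F x).re ∂μ = 1 := by
      have := integral_re hint
      simp only [h, RCLike.re_to_complex] at this
      simpa using this
    rw [integral_sub (integrable_const _) hintre, integral_const, hFre]
    simp
  have hnonneg : ∀ x, 0 ≤ 1 - (F x).re := fun x => by
    linarith [(Complex.re_le_norm (F x)).trans_eq (hF x)]
  filter_upwards [(integral_eq_zero_iff_of_nonneg hnonneg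
    ((integrable_const _).sub hintre)).mp hre] with x hx
  have hx1 : (F x).re = 1 := by
    simp only [Pi.zero_apply] at hx
    linarith
  have hx0 : (F x).im = 0 := by
    have hsq := Complex.sq_norm (F x)
    rw [hF, Complex.normSq_apply, hx1] at hsq
    nlinarith
  exact Complex.ext hx1 hx0

theorem statement_15
    (p : ℕ) [Fact (Nat.Prime p)]
    (k : Type) [Field k] [Algebra ℚ_[p] k] [FiniteDimensional ℚ_[p] k]
    (K : Type) [Field K] [Algebra k K] [CharZero K]
    (Kn : ℕ → IntermediateField k K)
    (hbot : Kn 1 = ⊥) (hmono : Monotone Kn)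
    [hfd : ∀ n, FiniteDimensional k (Kn n)]
    (hunion : ∀ x : K, ∃ n, x ∈ Kn n)
    (T : ℕ → K →ₗ[k] K)
    (hTmem : ∀ (n : ℕ) (x : K), T n x ∈ Kn n)
    (hTdef : ∀ (n ν : ℕ) (h : n ≤ ν) (x : K) (hx : x ∈ Kn ν),
      T n x = ((finrank k (Kn n) : K) / (finrank k (Kn ν) : K)) *
        (relTrace k K (Kn n) (Kn ν) (hmono h) ⟨x, hx⟩ : K))
    (Knorm : K → ℝ)
    (hKnorm : ∀ (n : ℕ) (x : K) (hx : x ∈ Kn n),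
      Knorm x = absk p k (Algebra.norm k (⟨x, hx⟩ : Kn n)) ^ ((finrank k (Kn n) : ℝ)⁻¹))
    (pairing : K → ProjLim k K Kn T → k)
    (hpair : ∀ (n : ℕ) (a : K) (ha : a ∈ Kn n) (x : ProjLim k K Kn T),
      pairing a x = (finrank k (Kn n) : k)⁻¹ *
        Algebra.trace k (Kn n) (⟨a * x.1 n, mul_mem ha (x.2.1 n)⟩ : Kn n))
    (q : ℕ → ℕ)
    (hq : ∀ n : ℕ, IsGreatest
      {r : ℝ | (∃ x : Kn n, Knorm ↑x ^ (finrank k (Kn n) : ℝ) = r) ∧ r < 1} ((q n : ℝ)⁻¹))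
    (χ : k → ℂ)
    (hχadd : ∀ x y : k, χ (x + y) = χ x * χ y)
    (hχnorm : ∀ x : k, ‖χ x‖ = 1)
    (hχcont : @Continuous _ _ (kTop p k) _ χ)
    (hχtriv : ∀ x : k, absk p k x ≤ 1 → χ x = 1)
    (hχrank : ∃ x : k, absk p k x ≤ (q 1 : ℝ) ∧ χ x ≠ 1)
    (d : ℕ → ℕ)
    (hd : ∀ (n : ℕ) (x : Kn n),
      Knorm ↑x ^ (finrank k (Kn n) : ℝ) ≤ (q n : ℝ) ^ (d n : ℝ) ↔
        ∀ y : Kn n, Knorm ↑y ≤ 1 → absk p k (Algebra.trace k (Kn n) (x * y)) ≤ 1)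
    (vol : ∀ n : ℕ, @MeasureTheory.Measure (Kn n) (KnMeas k K Kn Knorm n))
    (hvolinv : ∀ (n : ℕ) (a : Kn n) (A : Set (Kn n)),
      MeasurableSet[KnMeas k K Kn Knorm n] A → vol n ((fun z => a + z) ⁻¹' A) = vol n A)
    (hvolnorm : ∀ n : ℕ, vol n {z : Kn n | Knorm ↑z ≤ 1} = 1)
    (μ : @MeasureTheory.Measure (ProjLim k K Kn T) (projMeas k K Kn T Knorm))
    (hμprob : MeasureTheory.IsProbabilityMeasure μ)
    (hμradon : ∀ A : Set (ProjLim k K Kn T), MeasurableSet[projMeas k K Kn T Knorm] A →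
      μ A = ⨆ (C : Set (ProjLim k K Kn T))
        (_ : C ⊆ A ∧ @IsCompact _ (projTop k K Kn T Knorm) C), μ C)
    (hμchar : ∀ a : K, ∫ x, χ (pairing a x) ∂μ = if Knorm a ≤ 1 then (1 : ℂ) else 0)
    (α : ℝ) (hα : 0 < α) (n : ℕ) (hn : 1 ≤ n) (a : K) (ha : a ∈ Kn n) :
    ∀ᵐ x ∂μ,
      (∫ ξ : Kn n,
          χ ((finrank k (Kn n) : k)⁻¹ *
              Algebra.trace k (Kn n) (-(⟨x.1 n, x.2.1 n⟩ * ξ))) *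
            (if 1 < Knorm ↑ξ then ((Knorm ↑ξ ^ α : ℝ) : ℂ) else 0) *
            (∫ y, χ (pairing (↑ξ) y) * χ (pairing a y) ∂μ) ∂(vol n))
        = if Knorm a ≤ 1 then 0 else ((Knorm a ^ α : ℝ) : ℂ) * χ (pairing a x) := by
  have hm : 0 < finrank k (Kn n) := finrank_pos
  have hminv : (0 : ℝ) < (finrank k (Kn n) : ℝ)⁻¹ := inv_pos.mpr (Nat.cast_pos.mpr hm)
  have hval : ∀ x : Kn n, Knorm x =
      absk p k (Algebra.norm k x) ^ ((finrank k (Kn n) : ℝ)⁻¹) := fun x => hKnorm n x x.2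
  have hle_one : ∀ x : Kn n, Knorm x ≤ 1 ↔ absk p k (Algebra.norm k x) ≤ 1 := fun x => by
    rw [hval]
    refine ⟨fun h => ?_, fun h => Real.rpow_le_one (absk_nonneg p k _) h hminv.le⟩
    by_contra! hlt
    exact absurd h (not_le.mpr (Real.one_lt_rpow hlt hminv))
  have hadd : ∀ x y : Kn n, Knorm ((x + y : Kn n) : K) ≤ max (Knorm x) (Knorm y) := fun x y => by
    simp only [hval]
    rcases le_max_iff.mp (absk_norm_add_le p k (Kn n) x y) with h | h
    · exact le_max_of_le_left (Real.rpow_le_rpow (absk_nonneg p k _) h hminv.le)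
    · exact le_max_of_le_right (Real.rpow_le_rpow (absk_nonneg p k _) h hminv.le)
  have hneg : ∀ x : Kn n, Knorm ((-x : Kn n) : K) = Knorm x := fun x => by
    simp only [hval, absk_norm_neg]
  obtain ⟨a, rfl⟩ : ∃ b : Kn n, (b : K) = a := ⟨⟨a, ha⟩, rfl⟩
  -- The pairing, expressed through the linear functional of `y` on `Kn n`.
  let l : ProjLim k K Kn T → Kn n →ₗ[k] k := fun y =>
    (finrank k (Kn n) : k)⁻¹ • (Algebra.trace k (Kn n) ∘ₗ LinearMap.mulLeft k ⟨y.1 n, y.2.1 n⟩)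
  have hl : ∀ (y : ProjLim k K Kn T) (ξ : Kn n), (finrank k (Kn n) : k)⁻¹ *
      Algebra.trace k (Kn n) (⟨y.1 n, y.2.1 n⟩ * ξ) = l y ξ := fun y ξ => rfl
  have hpl : ∀ (ξ : Kn n) (y : ProjLim k K Kn T), pairing ξ y = l y ξ := fun ξ y => by
    rw [hpair n ξ ξ.2 y, ← hl]
    congr 2
    exact Subtype.ext (mul_comm _ _)
  have hinner : ∀ ξ : Kn n, ∫ y, χ (pairing (↑ξ) y) * χ (pairing a y) ∂μ =
      if Knorm ((ξ + a : Kn n) : K) ≤ 1 then (1 : ℂ) else 0 := fun ξ => by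
    rw [← hμchar]
    simp only [hpl, ← hχadd, map_add]
  -- Almost surely `χ ∘ l x` is trivial on the unit ball of `Kn n`.
  have htriv : ∀ᵐ x ∂μ, ∀ η : Kn n, Knorm η ≤ 1 → χ (l x η) = 1 := by
    obtain ⟨D, hDc, hD, happrox⟩ := exists_countable_absk_norm_le_one p k (Kn n)
    have hDae : ∀ᵐ x ∂μ, ∀ d ∈ D, χ (l x d) = 1 := by
      rw [ae_ball_iff hDc]
      intro d hd
      refine ae_eq_one_of_integral_eq_one (fun _ => hχnorm _) ?_
      simp only [← hpl, hμchar, if_pos ((hle_one d).mpr (hD d hd))]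
    filter_upwards [hDae] with x hx η hη
    obtain ⟨d, hd, hdη⟩ := happrox (l x) η ((hle_one η).mp hη)
    rw [← sub_add_cancel η d, map_add, hχadd, hχtriv _ hdη, hx d hd, one_mul]
  let B : Kn n → Set (Kn n) := fun c => {z | Knorm ((c + z : Kn n) : K) ≤ 1}
  have hBmeas : ∀ c, MeasurableSet[KnMeas k K Kn Knorm n] (B c) := fun c => by
    have hzero : Knorm 0 = 0 := by
      have := hval 0
      rw [Algebra.norm_zero, absk_zero, Real.zero_rpow hminv.ne'] at this
      simpa using this
    have hunion : B c = Subtype.val ⁻¹' ⋃ z : B c, {y : K | Knorm (y - (z : Kn n)) < 1} := by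
      ext y
      simp only [Set.mem_preimage, Set.mem_iUnion, Set.mem_ofPred_eq]
      refine ⟨fun hy => ⟨⟨y, hy⟩, by simp [hzero]⟩, fun ⟨z, hz⟩ => ?_⟩
      have h := hadd (y - z) (c + z)
      rw [sub_add_add_cancel, add_comm] at h
      exact h.trans (max_le hz.le z.2)
    have hopen : @IsOpen _ (KnTop k K Kn Knorm n) (B c) := by
      rw [hunion]
      refine ⟨_, ?_, rfl⟩
      exact @isOpen_iUnion _ _ (normTopology Knorm) _ fun z =>
        TopologicalSpace.isOpen_generateFrom_of_mem ⟨_, 1, one_pos, rfl⟩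
    exact MeasurableSpace.measurableSet_generateFrom hopen
  have hBvol : vol n (B a) = 1 := by
    have hB_zero : B 0 = {z : Kn n | Knorm z ≤ 1} := by simp [B]
    rw [← hvolnorm n, ← hB_zero, ← hvolinv n a _ (hBmeas 0), hB_zero]
    rfl
  filter_upwards [htriv] with x hx
  have hchar : ∀ ξ ∈ B a, χ ((finrank k (Kn n) : k)⁻¹ *
      Algebra.trace k (Kn n) (-(⟨x.1 n, x.2.1 n⟩ * ξ))) = χ (pairing a x) := fun ξ hξ => by
    have hsplit : -ξ = a + -(a + ξ) := by ring
    rw [← mul_neg, hl, hsplit, map_add, hχadd, hx _ ((hneg _).trans_le hξ), mul_one, hpl]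
  simp only [hinner]
  split_ifs with ha1
  · refine integral_eq_zero_of_ae (Filter.Eventually.of_forall fun ξ => ?_)
    simp only [Pi.zero_apply]
    by_cases hξ : 1 < Knorm ξ
    · rw [if_neg (c := Knorm _ ≤ 1), mul_zero]
      intro h
      have := hadd (ξ + a) (-a)
      rw [add_neg_cancel_right, hneg] at this
      exact absurd (this.trans (max_le h ha1)) (not_le.mpr hξ)
    · rw [if_neg hξ, mul_zero, zero_mul]
  · rw [not_le] at ha1
    have hB_norm : ∀ ξ ∈ B a, Knorm ξ = Knorm a := fun ξ hξ => by
      have h₁ := hadd (a + ξ) (-ξ)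
      have h₂ := hadd (a + ξ) (-a)
      rw [add_neg_cancel_right, hneg] at h₁
      rw [add_neg_cancel_comm, hneg] at h₂
      have h₃ : Knorm a ≤ Knorm ξ :=
        (le_max_iff.mp h₁).resolve_left (not_le.mpr (lt_of_le_of_lt hξ ha1))
      exact le_antisymm (h₂.trans (max_le (hξ.trans ha1.le) le_rfl)) h₃
    calc _ = ∫ ξ, (B a).indicator
          (fun _ => ((Knorm a ^ α : ℝ) : ℂ) * χ (pairing a x)) ξ ∂(vol n) := by
          congr 1
          funext ξ
          by_cases hξ : ξ ∈ B a
          · rw [Set.indicator_of_mem hξ, hchar ξ hξ, hB_norm ξ hξ, if_pos ha1, add_comm ξ a,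
              if_pos (c := Knorm _ ≤ 1) hξ, mul_one, mul_comm]
          · rw [Set.indicator_of_notMem hξ, add_comm ξ a, if_neg (c := Knorm _ ≤ 1) hξ, mul_zero]
      _ = _ := by
          rw [integral_indicator_const _ (hBmeas a), measureReal_def, hBvol]
          simp
end

section
/- Let α > 0 and let f ∈ E(K̄) satisfy ∫_{K̄} f(x) dμ(x) = 0. Then a function u ∈ E(K̄) satisfies D^α u = f μ-almost everywhere on K̄ if and only if u = D^{−α} f + C μ-almost everywhere for some constant C ∈ ℂ. -/
open MeasureTheory Module
open scoped Classical

/-- The spectral norm on a finite separable extension of a complete nonarchimedean field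
is the normalized absolute value of the field norm. -/
theorem spectralNorm_pow_finrank {F L : Type*} [NontriviallyNormedField F] [IsUltrametricDist F]
    [CompleteSpace F] [CharZero F] [Field L] [Algebra F L] [FiniteDimensional F L] (x : L) :
    spectralNorm F L x ^ finrank F L = ‖Algebra.norm F x‖ := by
  have hint : IsIntegral F x := Algebra.IsIntegral.isIntegral x
  have hdeg : (minpoly F x).natDegree ≠ 0 := (minpoly.natDegree_pos hint).ne'
  have h1 : spectralNorm F L x ^ (minpoly F x).natDegree = ‖(minpoly F x).coeff 0‖ := by
    rw [spectralNorm.spectralNorm_eq_norm_coeff_zero_rpow, one_div,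
      Real.rpow_inv_natCast_pow (norm_nonneg _) hdeg]
  have h2 : ‖Algebra.norm F (IntermediateField.AdjoinSimple.gen F x)‖ =
      ‖(minpoly F x).coeff 0‖ := by
    have h := Algebra.PowerBasis.norm_gen_eq_coeff_zero_minpoly
      (IntermediateField.adjoin.powerBasis hint)
    rw [IntermediateField.adjoin.powerBasis_gen, IntermediateField.minpoly_gen] at h
    rw [h, norm_mul, norm_pow, norm_neg, norm_one, one_pow, one_mul]
  have h3 : finrank F (IntermediateField.adjoin F {x}) = (minpoly F x).natDegree :=
    IntermediateField.adjoin.finrank hint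
  rw [Algebra.norm_eq_norm_adjoin, norm_pow, h2, ← h1, ← pow_mul, ← h3, finrank_mul_finrank]

theorem IsNonarchimedean.pow_nat {R : Type*} [Ring R] {f : R → ℝ} (hf : IsNonarchimedean f)
    (h0 : ∀ x, 0 ≤ f x) (N : ℕ) : IsNonarchimedean fun x => f x ^ N := by
  intro x y
  rcases le_total (f x) (f y) with h | h
  · exact le_max_of_le_right
      (pow_le_pow_left₀ (h0 _) ((hf x y).trans_eq (max_eq_right h)) N)
  · exact le_max_of_le_left
      (pow_le_pow_left₀ (h0 _) ((hf x y).trans_eq (max_eq_left h)) N)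

section FiniteDimensional

variable {F L : Type*} [NontriviallyNormedField F] [IsUltrametricDist F] [ProperSpace F]
  [Field L] [Algebra F L] [FiniteDimensional F L] {N : ℕ}

/-- Balls in a finite extension of a local field are totally bounded. -/
theorem exists_finset_cover_spectralNorm_pow (hN : N ≠ 0) (R : ℝ) {δ : ℝ} (hδ : 0 < δ) :
    ∃ t : Finset L, ∀ z : L, spectralNorm F L z ^ N ≤ R →
      ∃ w ∈ t, spectralNorm F L (z - w) ^ N < δ := by
  let := spectralNorm.normedField F L
  let := spectralNorm.normedSpace F L
  have : ProperSpace L := FiniteDimensional.proper F L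
  have hδ' : 0 < δ ^ ((N : ℝ)⁻¹) := Real.rpow_pos_of_pos hδ _
  obtain ⟨t, -, ht, hc⟩ := Metric.finite_approx_of_totallyBounded
    (isCompact_closedBall (0 : L) (max R 1)).totallyBounded _ hδ'
  refine ⟨ht.toFinset, fun z hz => ?_⟩
  have hz' : z ∈ Metric.closedBall (0 : L) (max R 1) := by
    rw [mem_closedBall_zero_iff]
    by_contra! h
    have h1 : 1 < ‖z‖ := (le_max_right _ _).trans_lt h
    have h2 : ‖z‖ ≤ ‖z‖ ^ N := le_self_pow₀ h1.le hN
    have h3 : ‖z‖ ^ N ≤ R := hz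
    exact absurd (h2.trans (h3.trans (le_max_left R 1))) (not_le.mpr h)
  obtain ⟨w, hw, hzw⟩ := Set.mem_iUnion₂.mp (hc hz')
  refine ⟨w, ht.mem_toFinset.mpr hw, ?_⟩
  have h : ‖z - w‖ < δ ^ ((N : ℝ)⁻¹) := by rwa [← dist_eq_norm]
  calc ‖z - w‖ ^ N < (δ ^ ((N : ℝ)⁻¹)) ^ N := pow_lt_pow_left₀ h (norm_nonneg _) hN
    _ = δ := Real.rpow_inv_natCast_pow hδ.le hN

/-- A linear map between finite extensions of a local field is bounded. -/
theorem exists_spectralNorm_pow_linearMap_le {M : Type*} [Field M] [Algebra F M]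
    [FiniteDimensional F M] (g : L →ₗ[F] M) (N : ℕ) :
    ∃ C : ℝ, 0 < C ∧ ∀ z, spectralNorm F M (g z) ^ N ≤ C * spectralNorm F L z ^ N := by
  let := spectralNorm.normedField F L
  let := spectralNorm.normedSpace F L
  let := spectralNorm.normedField F M
  let := spectralNorm.normedSpace F M
  obtain ⟨C, hC, h⟩ := (LinearMap.toContinuousLinearMap g).bound
  refine ⟨C ^ N, pow_pos hC N, fun z => ?_⟩
  rw [← mul_pow]
  exact pow_le_pow_left₀ (norm_nonneg (g z)) (h z) N

/-- A function on a finite extension of a local field which is locally constant is uniformly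
so on bounded sets. -/
theorem exists_uniform_locallyConstant_spectralNorm_pow (hN : N ≠ 0) {Y : Type*} {φ : L → Y}
    (hφ : ∀ z, ∃ ε > 0, ∀ w, spectralNorm F L (w - z) ^ N < ε → φ w = φ z) (R : ℝ) :
    ∃ δ > 0, ∀ z w, spectralNorm F L z ^ N ≤ R → spectralNorm F L (w - z) ^ N < δ →
      φ w = φ z := by
  let := spectralNorm.normedField F L
  let := spectralNorm.normedSpace F L
  have : ProperSpace L := FiniteDimensional.proper F L
  have hloc : IsLocallyConstant φ := by
    refine (IsLocallyConstant.iff_eventually_eq φ).mpr fun z => ?_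
    obtain ⟨ε, hε, h⟩ := hφ z
    have hcont : Continuous fun w : L => ‖w - z‖ ^ N := by fun_prop
    have : ∀ᶠ w in nhds z, ‖w - z‖ ^ N < ε :=
      hcont.continuousAt.eventually_lt continuousAt_const (by simpa [hN] using hε)
    exact this.mono fun w hw => h w hw
  obtain ⟨δ, hδ, h⟩ := lebesgue_number_lemma_of_metric
    (isCompact_closedBall (0 : L) (max R 1)) (c := fun y : Y => φ ⁻¹' {y})
    (fun y => hloc.isOpen_fiber y) (fun z _ => Set.mem_iUnion.mpr ⟨φ z, rfl⟩)
  refine ⟨δ ^ N, pow_pos hδ N, fun z w hz hw => ?_⟩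
  have hz' : z ∈ Metric.closedBall (0 : L) (max R 1) := by
    rw [mem_closedBall_zero_iff]
    by_contra! h
    have h1 : 1 < ‖z‖ := (le_max_right _ _).trans_lt h
    have h2 : ‖z‖ ≤ ‖z‖ ^ N := le_self_pow₀ h1.le hN
    have h3 : ‖z‖ ^ N ≤ R := hz
    exact absurd (h2.trans (h3.trans (le_max_left R 1))) (not_le.mpr h)
  obtain ⟨y, hy⟩ := h z hz'
  have hw' : w ∈ Metric.ball z δ := by
    rw [Metric.mem_ball, dist_eq_norm]
    exact lt_of_pow_lt_pow_left₀ N hδ.le hw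
  exact (hy hw').trans (hy (Metric.mem_ball_self hδ)).symm

end FiniteDimensional

/-- A subalgebra of functions interpolates, on a finite set, every function which is constant on
the classes of points it does not separate. -/
theorem Subalgebra.exists_eqOn_finset {X F : Type*} [Field F] (A : Subalgebra F (X → F))
    (s : Finset X) (ψ : X → F)
    (h : ∀ x ∈ s, ∀ y ∈ s, (∀ g ∈ A, g x = g y) → ψ x = ψ y) :
    ∃ g ∈ A, ∀ x ∈ s, g x = ψ x := by
  induction s using Finset.induction_on with
  | empty => exact ⟨0, A.zero_mem, by simp⟩
  | insert x s hx ih =>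
    obtain ⟨g, hg, hgs⟩ := ih fun a ha b hb =>
      h a (Finset.mem_insert_of_mem ha) b (Finset.mem_insert_of_mem hb)
    by_cases hsep : ∃ y ∈ s, ∀ e ∈ A, e x = e y
    · obtain ⟨y, hy, hxy⟩ := hsep
      refine ⟨g, hg, fun z hz => ?_⟩
      rcases Finset.mem_insert.mp hz with rfl | hz
      · rw [hxy g hg, hgs y hy]
        exact (h z (Finset.mem_insert_self _ _) y (Finset.mem_insert_of_mem hy) hxy).symm
      · exact hgs z hz
    · push Not at hsep
      choose! e he hne using hsep
      let f : X → F := ∏ y ∈ s, (e y - algebraMap F (X → F) (e y y))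
      have hf : f ∈ A := A.prod_mem fun y hy => A.sub_mem (he y hy) (A.algebraMap_mem _)
      have hfv : ∀ z, f z = ∏ y ∈ s, (e y z - e y y) := fun z => by
        simp [f, Finset.prod_apply]
      have hfx : f x ≠ 0 := by
        rw [hfv]
        exact Finset.prod_ne_zero_iff.mpr fun y hy => sub_ne_zero.mpr (hne y hy)
      have hfs : ∀ z ∈ s, f z = 0 := fun z hz => by
        rw [hfv]
        exact Finset.prod_eq_zero hz (sub_self _)
      refine ⟨g + ((ψ x - g x) / f x) • f, A.add_mem hg (A.smul_mem hf _), fun z hz => ?_⟩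
      rcases Finset.mem_insert.mp hz with rfl | hz
      · simp [hfx]
      · simp [hfs z hz, hgs z hz]

section LocalFourier

variable {E : Type*} [Field E] {v : AbsoluteValue E ℝ} {ψ : AddChar E ℂ}

/-- On the annihilator of the unit ball, a uniformly locally constant function is a finite
combination of characters. -/
theorem exists_eq_linearCombination_addChar
    (hcover : ∀ R δ : ℝ, 0 < δ → ∃ t : Finset E, ∀ z, v z ≤ R → ∃ w ∈ t, v (z - w) < δ)
    (hψ : ∃ r > 0, ∀ z, v z ≤ r → ψ z = 1) {c₀ : E} (hc₀ : ψ c₀ ≠ 1) {φ : E → ℂ}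
    (hφ : ∀ R : ℝ, ∃ δ > 0, ∀ z w, v z ≤ R → v (w - z) < δ → φ w = φ z) :
    ∃ c : E →₀ ℂ, ∀ z, (∀ a, v a ≤ 1 → ψ (a * z) = 1) →
      φ z = Finsupp.linearCombination ℂ (fun η => ψ (-(η * z))) c := by
  obtain ⟨r, hr, hψr⟩ := hψ
  have hbound : ∀ R z, (∀ a, v a ≤ R → ψ (a * z) = 1) → R * v z ≤ v c₀ := by
    intro R z hz
    rcases eq_or_ne z 0 with rfl | hz0
    · simp
    · by_contra! h
      refine hc₀ ?_
      rw [← hz (c₀ / z) ?_, div_mul_cancel₀ _ hz0]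
      rw [map_div₀, div_le_iff₀ (v.pos hz0)]
      exact h.le
  obtain ⟨δ, hδ, hφδ⟩ := hφ (v c₀)
  set R : ℝ := max 1 (v c₀ / δ + 1) with hR
  have hR1 : 1 ≤ R := le_max_left _ _
  have hR0 : 0 < R := one_pos.trans_le hR1
  have hsmall : ∀ z, (∀ a, v a ≤ R → ψ (a * z) = 1) → v z < δ := by
    intro z hz
    have h1 := hbound R z hz
    have h2 : v c₀ / δ < R := (lt_add_one _).trans_le (le_max_right _ _)
    rw [div_lt_iff₀ hδ] at h2
    exact lt_of_mul_lt_mul_left (h1.trans_lt h2) hR0.le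
  have hann : ∀ z, v z < r / R → ∀ a, v a ≤ R → ψ (a * z) = 1 := by
    intro z hz a ha
    refine hψr _ ?_
    rw [map_mul]
    calc v a * v z ≤ R * (r / R) := mul_le_mul ha hz.le (v.nonneg _) hR0.le
      _ = r := mul_div_cancel₀ _ hR0.ne'
  let S : Set (E → ℂ) := {g | ∃ a, v a ≤ R ∧ g = fun z => ψ (a * z)}
  have hinv : ∀ z w, (∀ a, v a ≤ R → ψ (a * (z - w)) = 1) →
      ∀ g ∈ Algebra.adjoin ℂ S, g z = g w := by
    intro z w hzw g hg
    induction hg using Algebra.adjoin_induction with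
    | mem g hg =>
      obtain ⟨a, ha, rfl⟩ := hg
      have h : a * z = a * (z - w) + a * w := by ring
      change ψ (a * z) = ψ (a * w)
      rw [h, AddChar.map_add_eq_mul, hzw a ha, one_mul]
    | algebraMap s => rfl
    | add f g _ _ hf hg => simp [hf, hg]
    | mul f g _ _ hf hg => simp [hf, hg]
  obtain ⟨t, ht⟩ := hcover (v c₀) (r / R) (div_pos hr hR0)
  let B : Set E := {z | ∀ a, v a ≤ 1 → ψ (a * z) = 1}
  have hB : ∀ z ∈ B, v z ≤ v c₀ := fun z hz => by simpa using hbound 1 z hz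
  obtain ⟨g, hg, hgt⟩ := (Algebra.adjoin ℂ S).exists_eqOn_finset (t.filter (· ∈ B)) φ <| by
    intro x hx y hy hxy
    refine (hφδ x y (hB x (Finset.mem_filter.mp hx).2) (hsmall _ fun a ha => ?_)).symm
    have h := hxy (fun z => ψ (a * z)) (Algebra.subset_adjoin ⟨a, ha, rfl⟩)
    rw [mul_sub, AddChar.map_sub_eq_div, ← h, div_self]
    exact (AddChar.val_isUnit ψ _).ne_zero
  have hspan : g ∈ Submodule.span ℂ (Set.range fun (η : E) (z : E) => ψ (-(η * z))) := by
    rw [← Subalgebra.mem_toSubmodule, Algebra.adjoin_eq_span] at hg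
    refine Submodule.span_mono (fun f hf => ?_) hg
    induction hf using Submonoid.closure_induction with
    | mem f hf =>
      obtain ⟨a, -, rfl⟩ := hf
      exact ⟨-a, by simp⟩
    | one => exact ⟨0, by ext; simp⟩
    | mul f g _ _ hf hg =>
      obtain ⟨a, rfl⟩ := hf
      obtain ⟨b, rfl⟩ := hg
      refine ⟨a + b, ?_⟩
      ext z
      simp only [Pi.mul_apply, ← AddChar.map_add_eq_mul]
      congr 1
      ring
  obtain ⟨c, hc⟩ := Finsupp.mem_span_range_iff_exists_finsupp.mp hspan
  refine ⟨c, fun z hz => ?_⟩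
  obtain ⟨w, hw, hzw⟩ := ht z (hB z hz)
  have hzwR := hann _ hzw
  have hwB : w ∈ B := fun a ha => by
    have h : a * w = a * z - a * (z - w) := by ring
    rw [h, AddChar.map_sub_eq_div, hz a ha, hzwR a (ha.trans hR1), div_one]
  have h1 : g z = g w := hinv z w hzwR g hg
  have h2 : φ z = φ w := hφδ w z (hB w hwB) (hsmall _ hzwR)
  rw [h2, ← hgt w (Finset.mem_filter.mpr ⟨hw, hwB⟩), ← h1, ← hc, Finsupp.linearCombination_apply]
  simp [Finsupp.sum, Finset.sum_apply]

/-- A random variable whose characteristic function equals one on the unit ball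
lies almost surely in the annihilator of the unit ball. -/
theorem ae_addChar_mul_eq_one {X : Type*} [MeasurableSpace X] {μ : Measure X}
    [IsProbabilityMeasure μ] (hv : IsNonarchimedean v)
    (hcover : ∀ R δ : ℝ, 0 < δ → ∃ t : Finset E, ∀ z, v z ≤ R → ∃ w ∈ t, v (z - w) < δ)
    (hψ : ∃ r > 0, ∀ z, v z ≤ r → ψ z = 1) (hnorm : ∀ z, ‖ψ z‖ = 1) {ρ : X → E}
    (hint : ∀ a, v a ≤ 1 → ∫ x, ψ (a * ρ x) ∂μ = 1) :
    ∀ᵐ x ∂μ, ∀ a, v a ≤ 1 → ψ (a * ρ x) = 1 := by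
  obtain ⟨r, hr, hψr⟩ := hψ
  have hone : ∀ a, v a ≤ 1 → ∀ᵐ x ∂μ, ψ (a * ρ x) = 1 := by
    intro a ha
    have hi : Integrable (fun x => ψ (a * ρ x)) μ := by
      by_contra h
      exact one_ne_zero ((hint a ha).symm.trans (integral_undef h))
    have hi' : Integrable (fun x => 1 - (ψ (a * ρ x)).re) μ :=
      (integrable_const _).sub hi.re
    have h0 : ∫ x, (1 - (ψ (a * ρ x)).re) ∂μ = 0 := by
      have hre : ∫ x, (ψ (a * ρ x)).re ∂μ = (∫ x, ψ (a * ρ x) ∂μ).re := integral_re hi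
      have hsub : ∫ x, (1 - (ψ (a * ρ x)).re) ∂μ = ∫ _, (1 : ℝ) ∂μ - ∫ x, (ψ (a * ρ x)).re ∂μ :=
        integral_sub (integrable_const _) hi.re
      rw [hsub, hre, hint a ha]
      simp
    have hle : ∀ x, (ψ (a * ρ x)).re ≤ 1 := fun x =>
      (Complex.re_le_norm _).trans (hnorm _).le
    filter_upwards [(integral_eq_zero_iff_of_nonneg
      (fun x => sub_nonneg.mpr (hle x)) hi').mp h0] with x hx
    have hx1 : (ψ (a * ρ x)).re = 1 := (sub_eq_zero.mp hx).symm
    have hx2 := Complex.sq_norm_sub_sq_re (ψ (a * ρ x))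
    rw [hnorm, hx1] at hx2
    exact Complex.ext hx1 (by simpa using hx2.symm)
  choose t ht using fun j : ℕ => hcover 1 (1 / ((j : ℝ) + 1)) Nat.one_div_pos_of_nat
  have hall : ∀ᵐ x ∂μ, ∀ j, ∀ a ∈ t j, v a ≤ 1 → ψ (a * ρ x) = 1 := by
    refine ae_all_iff.mpr fun j => (ae_ball_iff (t j).countable_toSet).mpr fun a _ => ?_
    by_cases ha : v a ≤ 1
    · exact (hone a ha).mono fun x hx _ => hx
    · exact Filter.Eventually.of_forall fun x h => absurd h ha
  filter_upwards [hall] with x hx a ha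
  obtain ⟨j, hj⟩ := exists_nat_one_div_lt (div_pos hr (add_pos_of_nonneg_of_pos
    (v.nonneg (ρ x)) one_pos))
  obtain ⟨w, hw, haw⟩ := ht j a ha
  have hw1 : v w ≤ 1 := by
    have h : w = a + -(a - w) := by ring
    rw [h]
    refine (hv _ _).trans (max_le ha ?_)
    rw [v.map_neg]
    refine haw.le.trans ?_
    rw [div_le_one (by positivity)]
    exact le_add_of_nonneg_left (Nat.cast_nonneg j)
  have hsmall : ψ ((a - w) * ρ x) = 1 := by
    refine hψr _ ?_
    rw [map_mul]
    have h1 := (lt_div_iff₀ (add_pos_of_nonneg_of_pos (v.nonneg (ρ x)) one_pos)).mp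
      (haw.trans hj)
    nlinarith [v.nonneg (a - w)]
  have h : a * ρ x = (a - w) * ρ x + w * ρ x := by ring
  rw [h, AddChar.map_add_eq_mul, hsmall, hx j w hw hw1, one_mul]

/-- The inverse Fourier transform of a multiple of the transform of a finite combination of
characters, when the multiplier is constant on unit balls. -/
theorem integral_addChar_mul_linearCombination [MeasurableSpace E] {ν : Measure E}
    (hmeas : ∀ η, MeasurableSet {ξ | v (ξ - η) ≤ 1}) (hvol : ∀ η, ν {ξ | v (ξ - η) ≤ 1} = 1)
    {Δ : E → ℂ} (hΔ : ∀ ξ η, v (ξ - η) ≤ 1 → Δ ξ = Δ η) {z : E}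
    (hz : ∀ a, v a ≤ 1 → ψ (a * z) = 1) (c : E →₀ ℂ) :
    ∫ ξ, ψ (-(z * ξ)) * Δ ξ *
        Finsupp.linearCombination ℂ (fun η => if v (ξ - η) ≤ 1 then (1 : ℂ) else 0) c ∂ν =
      Finsupp.linearCombination ℂ (fun η => Δ η * ψ (-(η * z))) c := by
  suffices h : Integrable (fun ξ => ψ (-(z * ξ)) * Δ ξ *
        Finsupp.linearCombination ℂ (fun η => if v (ξ - η) ≤ 1 then (1 : ℂ) else 0) c) ν ∧
      ∫ ξ, ψ (-(z * ξ)) * Δ ξ *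
        Finsupp.linearCombination ℂ (fun η => if v (ξ - η) ≤ 1 then (1 : ℂ) else 0) c ∂ν =
      Finsupp.linearCombination ℂ (fun η => Δ η * ψ (-(η * z))) c from h.2
  induction c using Finsupp.induction_linear with
  | zero => simp
  | add c d hc hd =>
    simp only [map_add, mul_add]
    exact ⟨hc.1.add hd.1, (integral_add hc.1 hd.1).trans (congrArg₂ _ hc.2 hd.2)⟩
  | single η b =>
    have heq : (fun ξ => ψ (-(z * ξ)) * Δ ξ * Finsupp.linearCombination ℂ
        (fun η => if v (ξ - η) ≤ 1 then (1 : ℂ) else 0) (Finsupp.single η b)) =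
        {ξ | v (ξ - η) ≤ 1}.indicator fun _ => b * (Δ η * ψ (-(η * z))) := by
      ext ξ
      by_cases h : v (ξ - η) ≤ 1
      · have hψ : ψ (-(z * ξ)) = ψ (-(η * z)) := by
          have h1 : -(z * ξ) = -(η * z) - (ξ - η) * z := by ring
          rw [h1, AddChar.map_sub_eq_div, hz _ h, div_one]
        simp only [Finsupp.linearCombination_single, h, if_true, smul_eq_mul, mul_one,
          Set.indicator, Set.mem_ofPred_eq, hψ, hΔ ξ η h]
        ring
      · simp [h, Set.indicator]
    rw [heq]
    constructor
    · rw [integrable_indicator_iff (hmeas η)]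
      exact integrableOn_const (by simp [hvol])
    · rw [integral_indicator_const _ (hmeas η)]
      simp [Measure.real, hvol]

end LocalFourier

theorem linearCombination_trig_mul {K X : Type*} [AddCommGroup K] {e : X → AddChar K ℂ}
    (Δ : K → ℂ) (c : K →₀ ℂ) (x : X) :
    Finsupp.linearCombination ℂ (fun η => e x (-η))
        (Finsupp.linearCombination ℂ (fun η => Finsupp.single η (Δ η)) c) =
      Finsupp.linearCombination ℂ (fun η => Δ η * e x (-η)) c := by
  induction c using Finsupp.induction_linear with
  | zero => simp
  | add c d hc hd => simp only [map_add, hc, hd]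
  | single η b =>
    simp only [Finsupp.linearCombination_single, Finsupp.smul_single, smul_eq_mul, mul_assoc]

section TrigonometricPolynomials

variable {K X : Type*} [AddCommGroup K] [MeasurableSpace X] {μ : Measure X}
  [IsProbabilityMeasure μ] {v : K → ℝ} {e : X → AddChar K ℂ}

/-- The Fourier coefficients of a finite combination of characters. -/
theorem integral_addChar_mul_trig (hnorm : ∀ x a, ‖e x a‖ = 1)
    (hmeas : ∀ a, Measurable fun x => e x a)
    (hchar : ∀ a, ∫ x, e x a ∂μ = if v a ≤ 1 then (1 : ℂ) else 0) (c : K →₀ ℂ) (ξ : K) :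
    Integrable (fun x => e x ξ * Finsupp.linearCombination ℂ (fun η => e x (-η)) c) μ ∧
      ∫ x, e x ξ * Finsupp.linearCombination ℂ (fun η => e x (-η)) c ∂μ =
        Finsupp.linearCombination ℂ (fun η => if v (ξ - η) ≤ 1 then (1 : ℂ) else 0) c := by
  have hi : ∀ a, Integrable (fun x => e x a) μ := fun a =>
    Integrable.of_bound (hmeas a).aestronglyMeasurable 1
      (Filter.Eventually.of_forall fun x => (hnorm x a).le)
  induction c using Finsupp.induction_linear with
  | zero => simp
  | add c d hc hd =>
    simp only [map_add, mul_add]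
    exact ⟨hc.1.add hd.1, (integral_add hc.1 hd.1).trans (congrArg₂ _ hc.2 hd.2)⟩
  | single η b =>
    have h : ∀ x, e x ξ * Finsupp.linearCombination ℂ (fun η => e x (-η)) (Finsupp.single η b) =
        b * e x (ξ - η) := fun x => by
      rw [Finsupp.linearCombination_single, smul_eq_mul, sub_eq_add_neg, AddChar.map_add_eq_mul]
      ring
    simp only [h]
    refine ⟨(hi _).const_mul b, ?_⟩
    rw [integral_const_mul, hchar, Finsupp.linearCombination_single, smul_eq_mul]

/-- Uniqueness of Fourier coefficients for finite combinations of characters. -/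
theorem trig_ae_eq_iff (hnorm : ∀ x a, ‖e x a‖ = 1) (hmeas : ∀ a, Measurable fun x => e x a)
    (hchar : ∀ a, ∫ x, e x a ∂μ = if v a ≤ 1 then (1 : ℂ) else 0) (c d : K →₀ ℂ) :
    (∀ᵐ x ∂μ, Finsupp.linearCombination ℂ (fun η => e x (-η)) c =
        Finsupp.linearCombination ℂ (fun η => e x (-η)) d) ↔
      ∀ ξ, Finsupp.linearCombination ℂ (fun η => if v (ξ - η) ≤ 1 then (1 : ℂ) else 0) c =
        Finsupp.linearCombination ℂ (fun η => if v (ξ - η) ≤ 1 then (1 : ℂ) else 0) d := by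
  have hF := integral_addChar_mul_trig hnorm hmeas hchar
  constructor
  · intro h ξ
    rw [← (hF c ξ).2, ← (hF d ξ).2]
    exact integral_congr_ae (h.mono fun x hx => by simp only [hx])
  · intro h
    set b := c - d with hb
    have hb0 : ∀ ξ, Finsupp.linearCombination ℂ
        (fun η => if v (ξ - η) ≤ 1 then (1 : ℂ) else 0) b = 0 := fun ξ => by
      rw [hb, map_sub, h ξ, sub_self]
    have hconj : ∀ x η, (starRingEnd ℂ) (e x (-η)) = e x η := fun x η => by
      rw [AddChar.map_neg_eq_inv, Complex.inv_def, Complex.normSq_eq_norm_sq, hnorm]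
      simp
    have horth : ∀ a : K →₀ ℂ, Integrable (fun x =>
        (starRingEnd ℂ) (Finsupp.linearCombination ℂ (fun η => e x (-η)) a) *
          Finsupp.linearCombination ℂ (fun η => e x (-η)) b) μ ∧
        ∫ x, (starRingEnd ℂ) (Finsupp.linearCombination ℂ (fun η => e x (-η)) a) *
          Finsupp.linearCombination ℂ (fun η => e x (-η)) b ∂μ = 0 := by
      intro a
      induction a using Finsupp.induction_linear with
      | zero => simp
      | add a a' ha ha' =>
        simp only [map_add, add_mul]
        refine ⟨ha.1.add ha'.1, ?_⟩
        rw [integral_add ha.1 ha'.1, ha.2, ha'.2, add_zero]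
      | single η s =>
        simp only [Finsupp.linearCombination_single, smul_eq_mul, map_mul, hconj, mul_assoc]
        refine ⟨(hF b η).1.const_mul _, ?_⟩
        rw [integral_const_mul, (hF b η).2, hb0, mul_zero]
    have hsq : ∀ z : ℂ, ((starRingEnd ℂ) z * z).re = ‖z‖ ^ 2 := fun z => by
      rw [← Complex.normSq_eq_conj_mul_self, Complex.ofReal_re, Complex.normSq_eq_norm_sq]
    have hint : Integrable
        (fun x => ‖Finsupp.linearCombination ℂ (fun η => e x (-η)) b‖ ^ 2) μ := by
      simpa only [RCLike.re_to_complex, hsq] using (horth b).1.re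
    have hzero : ∫ x, ‖Finsupp.linearCombination ℂ (fun η => e x (-η)) b‖ ^ 2 ∂μ = 0 := by
      have hre := integral_re (horth b).1
      simpa only [RCLike.re_to_complex, hsq, (horth b).2, Complex.zero_re] using hre
    filter_upwards [(integral_eq_zero_iff_of_nonneg (fun x => by positivity) hint).mp hzero]
      with x hx
    have hx' : Finsupp.linearCombination ℂ (fun η => e x (-η)) b = 0 := by simpa using hx
    rwa [hb, map_sub, sub_eq_zero] at hx'

theorem linearCombination_ite_mul {Δ : K → ℂ} (hΔ : ∀ ξ η, v (ξ - η) ≤ 1 → Δ ξ = Δ η)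
    (c : K →₀ ℂ) (ξ : K) :
    Finsupp.linearCombination ℂ (fun η => if v (ξ - η) ≤ 1 then (1 : ℂ) else 0)
        (Finsupp.linearCombination ℂ (fun η => Finsupp.single η (Δ η)) c) =
      Δ ξ * Finsupp.linearCombination ℂ (fun η => if v (ξ - η) ≤ 1 then (1 : ℂ) else 0) c := by
  induction c using Finsupp.induction_linear with
  | zero => simp
  | add c d hc hd => simp only [map_add, hc, hd, mul_add]
  | single η b =>
    simp only [Finsupp.linearCombination_single, Finsupp.smul_single]
    by_cases h : v (ξ - η) ≤ 1
    · simp [h, hΔ ξ η h, mul_comm]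
    · simp [h]

/-- Inversion of Fourier multipliers on finite combinations of characters. -/
theorem trig_multiplier_eq_iff (hv : IsNonarchimedean v) (hneg : ∀ a, v (-a) = v a)
    (hnorm : ∀ x a, ‖e x a‖ = 1) (hmeas : ∀ a, Measurable fun x => e x a)
    (hchar : ∀ a, ∫ x, e x a ∂μ = if v a ≤ 1 then (1 : ℂ) else 0)
    {Δ Δ' : K → ℂ} (hΔ : ∀ ξ η, v (ξ - η) ≤ 1 → Δ ξ = Δ η)
    (hΔ' : ∀ ξ η, v (ξ - η) ≤ 1 → Δ' ξ = Δ' η)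
    (hzero : ∀ ξ, v ξ ≤ 1 → Δ ξ = 0 ∧ Δ' ξ = 0) (hmul : ∀ ξ, 1 < v ξ → Δ ξ * Δ' ξ = 1)
    (c d : K →₀ ℂ)
    (hd : ∫ x, Finsupp.linearCombination ℂ (fun η => e x (-η)) d ∂μ = 0) :
    (∀ᵐ x ∂μ, Finsupp.linearCombination ℂ (fun η => Δ η * e x (-η)) c =
        Finsupp.linearCombination ℂ (fun η => e x (-η)) d) ↔
      ∃ C : ℂ, ∀ᵐ x ∂μ, Finsupp.linearCombination ℂ (fun η => e x (-η)) c =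
        Finsupp.linearCombination ℂ (fun η => Δ' η * e x (-η)) d + C := by
  let H (b : K →₀ ℂ) (ξ : K) : ℂ :=
    Finsupp.linearCombination ℂ (fun η => if v (ξ - η) ≤ 1 then (1 : ℂ) else 0) b
  have hsymm : ∀ ξ η, v (ξ - η) = v (η - ξ) := fun ξ η => by rw [← hneg, neg_sub]
  have hball : ∀ b ξ, v ξ ≤ 1 → H b ξ = H b 0 := by
    intro b ξ hξ
    have h : ∀ η, v (ξ - η) ≤ 1 ↔ v (0 - η) ≤ 1 := fun η => by
      rw [zero_sub]
      constructor
      · intro h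
        rw [show -η = (ξ - η) + -ξ by abel]
        exact (hv _ _).trans (max_le h ((hneg ξ).trans_le hξ))
      · intro h
        rw [sub_eq_add_neg]
        exact (hv _ _).trans (max_le hξ h)
    simp only [H, h]
  have hd0 : ∀ ξ, v ξ ≤ 1 → H d ξ = 0 := by
    intro ξ hξ
    rw [hball d ξ hξ]
    have h := (integral_addChar_mul_trig hnorm hmeas hchar d 0).2
    simp only [AddChar.map_zero_eq_one, one_mul, hd] at h
    exact h.symm
  have hleft : (∀ᵐ x ∂μ, Finsupp.linearCombination ℂ (fun η => Δ η * e x (-η)) c =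
      Finsupp.linearCombination ℂ (fun η => e x (-η)) d) ↔ ∀ ξ, Δ ξ * H c ξ = H d ξ := by
    simp only [← linearCombination_trig_mul, trig_ae_eq_iff hnorm hmeas hchar,
      linearCombination_ite_mul hΔ, H]
  have hright : ∀ C : ℂ, (∀ᵐ x ∂μ, Finsupp.linearCombination ℂ (fun η => e x (-η)) c =
      Finsupp.linearCombination ℂ (fun η => Δ' η * e x (-η)) d + C) ↔
      ∀ ξ, H c ξ = Δ' ξ * H d ξ + (if v ξ ≤ 1 then C else 0) := by
    intro C
    have hC : ∀ x, C = Finsupp.linearCombination ℂ (fun η => e x (-η)) (Finsupp.single 0 C) :=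
      fun x => by simp
    have hrw : (∀ᵐ x ∂μ, Finsupp.linearCombination ℂ (fun η => e x (-η)) c =
      Finsupp.linearCombination ℂ (fun η => Δ' η * e x (-η)) d + C) ↔
      ∀ᵐ x ∂μ, Finsupp.linearCombination ℂ (fun η => e x (-η)) c =
      Finsupp.linearCombination ℂ (fun η => e x (-η))
        (Finsupp.linearCombination ℂ (fun η => Finsupp.single η (Δ' η)) d +
          Finsupp.single 0 C) := by
      simp only [map_add, linearCombination_trig_mul, ← hC]
    rw [hrw, trig_ae_eq_iff hnorm hmeas hchar]
    simp only [map_add, linearCombination_ite_mul hΔ', Finsupp.linearCombination_single, sub_zero,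
      smul_eq_mul, mul_ite, mul_one, mul_zero, H]
  rw [hleft]
  simp only [hright]
  constructor
  · intro h
    refine ⟨H c 0, fun ξ => ?_⟩
    by_cases hξ : v ξ ≤ 1
    · simp [hξ, (hzero ξ hξ).2, hball c ξ hξ]
    · rw [if_neg hξ, add_zero, ← h ξ, ← mul_assoc, mul_comm (Δ' ξ), hmul ξ (not_le.mp hξ), one_mul]
  · rintro ⟨C, h⟩ ξ
    by_cases hξ : v ξ ≤ 1
    · rw [(hzero ξ hξ).1, zero_mul, hd0 ξ hξ]
    · rw [h ξ, if_neg hξ, add_zero, ← mul_assoc, hmul ξ (not_le.mp hξ), one_mul]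

end TrigonometricPolynomials

section Topology

theorem exists_ball_subset_of_isOpen_normTopology {K : Type} [Ring K] {f : K → ℝ}
    (hf : IsNonarchimedean f) {U : Set K} (hU : @IsOpen _ (normTopology f) U) :
    ∀ z ∈ U, ∃ ε > 0, ∀ w, f (w - z) < ε → w ∈ U := by
  induction hU with
  | basic s hs =>
    obtain ⟨x, ε, hε, rfl⟩ := hs
    refine fun z hz => ⟨ε, hε, fun w hw => ?_⟩
    change f (w - x) < ε
    rw [← sub_add_sub_cancel w z x]
    exact (hf _ _).trans_lt (max_lt hw hz)
  | univ => exact fun z _ => ⟨1, one_pos, fun w _ => trivial⟩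
  | inter s t _ _ hs ht =>
    intro z hz
    obtain ⟨ε, hε, h⟩ := hs z hz.1
    obtain ⟨ε', hε', h'⟩ := ht z hz.2
    exact ⟨min ε ε', lt_min hε hε', fun w hw =>
      ⟨h w (hw.trans_le (min_le_left _ _)), h' w (hw.trans_le (min_le_right _ _))⟩⟩
  | sUnion S _ hS =>
    rintro z ⟨s, hs, hz⟩
    obtain ⟨ε, hε, h⟩ := hS s hs z hz
    exact ⟨ε, hε, fun w hw => ⟨s, hs, h w hw⟩⟩

variable {k K : Type} [Field k] [Field K] [Algebra k K] {Kn : ℕ → IntermediateField k K}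
  {T : ℕ → K →ₗ[k] K} {f : K → ℝ}

theorem exists_ball_eq_of_isLocallyConstant_KnTop (hf : IsNonarchimedean f) {n : ℕ} {Y : Type*}
    {φ : Kn n → Y} (hφ : @IsLocallyConstant _ _ (KnTop k K Kn f n) φ) (z : Kn n) :
    ∃ ε > 0, ∀ w : Kn n, f ((w - z : Kn n) : K) < ε → φ w = φ z := by
  obtain ⟨V, hV, hVφ⟩ := hφ {φ z}
  have hz : (z : K) ∈ V := by
    rw [← Set.mem_preimage, hVφ]
    rfl
  obtain ⟨ε, hε, h⟩ := exists_ball_subset_of_isOpen_normTopology hf hV z hz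
  refine ⟨ε, hε, fun w hw => ?_⟩
  have hw' : w ∈ Subtype.val ⁻¹' V := h w hw
  rwa [hVφ] at hw'

theorem measurableSet_closedBall_KnMeas (n : ℕ) (η : Kn n) {R : ℝ} (hR : 0 ≤ R) :
    MeasurableSet[KnMeas k K Kn f n] {ξ : Kn n | f ((ξ - η : Kn n) : K) ≤ R} := by
  let := KnMeas k K Kn f n
  have h : {ξ : Kn n | f ((ξ - η : Kn n) : K) ≤ R} =
      ⋂ j : ℕ, {ξ : Kn n | f ((ξ - η : Kn n) : K) < R + 1 / ((j : ℝ) + 1)} := by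
    ext ξ
    simp only [Set.mem_ofPred_eq, Set.mem_iInter]
    constructor
    · exact fun h j => h.trans_lt (lt_add_of_pos_right _ Nat.one_div_pos_of_nat)
    · intro h
      refine le_of_forall_pos_le_add fun ε hε => ?_
      obtain ⟨j, hj⟩ := exists_nat_one_div_lt hε
      exact (h j).le.trans (by gcongr)
  rw [h]
  refine MeasurableSet.iInter fun j => ?_
  have hopen : @IsOpen _ (KnTop k K Kn f n)
      {ξ : Kn n | f ((ξ - η : Kn n) : K) < R + 1 / ((j : ℝ) + 1)} := by
    have hpos : 0 < R + 1 / ((j : ℝ) + 1) := add_pos_of_nonneg_of_pos hR Nat.one_div_pos_of_nat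
    exact ⟨{y | f (y - η) < R + 1 / ((j : ℝ) + 1)},
      TopologicalSpace.isOpen_generateFrom_of_mem ⟨η, _, hpos, rfl⟩, rfl⟩
  exact @MeasurableSpace.measurableSet_generateFrom _ _ _ hopen

theorem measurable_of_eq_on_balls {Y : Type*} [MeasurableSpace Y] {g : ProjLim k K Kn T → Y}
    (hg : ∀ x, ∃ n, ∃ ε > 0, ∀ y : ProjLim k K Kn T, f (y.1 n - x.1 n) < ε → g y = g x)
    (hf0 : f 0 = 0) :
    @Measurable _ _ (projMeas k K Kn T f) _ g := by
  intro s _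
  refine @MeasurableSpace.measurableSet_generateFrom _ _ _ ?_
  change @IsOpen _ (projTop k K Kn T f) (g ⁻¹' s)
  choose n ε hε h using hg
  have hU : g ⁻¹' s = ⋃ x ∈ g ⁻¹' s, {y | f (y.1 (n x) - x.1 (n x)) < ε x} := by
    ext y
    simp only [Set.mem_iUnion]
    constructor
    · exact fun hy => ⟨y, hy, by simp [hf0, hε y]⟩
    · rintro ⟨x, hx, hy⟩
      rw [Set.mem_preimage, h x y hy]
      exact hx
  rw [hU]
  let := projTop k K Kn T f
  exact isOpen_biUnion fun x _ =>
    TopologicalSpace.isOpen_generateFrom_of_mem ⟨x, n x, ε x, hε x, rfl⟩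

end Topology

/-- Positive powers of the spectral norm are nonarchimedean absolute values. -/
theorem exists_absoluteValue_spectralNorm_pow (F L : Type*) [NontriviallyNormedField F]
    [IsUltrametricDist F] [CompleteSpace F] [Field L] [Algebra F L] [Algebra.IsAlgebraic F L]
    {N : ℕ} (hN : N ≠ 0) :
    ∃ v : AbsoluteValue L ℝ, IsNonarchimedean v ∧ ∀ x, v x = spectralNorm F L x ^ N := by
  let := spectralNorm.normedField F L
  have hna : IsNonarchimedean fun x : L => ‖x‖ ^ N :=
    IsNonarchimedean.pow_nat (f := fun x : L => ‖x‖)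
      isNonarchimedean_spectralNorm (fun x => norm_nonneg x) N
  refine ⟨⟨⟨fun x => ‖x‖ ^ N, fun x y => by simp only [norm_mul, mul_pow]⟩,
    fun x => by positivity, fun x => by simp [hN], fun x y => ?_⟩, hna, fun x => rfl⟩
  exact (hna x y).trans (max_le_add_of_nonneg (by positivity) (by positivity))

theorem ite_rpow_eq_of_sub_le_one {E : Type*} [Field E] {v : AbsoluteValue E ℝ}
    (hv : IsNonarchimedean v) (α : ℝ) {ξ η : E} (h : v (ξ - η) ≤ 1) :
    (if 1 < v ξ then ((v ξ ^ α : ℝ) : ℂ) else 0) =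
      if 1 < v η then ((v η ^ α : ℝ) : ℂ) else 0 := by
  have hle : ∀ a b : E, v (a - b) ≤ 1 → 1 < v a → v a ≤ v b := fun a b hab ha => by
    have h1 := hv (a - b) b
    rw [sub_add_cancel] at h1
    exact (le_max_iff.mp h1).resolve_left (not_le.mpr (hab.trans_lt ha))
  have h' : v (η - ξ) ≤ 1 := by rwa [v.map_sub]
  by_cases hξ : 1 < v ξ
  · have hη : 1 < v η := hξ.trans_le (hle ξ η h hξ)
    rw [(hle ξ η h hξ).antisymm (hle η ξ h' hη)]
  · have hη : ¬ 1 < v η := fun hη => hξ (hη.trans_le (hle η ξ h' hη))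
    rw [if_neg hξ, if_neg hη]

section Level

variable {k K : Type} [Field k] [Field K] [Algebra k K] {Kn : ℕ → IntermediateField k K}
  {T : ℕ → K →ₗ[k] K} {v : AbsoluteValue K ℝ}

/-- Almost everywhere, a cylindrical function is a finite combination of characters, on which
the fractional differentiation operators act as multipliers. -/
theorem exists_trig_representation (hv : IsNonarchimedean v) {χ : AddChar k ℂ}
    (hχnorm : ∀ x, ‖χ x‖ = 1) {c₀ : k} (hc₀ : χ c₀ ≠ 1)
    {pairing : K → ProjLim k K Kn T → k} {e : ProjLim k K Kn T → AddChar K ℂ}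
    (he : ∀ x a, e x a = χ (pairing a x))
    {vol : ∀ n : ℕ, @Measure (Kn n) (KnMeas k K Kn v n)}
    {μ : @Measure (ProjLim k K Kn T) (projMeas k K Kn T v)} (hμ : IsProbabilityMeasure μ)
    (hmeas : ∀ a, @Measurable _ _ (projMeas k K Kn T v) _ fun x => e x a)
    (hchar : ∀ a, ∫ x, e x a ∂μ = if v a ≤ 1 then (1 : ℂ) else 0)
    {n : ℕ} (hvol : ∀ η : Kn n, vol n {ξ | v ((ξ - η : Kn n) : K) ≤ 1} = 1)
    (hm : (finrank k (Kn n) : k) ≠ 0)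
    (hpair : ∀ (a : Kn n) (x : ProjLim k K Kn T), pairing a x = (finrank k (Kn n) : k)⁻¹ *
        Algebra.trace k (Kn n) (a * ⟨x.1 n, x.2.1 n⟩))
    (hcover : ∀ R δ : ℝ, 0 < δ → ∃ t : Finset (Kn n), ∀ z : Kn n, v (z : K) ≤ R →
      ∃ w ∈ t, v ((z - w : Kn n) : K) < δ)
    (hsmall : ∃ r > 0, ∀ z : Kn n, v (z : K) ≤ r →
      χ ((finrank k (Kn n) : k)⁻¹ * Algebra.trace k (Kn n) z) = 1)
    {φ : Kn n → ℂ}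
    (hφ : ∀ R : ℝ, ∃ δ > 0, ∀ z w : Kn n, v (z : K) ≤ R → v ((w - z : Kn n) : K) < δ →
      φ w = φ z) :
    ∃ c : K →₀ ℂ,
      (∀ᵐ x ∂μ, φ ⟨x.1 n, x.2.1 n⟩ = Finsupp.linearCombination ℂ (fun η => e x (-η)) c) ∧
      ∀ α : ℝ, ∀ᵐ x ∂μ, Dop k K Kn T v χ pairing vol μ α n φ x =
        Finsupp.linearCombination ℂ
          (fun η => (if 1 < v η then ((v η ^ α : ℝ) : ℂ) else 0) * e x (-η)) c := by
  let := projMeas k K Kn T v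
  let := KnMeas k K Kn v n
  let vn : AbsoluteValue (Kn n) ℝ := v.comp (f := algebraMap (Kn n) K) (algebraMap (Kn n) K).injective
  have hvn : IsNonarchimedean vn := fun x y => hv (x : K) (y : K)
  let ψ : AddChar (Kn n) ℂ := χ.compAddMonoidHom
    ((AddMonoidHom.mulLeft (finrank k (Kn n) : k)⁻¹).comp
      (Algebra.trace k (Kn n)).toAddMonoidHom)
  have hψ : ∀ z, ψ z = χ ((finrank k (Kn n) : k)⁻¹ * Algebra.trace k (Kn n) z) := fun z => rfl
  let ρ : ProjLim k K Kn T → Kn n := fun x => ⟨x.1 n, x.2.1 n⟩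
  have heψ : ∀ x (a : Kn n), e x a = ψ (a * ρ x) := fun x a => by rw [he, hpair, hψ]
  have hψc : ψ (algebraMap k (Kn n) c₀) ≠ 1 := by
    rwa [hψ, Algebra.trace_algebraMap, nsmul_eq_mul, inv_mul_cancel_left₀ hm]
  obtain ⟨c, hc⟩ := exists_eq_linearCombination_addChar (v := vn) (ψ := ψ)
    hcover hsmall hψc hφ
  have hgood : ∀ᵐ x ∂μ, ∀ a, vn a ≤ 1 → ψ (a * ρ x) = 1 :=
    ae_addChar_mul_eq_one (v := vn) (ψ := ψ) hvn hcover hsmall (fun z => hχnorm _) fun a ha => by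
      simp only [← heψ, hchar]
      exact if_pos ha
  have hrepr : ∀ᵐ x ∂μ, φ (ρ x) = Finsupp.linearCombination ℂ (fun η => e x (-η))
      (c.mapDomain (algebraMap (Kn n) K)) := by
    filter_upwards [hgood] with x hx
    rw [hc _ hx, Finsupp.linearCombination_mapDomain]
    congr 2
    ext η
    rw [← neg_mul, ← heψ]
    simp
  refine ⟨_, hrepr, fun α => ?_⟩
  have hhat : ∀ ξ : Kn n, ∫ y, χ (pairing ξ y) * φ (ρ y) ∂μ =
      Finsupp.linearCombination ℂ (fun η => if vn (ξ - η) ≤ 1 then (1 : ℂ) else 0) c := by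
    intro ξ
    have h := (integral_addChar_mul_trig (fun x a => (congrArg _ (he x a)).trans (hχnorm _))
      hmeas hchar (c.mapDomain (algebraMap (Kn n) K)) (ξ : K)).2
    rw [Finsupp.linearCombination_mapDomain] at h
    refine Eq.trans (integral_congr_ae ?_) h
    filter_upwards [hrepr] with x hx
    rw [hx, he]
  filter_upwards [hgood] with x hx
  have h := integral_addChar_mul_linearCombination (v := vn) (ψ := ψ) (ν := vol n)
    (Δ := fun ξ => if 1 < vn ξ then ((vn ξ ^ α : ℝ) : ℂ) else 0)
    (fun η => measurableSet_closedBall_KnMeas n η zero_le_one) hvol ?_ hx c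
  · rw [Finsupp.linearCombination_mapDomain]
    unfold Dop
    refine Eq.trans ?_ (h.trans ?_)
    · congr 1
      ext ξ
      rw [← hhat]
      rfl
    · congr 2
      ext η
      rw [← neg_mul, ← heψ]
      rfl
  · exact fun ξ η h => ite_rpow_eq_of_sub_le_one hvn α h

end Level

theorem statement_16
    (p : ℕ) [Fact (Nat.Prime p)]
    (k : Type) [Field k] [Algebra ℚ_[p] k] [FiniteDimensional ℚ_[p] k]
    (K : Type) [Field K] [Algebra k K] [CharZero K]
    (Kn : ℕ → IntermediateField k K)
    (hbot : Kn 1 = ⊥) (hmono : Monotone Kn)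
    [hfd : ∀ n, FiniteDimensional k (Kn n)]
    (hunion : ∀ x : K, ∃ n, x ∈ Kn n)
    (T : ℕ → K →ₗ[k] K)
    (hTmem : ∀ (n : ℕ) (x : K), T n x ∈ Kn n)
    (hTdef : ∀ (n ν : ℕ) (h : n ≤ ν) (x : K) (hx : x ∈ Kn ν),
      T n x = ((finrank k (Kn n) : K) / (finrank k (Kn ν) : K)) *
        (relTrace k K (Kn n) (Kn ν) (hmono h) ⟨x, hx⟩ : K))
    (Knorm : K → ℝ)
    (hKnorm : ∀ (n : ℕ) (x : K) (hx : x ∈ Kn n),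
      Knorm x = absk p k (Algebra.norm k (⟨x, hx⟩ : Kn n)) ^ ((finrank k (Kn n) : ℝ)⁻¹))
    (pairing : K → ProjLim k K Kn T → k)
    (hpair : ∀ (n : ℕ) (a : K) (ha : a ∈ Kn n) (x : ProjLim k K Kn T),
      pairing a x = (finrank k (Kn n) : k)⁻¹ *
        Algebra.trace k (Kn n) (⟨a * x.1 n, mul_mem ha (x.2.1 n)⟩ : Kn n))
    (q : ℕ → ℕ)
    (hq : ∀ n : ℕ, IsGreatest
      {r : ℝ | (∃ x : Kn n, Knorm ↑x ^ (finrank k (Kn n) : ℝ) = r) ∧ r < 1} ((q n : ℝ)⁻¹))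
    (χ : k → ℂ)
    (hχadd : ∀ x y : k, χ (x + y) = χ x * χ y)
    (hχnorm : ∀ x : k, ‖χ x‖ = 1)
    (hχcont : @Continuous _ _ (kTop p k) _ χ)
    (hχtriv : ∀ x : k, absk p k x ≤ 1 → χ x = 1)
    (hχrank : ∃ x : k, absk p k x ≤ (q 1 : ℝ) ∧ χ x ≠ 1)
    (d : ℕ → ℕ)
    (hd : ∀ (n : ℕ) (x : Kn n),
      Knorm ↑x ^ (finrank k (Kn n) : ℝ) ≤ (q n : ℝ) ^ (d n : ℝ) ↔
        ∀ y : Kn n, Knorm ↑y ≤ 1 → absk p k (Algebra.trace k (Kn n) (x * y)) ≤ 1)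
    (vol : ∀ n : ℕ, @MeasureTheory.Measure (Kn n) (KnMeas k K Kn Knorm n))
    (hvolinv : ∀ (n : ℕ) (a : Kn n) (A : Set (Kn n)),
      MeasurableSet[KnMeas k K Kn Knorm n] A → vol n ((fun z => a + z) ⁻¹' A) = vol n A)
    (hvolnorm : ∀ n : ℕ, vol n {z : Kn n | Knorm ↑z ≤ 1} = 1)
    (μ : @MeasureTheory.Measure (ProjLim k K Kn T) (projMeas k K Kn T Knorm))
    (hμprob : MeasureTheory.IsProbabilityMeasure μ)
    (hμradon : ∀ A : Set (ProjLim k K Kn T), MeasurableSet[projMeas k K Kn T Knorm] A →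
      μ A = ⨆ (C : Set (ProjLim k K Kn T))
        (_ : C ⊆ A ∧ @IsCompact _ (projTop k K Kn T Knorm) C), μ C)
    (hμchar : ∀ a : K, ∫ x, χ (pairing a x) ∂μ = if Knorm a ≤ 1 then (1 : ℂ) else 0)
    (α : ℝ) (hα : 0 < α)
    (n : ℕ) (hn : 1 ≤ n) (φ : Kn n → ℂ)
    (hφ : @IsLocallyConstant _ _ (KnTop k K Kn Knorm n) φ)
    (hint : ∫ x, φ ⟨x.1 n, x.2.1 n⟩ ∂μ = 0)
    (n' : ℕ) (hn' : 1 ≤ n') (φ' : Kn n' → ℂ)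
    (hφ' : @IsLocallyConstant _ _ (KnTop k K Kn Knorm n') φ') :
    (∀ᵐ x ∂μ, Dop k K Kn T Knorm χ pairing vol μ α n' φ' x = φ ⟨x.1 n, x.2.1 n⟩) ↔
      ∃ C : ℂ, ∀ᵐ x ∂μ,
        φ' ⟨x.1 n', x.2.1 n'⟩ = Dop k K Kn T Knorm χ pairing vol μ (-α) n φ x + C := by
  let : Algebra ℚ_[p] K := ((algebraMap k K).comp (algebraMap ℚ_[p] k)).toAlgebra
  have : IsScalarTower ℚ_[p] k K := IsScalarTower.of_algebraMap_eq fun _ => rfl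
  have (n : ℕ) : IsScalarTower ℚ_[p] (Kn n) K := IsScalarTower.of_algebraMap_eq fun _ => rfl
  have hfdp : ∀ n, FiniteDimensional ℚ_[p] (Kn n) := fun n =>
    FiniteDimensional.trans ℚ_[p] k (Kn n)
  have : Algebra.IsAlgebraic ℚ_[p] K := ⟨fun x => by
    obtain ⟨n, hx⟩ := hunion x
    exact (Algebra.IsAlgebraic.isAlgebraic (R := ℚ_[p]) (⟨x, hx⟩ : Kn n)).algebraMap⟩
  have : CharZero k := charZero_of_injective_algebraMap (algebraMap ℚ_[p] k).injective
  have hN : finrank ℚ_[p] k ≠ 0 := finrank_pos.ne'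
  have hm : ∀ n, finrank k (Kn n) ≠ 0 := fun n => finrank_pos.ne'
  have hKp : ∀ x, Knorm x = spectralNorm ℚ_[p] K x ^ finrank ℚ_[p] k := by
    intro x
    obtain ⟨n, hx⟩ := hunion x
    have h : spectralNorm ℚ_[p] (Kn n) ⟨x, hx⟩ = spectralNorm ℚ_[p] K x :=
      spectralNorm.eq_of_tower _
    rw [hKnorm n x hx, absk, Algebra.norm_norm, ← spectralNorm_pow_finrank, h,
      ← finrank_mul_finrank ℚ_[p] k (Kn n), pow_mul,
      Real.pow_rpow_inv_natCast (pow_nonneg (spectralNorm_nonneg _) _) (hm n)]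
  obtain ⟨v, hv, hvs⟩ := exists_absoluteValue_spectralNorm_pow ℚ_[p] K hN
  obtain rfl : Knorm = v := funext fun x => (hKp x).trans (hvs x).symm
  have hvn : ∀ n (z : Kn n), spectralNorm ℚ_[p] (Kn n) z ^ finrank ℚ_[p] k = v z :=
    fun n z => (congrArg (· ^ _) (spectralNorm.eq_of_tower z)).trans (hvs z).symm
  have hcover : ∀ n (R δ : ℝ), 0 < δ → ∃ t : Finset (Kn n), ∀ z : Kn n, v (z : K) ≤ R →
      ∃ w ∈ t, v ((z - w : Kn n) : K) < δ := fun n R δ hδ => by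
    simpa only [hvn] using exists_finset_cover_spectralNorm_pow (F := ℚ_[p]) (L := Kn n) hN R hδ
  have hunif : ∀ n (φ : Kn n → ℂ), @IsLocallyConstant _ _ (KnTop k K Kn v n) φ →
      ∀ R : ℝ, ∃ δ > 0, ∀ z w : Kn n, v (z : K) ≤ R → v ((w - z : Kn n) : K) < δ →
        φ w = φ z := fun n φ hφ R => by
    have h := exists_ball_eq_of_isLocallyConstant_KnTop hv hφ
    simp only [← hvn] at h
    simpa only [hvn] using
      exists_uniform_locallyConstant_spectralNorm_pow (F := ℚ_[p]) (L := Kn n) hN h R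
  have hχ0 : χ 0 = 1 := hχtriv 0 (by simp [absk, Algebra.norm_zero])
  obtain ⟨χ, rfl⟩ : ∃ χ' : AddChar k ℂ, ⇑χ' = χ := ⟨⟨χ, hχ0, hχadd⟩, rfl⟩
  obtain ⟨c₀, -, hc₀⟩ := hχrank
  have hsmall : ∀ n, ∃ r > 0, ∀ z : Kn n, v (z : K) ≤ r →
      χ ((finrank k (Kn n) : k)⁻¹ * Algebra.trace k (Kn n) z) = 1 := by
    intro n
    obtain ⟨C, hC, h⟩ := exists_spectralNorm_pow_linearMap_le (F := ℚ_[p])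
      (((finrank k (Kn n) : k)⁻¹ • Algebra.trace k (Kn n)).restrictScalars ℚ_[p])
      (finrank ℚ_[p] k)
    refine ⟨C⁻¹, inv_pos.mpr hC, fun z hz => hχtriv _ ?_⟩
    rw [absk, ← spectralNorm_pow_finrank]
    refine (h z).trans ?_
    rw [hvn, ← mul_inv_cancel₀ hC.ne']
    exact mul_le_mul_of_nonneg_left hz hC.le
  have hpadd : ∀ x a b, pairing (a + b) x = pairing a x + pairing b x := by
    intro x a b
    obtain ⟨i, hi⟩ := hunion a
    obtain ⟨j, hj⟩ := hunion b
    have ha := hmono (le_max_left i j) hi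
    have hb := hmono (le_max_right i j) hj
    rw [hpair _ a ha, hpair _ b hb, hpair _ (a + b) (add_mem ha hb), ← mul_add, ← map_add]
    congr 2
    exact Subtype.ext (add_mul _ _ _)
  have hpair' : ∀ n (a : Kn n) (x : ProjLim k K Kn T), pairing a x =
      (finrank k (Kn n) : k)⁻¹ * Algebra.trace k (Kn n) (a * ⟨x.1 n, x.2.1 n⟩) :=
    fun n a x => hpair n a a.2 x
  let e : ProjLim k K Kn T → AddChar K ℂ := fun x =>
    χ.compAddMonoidHom (AddMonoidHom.mk' (fun a => pairing a x) (hpadd x))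
  have he : ∀ x a, e x a = χ (pairing a x) := fun x a => rfl
  have hmeas : ∀ a, @Measurable _ _ (projMeas k K Kn T v) _ fun x => e x a := by
    intro a
    obtain ⟨i, ha⟩ := hunion a
    obtain ⟨r, hr, hχr⟩ := hsmall i
    have hva : 0 < v a + 1 := add_pos_of_nonneg_of_pos (v.nonneg a) one_pos
    refine measurable_of_eq_on_balls (fun x => ⟨i, r / (v a + 1), div_pos hr hva,
      fun y hy => ?_⟩) v.map_zero
    have hle : v (((⟨a, ha⟩ : Kn i) * (⟨y.1 i, y.2.1 i⟩ - ⟨x.1 i, x.2.1 i⟩) : Kn i) : K) ≤ r := by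
      change v (a * (y.1 i - x.1 i)) ≤ r
      rw [map_mul]
      have := (lt_div_iff₀ hva).mp hy
      nlinarith [v.nonneg (y.1 i - x.1 i)]
    have h := hχr _ hle
    rw [mul_sub, map_sub, mul_sub, AddChar.map_sub_eq_div, ← hpair' i ⟨a, ha⟩ y,
      ← hpair' i ⟨a, ha⟩ x] at h
    exact (div_eq_one_iff_eq (AddChar.val_isUnit χ _).ne_zero).mp h
  have hvol : ∀ n (η : Kn n), vol n {ξ | v ((ξ - η : Kn n) : K) ≤ 1} = 1 := by
    intro n η
    have hball : {z : Kn n | v (z : K) ≤ 1} = {ξ : Kn n | v ((ξ - 0 : Kn n) : K) ≤ 1} := by simp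
    have hms : @MeasurableSet _ (KnMeas k K Kn v n) {z : Kn n | v (z : K) ≤ 1} := by
      rw [hball]
      exact measurableSet_closedBall_KnMeas n 0 zero_le_one
    refine Eq.trans ?_ ((hvolinv n (-η) _ hms).trans (hvolnorm n))
    congr 1
    ext ξ
    simp only [Set.mem_preimage, Set.mem_ofPred_eq, neg_add_eq_sub]
  have hrep : ∀ n (φ : Kn n → ℂ), @IsLocallyConstant _ _ (KnTop k K Kn v n) φ → ∃ c : K →₀ ℂ,
      (∀ᵐ x ∂μ, φ ⟨x.1 n, x.2.1 n⟩ = Finsupp.linearCombination ℂ (fun η => e x (-η)) c) ∧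
      ∀ α : ℝ, ∀ᵐ x ∂μ, Dop k K Kn T v χ pairing vol μ α n φ x =
        Finsupp.linearCombination ℂ
          (fun η => (if 1 < v η then ((v η ^ α : ℝ) : ℂ) else 0) * e x (-η)) c :=
    fun n φ hφ => exists_trig_representation hv hχnorm hc₀ he hμprob hmeas hμchar (hvol n)
      (Nat.cast_ne_zero.mpr (hm n)) (hpair' n) (hcover n) (hsmall n) (hunif n φ hφ)
  obtain ⟨c, hc, hDc⟩ := hrep n' φ' hφ'
  obtain ⟨d, hd, hDd⟩ := hrep n φ hφ
  have hmain := @trig_multiplier_eq_iff K (ProjLim k K Kn T) _ (projMeas k K Kn T v) μ hμprob v e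
    hv v.map_neg (fun x a => hχnorm _) hmeas hμchar _ _
    (fun ξ η h => ite_rpow_eq_of_sub_le_one hv α h)
    (fun ξ η h => ite_rpow_eq_of_sub_le_one hv (-α) h)
    (fun ξ hξ => ⟨if_neg (not_lt.mpr hξ), if_neg (not_lt.mpr hξ)⟩)
    (fun ξ hξ => by
      rw [if_pos hξ, if_pos hξ, ← Complex.ofReal_mul, ← Real.rpow_add (one_pos.trans hξ),
        add_neg_cancel, Real.rpow_zero, Complex.ofReal_one])
    c d ((integral_congr_ae hd).symm.trans hint)
  refine Iff.trans (Filter.eventually_congr ?_)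
    (hmain.trans (exists_congr fun C => Filter.eventually_congr ?_))
  · filter_upwards [hDc α, hd] with x hx hx'
    rw [hx, hx']
  · filter_upwards [hc, hDd (-α)] with x hx hx'
    rw [hx, hx']
end

section
/- Let α > 0 and f ∈ E(K̄) with f(x) = φ(T_n(x)). Then (D^α f)(x) = ψ(T_n(x)), where for z ∈ K_n with ‖z‖ ≤ q_n^{d_n/m_n}·‖m_n‖ one has the hyper-singular integral representation ψ(z) = q_n^{d_n·α/m_n} · (1 − q_n^{α/m_n})/(1 − q_n^{−1−α/m_n}) · ‖m_n‖^{−m_n} · ∫_{{x ∈ K_n : ‖x‖ ≤ q_n^{d_n/m_n}·‖m_n‖}} [ ‖x‖^{−m_n−α}·‖m_n‖^{m_n+α} + ((1 − q_n^{−1})/(q_n^{α/m_n} − 1))·q_n^{−d_n(1+α/m_n)} ] · (φ(z − x) − φ(z)) dx. -/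
open MeasureTheory Module
open scoped Classical

/-- `A` is a discrete non-archimedean modulus on the topological field `L`, with values in the
powers of `q`, which defines the topology and scales the translation-invariant measure `vol`. -/
structure IsScaledModulus {L : Type*} [Field L] [TopologicalSpace L] [MeasurableSpace L]
    (A : L → ℝ) (q : ℝ) (vol : Measure L) : Prop where
  one_lt : 1 < q
  map_zero : A 0 = 0
  map_neg : ∀ x, A (-x) = A x
  map_mul : ∀ x y, A (x * y) = A x * A y
  add_le_max : ∀ x y, A (x + y) ≤ max (A x) (A y)
  eq_zpow : ∀ x, x ≠ 0 → ∃ j : ℤ, A x = q ^ j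
  exists_eq_inv : ∃ x, A x = q⁻¹
  isOpen_ball : ∀ (c : L) (i : ℤ), IsOpen {x | A (x - c) ≤ q ^ i}
  exists_ball_subset : ∀ (c : L) (U : Set L), IsOpen U → c ∈ U →
    ∃ i : ℤ, {x | A (x - c) ≤ q ^ i} ⊆ U
  isCompact_ball : ∀ i : ℤ, IsCompact {x | A x ≤ q ^ i}
  vol_ball : ∀ i : ℤ, vol {x | A x ≤ q ^ i} = ENNReal.ofReal (q ^ i)

namespace IsScaledModulus

variable {L : Type*} [Field L] [TopologicalSpace L] [MeasurableSpace L] {A : L → ℝ} {q : ℝ}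
  {vol : Measure L}

section Basic

variable (h : IsScaledModulus A q vol)
include h

lemma q_pos : 0 < q := zero_lt_one.trans h.one_lt

lemma map_nonneg (x : L) : 0 ≤ A x := by
  by_cases hx : x = 0
  · rw [hx, h.map_zero]
  · obtain ⟨j, hj⟩ := h.eq_zpow x hx
    rw [hj]
    exact (zpow_pos h.q_pos j).le

lemma add_le {x y : L} {r : ℝ} (hx : A x ≤ r) (hy : A y ≤ r) : A (x + y) ≤ r :=
  (h.add_le_max x y).trans (max_le hx hy)

lemma sub_le {x y : L} {r : ℝ} (hx : A x ≤ r) (hy : A y ≤ r) : A (x - y) ≤ r := by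
  rw [sub_eq_add_neg]
  exact h.add_le hx (by rwa [h.map_neg])

lemma map_sub_comm (x y : L) : A (x - y) = A (y - x) := by
  rw [← h.map_neg, neg_sub]

lemma add_le_iff {x y : L} {r : ℝ} (hx : A x ≤ r) : A (x + y) ≤ r ↔ A y ≤ r :=
  ⟨fun hxy => by simpa using h.sub_le hxy hx, fun hy => h.add_le hx hy⟩

lemma sub_le_iff {x y : L} {r : ℝ} (hx : A x ≤ r) : A (x - y) ≤ r ↔ A y ≤ r :=
  ⟨fun hxy => by simpa using h.sub_le hx hxy, fun hy => h.sub_le hx hy⟩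

lemma exists_eq_zpow (i : ℤ) : ∃ x, x ≠ 0 ∧ A x = q ^ i := by
  obtain ⟨w, hw⟩ := h.exists_eq_inv
  have hw0 : w ≠ 0 := by
    rintro rfl
    rw [h.map_zero] at hw
    exact (inv_pos.2 h.q_pos).ne hw
  have hA1 : A 1 = 1 := by
    obtain ⟨j, hj⟩ := h.eq_zpow 1 one_ne_zero
    have h1 := h.map_mul 1 1
    have hpos := zpow_pos h.q_pos j
    rw [mul_one, hj] at h1
    rw [hj]
    nlinarith
  let f : L →*₀ ℝ := { toFun := A, map_zero' := h.map_zero, map_one' := hA1, map_mul' := h.map_mul }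
  refine ⟨w ^ (-i), zpow_ne_zero _ hw0, ?_⟩
  have : f (w ^ (-i)) = f w ^ (-i) := map_zpow₀ f w (-i)
  change A (w ^ (-i)) = A w ^ (-i) at this
  rw [this, hw, inv_zpow, zpow_neg, inv_inv]

lemma zpow_le_iff {i j : ℤ} : q ^ i ≤ q ^ j ↔ i ≤ j := zpow_le_zpow_iff_right₀ h.one_lt

lemma ball_mono {i j : ℤ} (hij : i ≤ j) : {x | A x ≤ q ^ i} ⊆ {x | A x ≤ q ^ j} :=
  fun _ hx => le_trans hx (h.zpow_le_iff.2 hij)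

lemma ball_eq_of_mem {c c' : L} {r : ℝ} (hc : A (c' - c) ≤ r) :
    {x | A (x - c) ≤ r} = {x | A (x - c') ≤ r} := by
  ext x
  have : x - c = (c' - c) + (x - c') := by ring
  simp only [Set.mem_ofPred_eq]
  rw [this]
  exact h.add_le_iff hc

lemma isOpen_ball_zero (i : ℤ) : IsOpen {x | A x ≤ q ^ i} := by
  simpa using h.isOpen_ball 0 i

end Basic

section Measure

variable [BorelSpace L]

lemma measurableSet_ball (h : IsScaledModulus A q vol) (c : L) (i : ℤ) :
    MeasurableSet {x | A (x - c) ≤ q ^ i} :=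
  (h.isOpen_ball c i).measurableSet

lemma measurableSet_ball_zero (h : IsScaledModulus A q vol) (i : ℤ) :
    MeasurableSet {x | A x ≤ q ^ i} :=
  (h.isOpen_ball_zero i).measurableSet

lemma measurable (h : IsScaledModulus A q vol) : Measurable A := by
  refine measurable_of_Iic fun r => ?_
  by_cases hr : r < 0
  · convert MeasurableSet.empty
    ext x
    simpa using hr.trans_le (h.map_nonneg x)
  push Not at hr
  rcases hr.eq_or_lt with rfl | hr
  · have : A ⁻¹' Set.Iic 0 = ⋂ n : ℕ, {x | A x ≤ q ^ (-(n : ℤ))} := by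
      ext x
      simp only [Set.mem_preimage, Set.mem_Iic, Set.mem_iInter, Set.mem_ofPred_eq]
      refine ⟨fun hx n => hx.trans (zpow_pos h.q_pos _).le, fun hx => ?_⟩
      have ht := tendsto_pow_atTop_nhds_zero_of_lt_one (inv_nonneg.2 h.q_pos.le)
        (inv_lt_one_of_one_lt₀ h.one_lt)
      refine ge_of_tendsto' ht fun n => ?_
      simpa using hx n
    rw [this]
    exact MeasurableSet.iInter fun n => h.measurableSet_ball_zero _
  · obtain ⟨i, hi, hi'⟩ := exists_mem_Ico_zpow hr h.one_lt
    have : A ⁻¹' Set.Iic r = {x | A x ≤ q ^ i} := by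
      ext x
      simp only [Set.mem_preimage, Set.mem_Iic, Set.mem_ofPred_eq]
      refine ⟨fun hx => ?_, fun hx => hx.trans hi⟩
      by_cases hx0 : x = 0
      · rw [hx0, h.map_zero]
        exact (zpow_pos h.q_pos _).le
      obtain ⟨j, hj⟩ := h.eq_zpow x hx0
      rw [hj, h.zpow_le_iff]
      have := hx.trans_lt hi'
      rw [hj, zpow_lt_zpow_iff_right₀ h.one_lt] at this
      omega
    rw [this]
    exact h.measurableSet_ball_zero _

omit [BorelSpace L] in
lemma finite_restrict (h : IsScaledModulus A q vol) (i : ℤ) :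
    IsFiniteMeasure (vol.restrict {x | A x ≤ q ^ i}) :=
  ⟨by rw [Measure.restrict_apply_univ, h.vol_ball]; exact ENNReal.ofReal_lt_top⟩

lemma measure_ext [SecondCountableTopology L] (h : IsScaledModulus A q vol) {P Q : Measure L}
    [IsFiniteMeasure P] (i₀ : ℤ)
    (hPQ : ∀ (c : L) (i : ℤ), i ≤ i₀ → P {x | A (x - c) ≤ q ^ i} = Q {x | A (x - c) ≤ q ^ i})
    (huniv : P Set.univ = Q Set.univ) : P = Q := by
  set C : Set (Set L) := {S | ∃ (c : L) (i : ℤ), i ≤ i₀ ∧ S = {x | A (x - c) ≤ q ^ i}} with hC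
  have hself : ∀ (c : L) (i : ℤ), c ∈ {x | A (x - c) ≤ q ^ i} := fun c i => by
    simpa [h.map_zero] using (zpow_pos h.q_pos i).le
  have hbasis : TopologicalSpace.IsTopologicalBasis C := by
    refine TopologicalSpace.isTopologicalBasis_of_isOpen_of_nhds ?_ ?_
    · rintro _ ⟨c, i, -, rfl⟩
      exact h.isOpen_ball c i
    · intro a u ha hu
      obtain ⟨i, hi⟩ := h.exists_ball_subset a u hu ha
      refine ⟨_, ⟨a, min i i₀, min_le_right _ _, rfl⟩, hself _ _, fun x hx => hi ?_⟩
      exact le_trans hx (h.zpow_le_iff.2 (min_le_left _ _))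
  refine ext_of_generate_finite C ?_ ?_ ?_ huniv
  · rw [← hbasis.borel_eq_generateFrom]
    exact BorelSpace.measurable_eq
  · rintro _ ⟨c, i, hi, rfl⟩ _ ⟨c', i', hi', rfl⟩ ⟨x, hx, hx'⟩
    rw [h.ball_eq_of_mem hx, h.ball_eq_of_mem hx']
    refine ⟨x, min i i', (min_le_left _ _).trans hi, ?_⟩
    ext y
    simp only [Set.mem_inter_iff, Set.mem_ofPred_eq]
    rcases le_total i i' with hii | hii
    · rw [min_eq_left hii]
      exact ⟨fun hy => hy.1, fun hy => ⟨hy, hy.trans (h.zpow_le_iff.2 hii)⟩⟩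
    · rw [min_eq_right hii]
      exact ⟨fun hy => hy.2, fun hy => ⟨hy.trans (h.zpow_le_iff.2 hii), hy⟩⟩
  · rintro _ ⟨c, i, hi, rfl⟩
    exact hPQ c i hi

variable [IsTopologicalRing L] [SecondCountableTopology L] [vol.IsAddLeftInvariant]

omit [SecondCountableTopology L] in
lemma vol_ball_center (h : IsScaledModulus A q vol) (c : L) (i : ℤ) :
    vol {x | A (x - c) ≤ q ^ i} = ENNReal.ofReal (q ^ i) := by
  rw [← h.vol_ball i, ← measure_preimage_add vol (-c) {x | A x ≤ q ^ i}]
  congr 1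
  ext x
  simp [neg_add_eq_sub]

omit [SecondCountableTopology L] in
lemma restrict_ball (h : IsScaledModulus A q vol) (c : L) {i j : ℤ} (hij : i ≤ j) :
    vol.restrict {x | A x ≤ q ^ j} {x | A (x - c) ≤ q ^ i} =
      if A c ≤ q ^ j then ENNReal.ofReal (q ^ i) else 0 := by
  rw [Measure.restrict_apply (h.measurableSet_ball c i)]
  have hij' := h.zpow_le_iff.2 hij
  split_ifs with hc
  · rw [← h.vol_ball_center c i]
    congr 1
    refine Set.inter_eq_left.2 fun x hx => ?_
    simpa using h.add_le (le_trans hx hij') hc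
  · convert measure_empty (μ := vol)
    refine Set.eq_empty_of_forall_notMem fun x hx => hc ?_
    simpa using h.sub_le hx.2 (le_trans hx.1 hij')

/-- A probability measure with prescribed values on small balls is the normalized restriction
of the invariant measure, reflected through any point `z` of the ball. -/
lemma eq_smul_map_restrict (h : IsScaledModulus A q vol) {ν : Measure L} [IsProbabilityMeasure ν]
    (D : ℤ) (hν : ∀ (c : L) (i : ℤ), i ≤ D →
      ν {x | A (x - c) ≤ q ^ i} = if A c ≤ q ^ D then ENNReal.ofReal (q ^ (i - D)) else 0)
    {z : L} (hz : A z ≤ q ^ D) :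
    ν = ENNReal.ofReal (q ^ (-D)) •
      (vol.restrict {x | A x ≤ q ^ D}).map (fun x => z - x) := by
  have hm : Measurable (fun x : L => z - x) := (continuous_const.sub continuous_id).measurable
  refine h.measure_ext D (fun c i hi => ?_) ?_
  · rw [hν c i hi, Measure.smul_apply, Measure.map_apply hm (h.measurableSet_ball c i)]
    have : (fun x => z - x) ⁻¹' {x | A (x - c) ≤ q ^ i} = {x | A (x - (z - c)) ≤ q ^ i} := by
      ext x
      simp only [Set.mem_preimage, Set.mem_ofPred_eq]
      rw [h.map_sub_comm x (z - c), sub_right_comm]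
    rw [this, h.restrict_ball _ hi]
    simp only [h.sub_le_iff hz]
    split_ifs
    · rw [smul_eq_mul, ← ENNReal.ofReal_mul (zpow_pos h.q_pos _).le, ← zpow_add₀ h.q_pos.ne']
      congr 2
      ring
    · simp
  · rw [measure_univ, Measure.smul_apply, Measure.map_apply hm MeasurableSet.univ,
      Set.preimage_univ, Measure.restrict_apply_univ, h.vol_ball, smul_eq_mul,
      ← ENNReal.ofReal_mul (zpow_pos h.q_pos _).le, ← zpow_add₀ h.q_pos.ne']
    simp

end Measure

end IsScaledModulus

/-- `e` is a unitary additive character whose associated pairing `(a, b) ↦ e (a * b)` makes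
`{A ≤ q ^ D}` the annihilator of the unit ball. -/
structure IsBallCharacter {L : Type*} [Field L] (A : L → ℝ) (q : ℝ) (e : L → ℂ) (D : ℤ) :
    Prop where
  map_add : ∀ x y, e (x + y) = e x * e y
  norm_eq : ∀ x, ‖e x‖ = 1
  annihilator : ∀ b, (∀ a, A a ≤ 1 → e (a * b) = 1) ↔ A b ≤ q ^ D

namespace IsBallCharacter

variable {L : Type*} [Field L] {A : L → ℝ} {q : ℝ} {e : L → ℂ} {D : ℤ}

lemma ne_zero (he : IsBallCharacter A q e D) (x : L) : e x ≠ 0 := by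
  rw [← norm_ne_zero_iff, he.norm_eq]
  exact one_ne_zero

lemma map_zero (he : IsBallCharacter A q e D) : e 0 = 1 := by
  have := he.map_add 0 0
  rw [add_zero] at this
  exact (mul_eq_left₀ (he.ne_zero 0)).1 this.symm

variable [TopologicalSpace L] [MeasurableSpace L] {vol : Measure L}

lemma annihilator_ball (he : IsBallCharacter A q e D) (h : IsScaledModulus A q vol) (i : ℤ)
    (b : L) : (∀ a, A a ≤ q ^ i → e (a * b) = 1) ↔ A b ≤ q ^ (D - i) := by
  obtain ⟨w, hw0, hw⟩ := h.exists_eq_zpow i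
  have hqi := zpow_pos h.q_pos i
  have h1 : A b ≤ q ^ (D - i) ↔ A (w * b) ≤ q ^ D := by
    rw [h.map_mul, hw, zpow_sub₀ h.q_pos.ne', le_div_iff₀ hqi, mul_comm]
  rw [h1, ← he.annihilator]
  constructor
  · intro H a ha
    rw [← mul_assoc]
    refine H _ ?_
    rw [h.map_mul, hw]
    exact mul_le_of_le_one_left hqi.le ha
  · intro H a ha
    have := H (a / w) ?_
    · rwa [← mul_assoc, div_mul_cancel₀ _ hw0] at this
    · have h2 := h.map_mul (a / w) w
      rw [div_mul_cancel₀ _ hw0, hw] at h2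
      rw [h2] at ha
      exact le_of_mul_le_mul_right (by simpa using ha) hqi

lemma eq_one (he : IsBallCharacter A q e D) (h : IsScaledModulus A q vol) {x : L}
    (hx : A x ≤ q ^ D) : e x = 1 := by
  have hA1 : A 1 ≤ 1 := by
    have h1 := h.map_mul 1 1
    have hpos := h.map_nonneg 1
    rw [mul_one] at h1
    nlinarith
  simpa using (he.annihilator x).2 hx 1 hA1

lemma continuous (he : IsBallCharacter A q e D) (h : IsScaledModulus A q vol) :
    Continuous e := by
  refine IsLocallyConstant.continuous ((IsLocallyConstant.iff_exists_open e).2 fun x => ?_)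
  refine ⟨_, h.isOpen_ball x D, ?_, fun y hy => ?_⟩
  · simpa [h.map_zero] using (zpow_pos h.q_pos D).le
  · rw [← sub_add_cancel y x, he.map_add, he.eq_one h hy, one_mul]

variable [BorelSpace L] [IsTopologicalRing L] [SecondCountableTopology L]

omit [SecondCountableTopology L] in
lemma measurable_mul (he : IsBallCharacter A q e D) (h : IsScaledModulus A q vol) (b : L) :
    Measurable fun a => e (a * b) :=
  ((he.continuous h).comp (continuous_id.mul continuous_const)).measurable

variable [vol.IsAddLeftInvariant]

omit [SecondCountableTopology L] in
/-- Functions on a ball which are invariant under a smaller ball have compactly supported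
Fourier transform. -/
lemma setIntegral_mul_eq_zero (he : IsBallCharacter A q e D) (h : IsScaledModulus A q vol)
    {i j : ℤ} (hji : j ≤ i) {g : L → ℂ}
    (hg : ∀ x y, A x ≤ q ^ i → A y ≤ q ^ j → g (y + x) = g x) {b : L}
    (hb : ¬ A b ≤ q ^ (D - j)) : ∫ a in {a | A a ≤ q ^ i}, e (a * b) * g a ∂vol = 0 := by
  rw [← he.annihilator_ball h] at hb
  push Not at hb
  obtain ⟨a₀, ha₀, hne⟩ := hb
  have ha₀' := ha₀.trans (h.zpow_le_iff.2 hji)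
  rw [← integral_indicator (h.measurableSet_ball_zero i)]
  set F := Set.indicator {a | A a ≤ q ^ i} fun a => e (a * b) * g a
  have hF : ∀ a, F (a₀ + a) = e (a₀ * b) * F a := by
    intro a
    simp only [F, Set.indicator_apply, Set.mem_ofPred_eq, h.add_le_iff ha₀']
    split_ifs with ha
    · rw [hg a a₀ ha ha₀, add_mul, he.map_add, mul_assoc]
    · simp
  have h1 := integral_add_left_eq_self (μ := vol) F a₀
  simp only [hF, integral_const_mul] at h1
  have h2 : (e (a₀ * b) - 1) * ∫ a, F a ∂vol = 0 := by rw [sub_mul, h1, one_mul, sub_self]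
  exact (mul_eq_zero.1 h2).resolve_left (sub_ne_zero.2 hne)

lemma setIntegral_ball (he : IsBallCharacter A q e D) (h : IsScaledModulus A q vol)
    (i : ℤ) (b : L) : ∫ a in {a | A a ≤ q ^ i}, e (a * b) ∂vol =
      if A b ≤ q ^ (D - i) then ((q ^ i : ℝ) : ℂ) else 0 := by
  split_ifs with hb
  · rw [setIntegral_congr_fun (g := fun _ => 1) (h.measurableSet_ball_zero i)
      fun a ha => (he.annihilator_ball h i b).2 hb a ha]
    rw [setIntegral_const, Measure.real, h.vol_ball, ENNReal.toReal_ofReal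
      (zpow_pos h.q_pos i).le]
    simp
  · simpa using he.setIntegral_mul_eq_zero h le_rfl (g := fun _ => 1) (fun _ _ _ _ => rfl) hb

/-- A probability measure whose characteristic function is the indicator of the unit ball is
uniformly distributed over the annihilator of the unit ball. -/
lemma measure_ball_of_charFun (he : IsBallCharacter A q e D) (h : IsScaledModulus A q vol)
    {ν : Measure L} [IsProbabilityMeasure ν]
    (hν : ∀ a, ∫ y, e (a * y) ∂ν = if A a ≤ 1 then 1 else 0) (c : L) {i : ℤ} (hi : i ≤ D) :
    ν {x | A (x - c) ≤ q ^ i} = if A c ≤ q ^ D then ENNReal.ofReal (q ^ (i - D)) else 0 := by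
  have hq := h.q_pos
  have := h.finite_restrict (D - i)
  have hcont : Continuous (fun z : L × L => e (z.1 * (z.2 - c))) :=
    (he.continuous h).comp (continuous_fst.mul (continuous_snd.sub continuous_const))
  have hint : Integrable (Function.uncurry fun a y => e (a * (y - c)))
      ((vol.restrict {a | A a ≤ q ^ (D - i)}).prod ν) :=
    Integrable.of_bound hcont.measurable.aestronglyMeasurable 1
      (Filter.Eventually.of_forall fun z => (he.norm_eq _).le)
  have hswap := integral_integral_swap hint
  have hinner : ∀ a, ∫ y, e (a * (y - c)) ∂ν =
      Set.indicator {a | A a ≤ q ^ (0 : ℤ)} (fun a => e (a * (-c))) a := by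
    intro a
    have : ∀ y, e (a * (y - c)) = e (a * (-c)) * e (a * y) := fun y => by
      rw [← he.map_add]
      congr 1
      ring
    simp only [this, integral_const_mul, hν, Set.indicator_apply, Set.mem_ofPred_eq, zpow_zero]
    split_ifs <;> simp
  have hsub : {a | A a ≤ q ^ (D - i)} ∩ {a | A a ≤ q ^ (0 : ℤ)} = {a | A a ≤ q ^ (0 : ℤ)} :=
    Set.inter_eq_right.2 (h.ball_mono (by omega))
  simp only [hinner] at hswap
  rw [setIntegral_indicator (h.measurableSet_ball_zero 0), hsub, he.setIntegral_ball h] at hswap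
  simp only [he.setIntegral_ball h, h.map_neg] at hswap
  have hind : ∀ y, (if A (y - c) ≤ q ^ (D - (D - i)) then ((q ^ (D - i) : ℝ) : ℂ) else 0) =
      Set.indicator {y | A (y - c) ≤ q ^ i} (fun _ => ((q ^ (D - i) : ℝ) : ℂ)) y := by
    intro y
    simp [Set.indicator_apply]
  simp only [hind] at hswap
  rw [integral_indicator (h.measurableSet_ball c i), setIntegral_const, sub_zero, zpow_zero,
    Complex.real_smul] at hswap
  have hreal : ν.real {x | A (x - c) ≤ q ^ i} = if A c ≤ q ^ D then q ^ (i - D) else 0 := by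
    have h1 : ν.real {x | A (x - c) ≤ q ^ i} * q ^ (D - i) = if A c ≤ q ^ D then 1 else 0 := by
      have h2 := hswap.symm
      split_ifs at h2 ⊢ <;> exact_mod_cast h2
    have h3 : ν.real {x | A (x - c) ≤ q ^ i} =
        (ν.real {x | A (x - c) ≤ q ^ i} * q ^ (D - i)) * q ^ (i - D) := by
      rw [mul_assoc, ← zpow_add₀ hq.ne']
      simp
    rw [h3, h1]
    split_ifs <;> simp
  rw [← ofReal_measureReal, hreal]
  split_ifs <;> simp

end IsBallCharacter

lemma IsScaledModulus.exists_forall_add_eq {L : Type*} [Field L] [TopologicalSpace L]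
    [MeasurableSpace L] {A : L → ℝ} {q : ℝ} {vol : Measure L} (h : IsScaledModulus A q vol)
    {φ : L → ℂ} (hφ : IsLocallyConstant φ) (D : ℤ) :
    ∃ i : ℤ, ∀ x y, A x ≤ q ^ D → A y ≤ q ^ i → φ (y + x) = φ x := by
  suffices ∃ i : ℤ, ∀ x ∈ {x | A x ≤ q ^ D}, ∀ y, A y ≤ q ^ i → φ (y + x) = φ x by
    obtain ⟨i, hi⟩ := this
    exact ⟨i, fun x y hx hy => hi x hx y hy⟩
  refine (h.isCompact_ball D).induction_on
    (p := fun S => ∃ i : ℤ, ∀ x ∈ S, ∀ y, A y ≤ q ^ i → φ (y + x) = φ x) ⟨0, by simp⟩ ?_ ?_ ?_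
  · rintro s t hst ⟨i, hi⟩
    exact ⟨i, fun x hx => hi x (hst hx)⟩
  · rintro s t ⟨i, hi⟩ ⟨j, hj⟩
    refine ⟨min i j, ?_⟩
    rintro x (hx | hx) y hy
    · exact hi x hx y (hy.trans (h.zpow_le_iff.2 (min_le_left _ _)))
    · exact hj x hx y (hy.trans (h.zpow_le_iff.2 (min_le_right _ _)))
  · intro x _
    obtain ⟨U, hU, hxU, hconst⟩ := (IsLocallyConstant.iff_exists_open φ).1 hφ x
    obtain ⟨i, hi⟩ := h.exists_ball_subset x U hU hxU
    refine ⟨_, mem_nhdsWithin_of_mem_nhds ((h.isOpen_ball x i).mem_nhds ?_), i, ?_⟩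
    · simpa [h.map_zero] using (zpow_pos h.q_pos i).le
    · intro y hy t ht
      rw [hconst y (hi hy), hconst (t + y) (hi _)]
      simpa only [Set.mem_ofPred_eq, add_sub_assoc] using h.add_le ht hy

section RadialIntegral

variable {L : Type*} [Field L] {A : L → ℝ} {q : ℝ}

/-- The radial weight `A ^ a` outside the unit ball. -/
noncomputable def radialWeight (A : L → ℝ) (a : ℝ) (ξ : L) : ℂ :=
  if 1 < A ξ then ((A ξ ^ a : ℝ) : ℂ) else 0

lemma zpow_rpow_eq_pow (hq : 0 < q) (a : ℝ) (n : ℕ) : (q ^ (n : ℤ)) ^ a = (q ^ a) ^ n := by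
  rw [zpow_natCast, Real.rpow_pow_comm hq.le]

variable [TopologicalSpace L] [MeasurableSpace L] [BorelSpace L] {vol : Measure L}

lemma IsScaledModulus.measurable_radialWeight (h : IsScaledModulus A q vol) (a : ℝ) :
    Measurable (radialWeight A a) :=
  Measurable.ite (measurableSet_lt measurable_const h.measurable)
    (Complex.measurable_ofReal.comp (h.measurable.pow_const a)) measurable_const

lemma IsScaledModulus.integrableOn_radialWeight (h : IsScaledModulus A q vol) {a : ℝ}
    (ha : 0 < a) (l : ℤ) : IntegrableOn (radialWeight A a) {ξ | A ξ ≤ q ^ l} vol := by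
  have := h.finite_restrict l
  refine Integrable.of_bound (h.measurable_radialWeight a).aestronglyMeasurable ((q ^ l) ^ a) ?_
  filter_upwards [ae_restrict_mem (h.measurableSet_ball_zero l)] with ξ hξ
  rw [radialWeight]
  split_ifs with h1
  · rw [Complex.norm_real, Real.norm_of_nonneg (Real.rpow_nonneg (h.map_nonneg _) _)]
    exact Real.rpow_le_rpow (h.map_nonneg _) hξ ha.le
  · simpa using Real.rpow_nonneg (zpow_pos h.q_pos l).le a

variable [IsTopologicalRing L] [SecondCountableTopology L] [vol.IsAddLeftInvariant]
  {e : L → ℂ} {D : ℤ}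

omit [vol.IsAddLeftInvariant] in
lemma IsBallCharacter.integrableOn_radialWeight_mul (he : IsBallCharacter A q e D)
    (h : IsScaledModulus A q vol) {a : ℝ} (ha : 0 < a) (l : ℤ) (x : L) :
    IntegrableOn (fun ξ => radialWeight A a ξ * e (ξ * x)) {ξ | A ξ ≤ q ^ l} vol :=
  Integrable.mul_bdd (c := 1) (h.integrableOn_radialWeight ha l)
    (he.measurable_mul h x).aestronglyMeasurable
    (Filter.Eventually.of_forall fun _ => (he.norm_eq _).le)

lemma IsBallCharacter.setIntegral_radialWeight_succ (he : IsBallCharacter A q e D)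
    (h : IsScaledModulus A q vol) {a : ℝ} (ha : 0 < a) {x : L} {j : ℕ}
    (hx : A x = q ^ (D - j)) (l : ℕ) :
    ∫ ξ in {ξ | A ξ ≤ q ^ ((l + 1 : ℕ) : ℤ)}, radialWeight A a ξ * e (ξ * x) ∂vol =
      (∫ ξ in {ξ | A ξ ≤ q ^ (l : ℤ)}, radialWeight A a ξ * e (ξ * x) ∂vol) +
        (((q ^ a) ^ (l + 1) *
          ((if l + 1 ≤ j then q ^ (l + 1) else 0) - (if l ≤ j then q ^ l else 0)) : ℝ) : ℂ) := by
  have hsub : {ξ | A ξ ≤ q ^ (l : ℤ)} ⊆ {ξ | A ξ ≤ q ^ ((l + 1 : ℕ) : ℤ)} :=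
    h.ball_mono (by push_cast; omega)
  have hml := h.measurableSet_ball_zero l
  have hml1 := h.measurableSet_ball_zero (l + 1 : ℕ)
  have hball : ∀ i : ℕ, ∫ ξ in {ξ | A ξ ≤ q ^ (i : ℤ)}, e (ξ * x) ∂vol =
      (((if i ≤ j then q ^ i else 0) : ℝ) : ℂ) := by
    intro i
    rw [he.setIntegral_ball h, hx]
    simp only [h.zpow_le_iff]
    have : D - (j : ℤ) ≤ D - i ↔ i ≤ j := by omega
    simp only [this, zpow_natCast]
    split_ifs <;> simp
  have hint : IntegrableOn (fun ξ => e (ξ * x)) {ξ | A ξ ≤ q ^ ((l + 1 : ℕ) : ℤ)} vol := by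
    have := h.finite_restrict (l + 1 : ℕ)
    exact Integrable.of_bound (he.measurable_mul h x).aestronglyMeasurable 1
      (Filter.Eventually.of_forall fun _ => (he.norm_eq _).le)
  rw [← sub_eq_iff_eq_add', ← setIntegral_sdiff hml
    (he.integrableOn_radialWeight_mul h ha (l + 1 : ℕ) x) hsub]
  rw [setIntegral_congr_fun (g := fun ξ => (((q ^ a) ^ (l + 1) : ℝ) : ℂ) * e (ξ * x))
    (hml1.diff hml), integral_const_mul, setIntegral_sdiff hml hint hsub, hball, hball]
  · push_cast
    rfl
  · rintro ξ ⟨hξ1, hξ⟩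
    have hξ0 : ξ ≠ 0 := by
      rintro rfl
      apply hξ
      simpa [h.map_zero] using (pow_pos h.q_pos l).le
    obtain ⟨i, hi⟩ := h.eq_zpow ξ hξ0
    simp only [Set.mem_ofPred_eq, hi, h.zpow_le_iff] at hξ1 hξ
    have hil : i = ((l + 1 : ℕ) : ℤ) := by omega
    simp only [radialWeight]
    rw [if_pos, hi, hil, zpow_rpow_eq_pow h.q_pos]
    rw [hi, ← zpow_zero q, zpow_lt_zpow_iff_right₀ h.one_lt]
    omega

/-- The oscillatory integral of the radial weight over a large ball. -/
lemma IsBallCharacter.setIntegral_radialWeight (he : IsBallCharacter A q e D)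
    (h : IsScaledModulus A q vol) {a : ℝ} (ha : 0 < a) {x : L} {j : ℕ}
    (hx : A x = q ^ (D - j)) {l : ℕ} (hl : j < l) :
    ∫ ξ in {ξ | A ξ ≤ q ^ (l : ℤ)}, radialWeight A a ξ * e (ξ * x) ∂vol =
      (((1 - q ^ a) / (1 - (q ^ a * q)⁻¹) *
        ((q ^ a * q) ^ j + (1 - q⁻¹) / (q ^ a - 1)) : ℝ) : ℂ) := by
  have hq := h.q_pos
  have hb : 1 < q ^ a := Real.one_lt_rpow h.one_lt ha
  have hstep := he.setIntegral_radialWeight_succ h ha hx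
  generalize q ^ a = b at hb hstep ⊢
  have hbq : 1 < b * q := by nlinarith [h.one_lt]
  have h1 : b * q - 1 ≠ 0 := (sub_pos.2 hbq).ne'
  have h1' : q * b - 1 ≠ 0 := by rwa [mul_comm]
  have h2 : b - 1 ≠ 0 := (sub_pos.2 hb).ne'
  have hb0 : b ≠ 0 := by linarith
  have hsmall : ∀ l : ℕ, l ≤ j →
      ∫ ξ in {ξ | A ξ ≤ q ^ (l : ℤ)}, radialWeight A a ξ * e (ξ * x) ∂vol =
        (((q - 1) * b * ((b * q) ^ l - 1) / (b * q - 1) : ℝ) : ℂ) := by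
    intro l
    induction l with
    | zero =>
      intro _
      rw [setIntegral_congr_fun (g := fun _ => 0) (h.measurableSet_ball_zero _)]
      · simp
      · intro ξ hξ
        have : ¬ 1 < A ξ := by simpa using hξ
        simp [radialWeight, this]
    | succ l ih =>
      intro hlj
      rw [hstep, ih (by omega), if_pos hlj, if_pos (by omega), ← Complex.ofReal_add]
      congr 1
      field_simp
      ring
  induction l, hl using Nat.le_induction with
  | base =>
    rw [hstep, hsmall j le_rfl, if_neg (by omega), if_pos le_rfl, ← Complex.ofReal_add]
    congr 1
    have h3 : 1 - (b * q)⁻¹ = (b * q - 1) / (b * q) := by field_simp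
    rw [h3]
    field_simp
    ring
  | succ l hl ih =>
    rw [hstep, ih, if_neg (by omega), if_neg (by omega)]
    simp

end RadialIntegral

section SingularIntegral

variable {L : Type*} [Field L] {A : L → ℝ} {q : ℝ} [TopologicalSpace L] [MeasurableSpace L]
  [BorelSpace L] {vol : Measure L} [IsTopologicalRing L] [SecondCountableTopology L]
  [vol.IsAddLeftInvariant] {e : L → ℂ} {D : ℤ}

/-- The Fourier transform of `φ` outside the unit ball, recentred at `z`. -/
lemma IsBallCharacter.mul_integral_eq (he : IsBallCharacter A q e D)
    (h : IsScaledModulus A q vol) {ν : Measure L} [IsProbabilityMeasure ν]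
    (hν : ∀ a, ∫ y, e (a * y) ∂ν = if A a ≤ 1 then 1 else 0) {φ : L → ℂ}
    (hφ : Continuous φ) {z : L} (hz : A z ≤ q ^ D) {ξ : L} (hξ : 1 < A ξ) :
    e (-(z * ξ)) * ∫ y, e (ξ * y) * φ y ∂ν =
      ((q ^ (-D) : ℝ) : ℂ) *
        ∫ x in {x | A x ≤ q ^ D}, e (x * (-ξ)) * (φ (z - x) - φ z) ∂vol := by
  have := h.finite_restrict D
  have hec := he.continuous h
  have hν' := h.eq_smul_map_restrict D (fun c i hi => he.measure_ball_of_charFun h hν c hi) hz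
  have hm : Measurable (fun x : L => z - x) := (continuous_const.sub continuous_id).measurable
  have hcont : Continuous fun y => e (ξ * y) * φ y :=
    (hec.comp (continuous_const.mul continuous_id)).mul hφ
  rw [hν', integral_smul_measure, integral_map hm.aemeasurable
    hcont.measurable.aestronglyMeasurable, ENNReal.toReal_ofReal (zpow_pos h.q_pos _).le,
    Complex.real_smul, mul_left_comm, ← integral_const_mul]
  congr 1
  have hball : ∫ x in {x | A x ≤ q ^ D}, e (x * (-ξ)) ∂vol = 0 := by
    rw [he.setIntegral_ball h, if_neg]
    simpa [h.map_neg] using hξ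
  have h1 : ∀ x, e (-(z * ξ)) * (e (ξ * (z - x)) * φ (z - x)) =
      e (x * (-ξ)) * (φ (z - x) - φ z) + φ z * e (x * (-ξ)) := by
    intro x
    rw [← mul_assoc, ← he.map_add]
    have : -(z * ξ) + ξ * (z - x) = x * (-ξ) := by ring
    rw [this]
    ring
  have hφz : Continuous fun x => φ (z - x) - φ z :=
    (hφ.comp (continuous_const.sub continuous_id)).sub continuous_const
  have hφi : Integrable (fun x => φ (z - x) - φ z) (vol.restrict {x | A x ≤ q ^ D}) := by
    obtain ⟨M, hM⟩ := (h.isCompact_ball D).exists_bound_of_continuousOn hφz.continuousOn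
    exact Integrable.of_bound hφz.measurable.aestronglyMeasurable M
      ((ae_restrict_mem (h.measurableSet_ball_zero D)).mono hM)
  simp only [h1]
  rw [integral_add, integral_const_mul, hball, mul_zero, add_zero]
  · exact Integrable.bdd_mul (c := 1) hφi (he.measurable_mul h _).aestronglyMeasurable
      (Filter.Eventually.of_forall fun _ => (he.norm_eq _).le)
  · exact (Integrable.of_bound (he.measurable_mul h _).aestronglyMeasurable 1
      (Filter.Eventually.of_forall fun _ => (he.norm_eq _).le)).const_mul _

/-- The pseudo-differential operator with symbol `radialWeight A a` is a hypersingular integral. -/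
theorem IsBallCharacter.integral_radialWeight_eq (he : IsBallCharacter A q e D)
    (h : IsScaledModulus A q vol) {ν : Measure L} [IsProbabilityMeasure ν]
    (hν : ∀ a, ∫ y, e (a * y) ∂ν = if A a ≤ 1 then 1 else 0) {φ : L → ℂ}
    (hφ : IsLocallyConstant φ) {a : ℝ} (ha : 0 < a) {z : L} (hz : A z ≤ q ^ D) :
    ∫ ξ, e (-(z * ξ)) * radialWeight A a ξ * (∫ y, e (ξ * y) * φ y ∂ν) ∂vol =
      ((q ^ (-D) * ((1 - q ^ a) / (1 - (q ^ a * q)⁻¹)) : ℝ) : ℂ) *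
        ∫ x in {x | A x ≤ q ^ D},
          (((A x * q ^ (-D)) ^ (-1 - a) + (1 - q⁻¹) / (q ^ a - 1) : ℝ) : ℂ) *
            (φ (z - x) - φ z) ∂vol := by
  have hq := h.q_pos
  have hφc := hφ.continuous
  obtain ⟨i, hi⟩ := h.exists_forall_add_eq hφ D
  set l : ℕ := (D - i).toNat
  have hli : D - (l : ℤ) ≤ i := by omega
  set g : L → ℂ := fun x => φ (z - x) - φ z with hg
  have hg0 : g 0 = 0 := by simp [hg]
  have hginv : ∀ x y, A x ≤ q ^ D → A y ≤ q ^ (D - l) → g (y + x) = g x := by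
    intro x y hx hy
    have h1 := hi (z - x) (-y) (h.sub_le hz hx)
      (by rw [h.map_neg]; exact hy.trans (h.zpow_le_iff.2 hli))
    have h2 : z - (y + x) = -y + (z - x) := by ring
    simp only [hg, h2, h1]
  have hgc : Continuous g := (hφc.comp (continuous_const.sub continuous_id)).sub continuous_const
  have hgi : Integrable g (vol.restrict {x | A x ≤ q ^ D}) := by
    have := h.finite_restrict D
    obtain ⟨M, hM⟩ := (h.isCompact_ball D).exists_bound_of_continuousOn hgc.continuousOn
    exact Integrable.of_bound hgc.measurable.aestronglyMeasurable M
      ((ae_restrict_mem (h.measurableSet_ball_zero D)).mono hM)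
  have houter : ∀ ξ, e (-(z * ξ)) * radialWeight A a ξ * (∫ y, e (ξ * y) * φ y ∂ν) =
      Set.indicator {ξ | A ξ ≤ q ^ (l : ℤ)} (fun ξ => ((q ^ (-D) : ℝ) : ℂ) *
        ∫ x in {x | A x ≤ q ^ D}, radialWeight A a ξ * g x * e (-(ξ * x)) ∂vol) ξ := by
    intro ξ
    by_cases hξ : 1 < A ξ
    · rw [mul_right_comm, he.mul_integral_eq h hν hφc hz hξ, Set.indicator_apply]
      split_ifs with hξl
      · rw [mul_assoc, ← integral_mul_const]
        congr 2
        ext x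
        rw [mul_neg, mul_comm x ξ]
        ring
      · rw [he.setIntegral_mul_eq_zero h (j := D - l) (by omega) hginv, mul_zero, zero_mul]
        rwa [h.map_neg, sub_sub_cancel]
    · simp [radialWeight, hξ, Set.indicator_apply]
  simp only [houter]
  have := h.finite_restrict D
  have := h.finite_restrict l
  have hec : Continuous fun w : L × L => e (-(w.1 * w.2)) :=
    (he.continuous h).comp (continuous_fst.mul continuous_snd).neg
  have hprod : Integrable (Function.uncurry fun ξ x => radialWeight A a ξ * g x * e (-(ξ * x)))
      ((vol.restrict {ξ | A ξ ≤ q ^ (l : ℤ)}).prod (vol.restrict {x | A x ≤ q ^ D})) :=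
    Integrable.mul_bdd (c := 1) (Integrable.mul_prod (h.integrableOn_radialWeight ha l) hgi)
      hec.measurable.aestronglyMeasurable
      (Filter.Eventually.of_forall fun _ => (he.norm_eq _).le)
  rw [integral_indicator (h.measurableSet_ball_zero l), integral_const_mul (L := ℂ),
    integral_integral_swap hprod, Complex.ofReal_mul, mul_assoc]
  congr 1
  rw [← integral_const_mul]
  refine setIntegral_congr_fun (h.measurableSet_ball_zero D) fun x hx => ?_
  by_cases hxl : A x ≤ q ^ (D - l)
  · have hgx : g x = 0 := by
      rw [← hg0, ← hginv 0 x (by simpa [h.map_zero] using (zpow_pos hq D).le) hxl, add_zero]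
    have hgx' : φ (z - x) - φ z = 0 := hgx
    simp [hgx, hgx']
  · have hx0 : x ≠ 0 := by
      rintro rfl
      apply hxl
      simpa [h.map_zero] using (zpow_pos hq (D - l)).le
    obtain ⟨j', hj'⟩ := h.eq_zpow x hx0
    simp only [Set.mem_ofPred_eq, hj', h.zpow_le_iff] at hx hxl
    obtain ⟨j, rfl⟩ : ∃ j : ℕ, j' = D - j := ⟨(D - j').toNat, by omega⟩
    have hjl : j < l := by omega
    have hx' : A (-x) = q ^ (D - (j : ℤ)) := by rw [h.map_neg, hj']
    have hswap : ∀ ξ, radialWeight A a ξ * g x * e (-(ξ * x)) =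
        g x * (radialWeight A a ξ * e (ξ * (-x))) := fun ξ => by
      rw [mul_neg]
      ring
    simp only [hswap]
    rw [integral_const_mul, he.setIntegral_radialWeight h ha hx' hjl]
    have hpow : (A x * q ^ (-D)) ^ (-1 - a) = (q ^ a * q) ^ j := by
      rw [hj', ← zpow_add₀ hq.ne', show D - (j : ℤ) + -D = -(j : ℤ) by ring, zpow_neg,
        Real.inv_rpow (zpow_pos hq _).le, ← Real.rpow_neg (zpow_pos hq _).le,
        zpow_rpow_eq_pow hq, show -(-1 - a) = a + 1 by ring, Real.rpow_add_one hq.ne']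
    rw [hpow, mul_comm (g x), Complex.ofReal_mul, mul_assoc]

end SingularIntegral

section PadicModulus

variable {p : ℕ} [Fact p.Prime] {L : Type*} [Field L] [Algebra ℚ_[p] L] [FiniteDimensional ℚ_[p] L]

lemma Padic.norm_algebraNorm_eq_spectralNorm_pow (x : L) :
    ‖Algebra.norm ℚ_[p] x‖ = spectralNorm ℚ_[p] L x ^ finrank ℚ_[p] L := by
  let E := AlgebraicClosure ℚ_[p]
  have h := congrArg (spectralMulAlgNorm ℚ_[p] E) (Algebra.norm_eq_prod_embeddings ℚ_[p] E x)
  rw [map_prod, spectralMulAlgNorm_def, spectralNorm_extends] at h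
  have h2 : ∀ σ : L →ₐ[ℚ_[p]] E, spectralMulAlgNorm ℚ_[p] E (σ x) = spectralNorm ℚ_[p] L x := by
    intro σ
    rw [spectralMulAlgNorm_def, spectralNorm, minpoly.algHom_eq σ σ.injective, spectralNorm]
  rw [h, Finset.prod_congr rfl fun σ _ => h2 σ, Finset.prod_const, Finset.card_univ, AlgHom.card]

variable (p L) in
/-- The normalized modulus `x ↦ |N x|` of a finite extension of `ℚ_[p]`. -/
noncomputable def padicModulus (x : L) : ℝ := ‖Algebra.norm ℚ_[p] x‖

lemma padicModulus_eq (x : L) : padicModulus p L x = spectralNorm ℚ_[p] L x ^ finrank ℚ_[p] L :=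
  Padic.norm_algebraNorm_eq_spectralNorm_pow x

lemma padicModulus_zero : padicModulus p L 0 = 0 := by simp [padicModulus, Algebra.norm_zero]

omit [FiniteDimensional ℚ_[p] L] in
lemma padicModulus_one : padicModulus p L 1 = 1 := by simp [padicModulus]

omit [FiniteDimensional ℚ_[p] L] in
lemma padicModulus_mul (x y : L) : padicModulus p L (x * y) = padicModulus p L x * padicModulus p L y := by simp [padicModulus]

lemma padicModulus_pos {x : L} (hx : x ≠ 0) : 0 < padicModulus p L x :=
  norm_pos_iff.2 (Algebra.norm_ne_zero_iff.2 hx)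

omit [FiniteDimensional ℚ_[p] L] in
lemma padicModulus_nonneg (x : L) : 0 ≤ padicModulus p L x := norm_nonneg _

lemma padicModulus_neg (x : L) : padicModulus p L (-x) = padicModulus p L x := by
  rw [padicModulus_eq, padicModulus_eq, spectralNorm_neg (Algebra.IsAlgebraic.isAlgebraic x)]

lemma padicModulus_add_le_max (x y : L) : padicModulus p L (x + y) ≤ max (padicModulus p L x) (padicModulus p L y) := by
  have h := isNonarchimedean_spectralNorm (K := ℚ_[p]) (L := L) x y
  simp only [padicModulus_eq]
  rcases le_max_iff.1 h with h | h
  · exact le_max_of_le_left (pow_le_pow_left₀ (spectralNorm_nonneg _) h _)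
  · exact le_max_of_le_right (pow_le_pow_left₀ (spectralNorm_nonneg _) h _)

lemma padicModulus_p : padicModulus p L (p : L) = ((p : ℝ) ^ finrank ℚ_[p] L)⁻¹ := by
  have : (p : L) = algebraMap ℚ_[p] L p := by simp
  rw [padicModulus, this, Algebra.norm_algebraMap, norm_pow, Padic.norm_p, inv_pow]

section Integral

variable [Algebra ℤ_[p] L] [IsScalarTower ℤ_[p] ℚ_[p] L]

lemma padicModulus_le_one_iff (x : L) : padicModulus p L x ≤ 1 ↔ IsIntegral ℤ_[p] x := by
  have hint : IsIntegral ℚ_[p] x := Algebra.IsIntegral.isIntegral x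
  rw [padicModulus_eq, pow_le_one_iff_of_nonneg (spectralNorm_nonneg _) finrank_pos.ne',
    spectralNorm, spectralValue_le_one_iff (minpoly.monic hint)]
  constructor
  · intro h
    have h' : minpoly ℚ_[p] x ∈ Polynomial.lifts (algebraMap ℤ_[p] ℚ_[p]) := by
      rw [Polynomial.lifts_iff_coeff_lifts]
      exact fun i => ⟨⟨_, h i⟩, rfl⟩
    obtain ⟨P, hP, -, hPm⟩ :=
      Polynomial.lifts_and_natDegree_eq_and_monic h' (minpoly.monic hint)
    refine ⟨P, hPm, ?_⟩
    have : Polynomial.aeval x (P.map (algebraMap ℤ_[p] ℚ_[p])) = 0 := by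
      rw [hP, minpoly.aeval]
    rwa [Polynomial.aeval_map_algebraMap] at this
  · intro h i
    rw [minpoly.isIntegrallyClosed_eq_field_fractions' ℚ_[p] h, Polynomial.coeff_map]
    exact ((minpoly ℤ_[p] x).coeff i).2

lemma index_span_p_integralClosure :
    (Ideal.span {(p : integralClosure ℤ_[p] L)}).toAddSubgroup.index = p ^ finrank ℚ_[p] L := by
  have : Module.IsTorsionFree ℤ_[p] L := .trans_faithfulSMul ℤ_[p] ℚ_[p] L
  have := IsIntegralClosure.finite ℤ_[p] ℚ_[p] L (integralClosure ℤ_[p] L)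
  have := IsIntegralClosure.module_free ℤ_[p] ℚ_[p] L (integralClosure ℤ_[p] L)
  have hr := IsIntegralClosure.rank ℤ_[p] ℚ_[p] L (integralClosure ℤ_[p] L)
  let b := Module.Free.chooseBasis ℤ_[p] (integralClosure ℤ_[p] L)
  let ι := Module.Free.ChooseBasisIndex ℤ_[p] (integralClosure ℤ_[p] L)
  let f : integralClosure ℤ_[p] L →+ (ι → ZMod p) :=
    { toFun := fun x i => PadicInt.toZMod (b.repr x i)
      map_zero' := by ext; simp
      map_add' := by intro x y; ext; simp }
  have hf : Function.Surjective f := by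
    intro y
    choose g hg using fun i => ZMod.ringHom_surjective (PadicInt.toZMod (p := p)) (y i)
    refine ⟨b.equivFun.symm g, ?_⟩
    ext i
    change PadicInt.toZMod (b.equivFun (b.equivFun.symm g) i) = y i
    rw [LinearEquiv.apply_symm_apply, hg]
  have hker : (Ideal.span {(p : integralClosure ℤ_[p] L)}).toAddSubgroup = f.ker := by
    ext x
    change x ∈ Ideal.span {(p : integralClosure ℤ_[p] L)} ↔ f x = 0
    rw [Ideal.mem_span_singleton']
    have hmem : ∀ c : ℤ_[p], PadicInt.toZMod c = 0 ↔ ∃ a, a * (p : ℤ_[p]) = c := by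
      intro c
      rw [← RingHom.mem_ker, PadicInt.ker_toZMod, PadicInt.maximalIdeal_eq_span_p,
        Ideal.mem_span_singleton']
    constructor
    · rintro ⟨a, rfl⟩
      ext i
      refine (hmem _).2 ⟨b.repr a i, ?_⟩
      have : a * (p : integralClosure ℤ_[p] L) = (p : ℤ_[p]) • a := by
        rw [Algebra.smul_def, map_natCast, mul_comm]
      rw [this]
      simp [mul_comm]
    · intro hx
      choose g hg using fun i => (hmem _).1 (congrFun hx i)
      refine ⟨b.equivFun.symm g, b.equivFun.injective ?_⟩
      have : b.equivFun.symm g * (p : integralClosure ℤ_[p] L) =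
          (p : ℤ_[p]) • b.equivFun.symm g := by
        rw [Algebra.smul_def, map_natCast, mul_comm]
      rw [this, map_smul, LinearEquiv.apply_symm_apply]
      ext i
      rw [Pi.smul_apply, smul_eq_mul, mul_comm, hg]
      rfl
  rw [hker, AddSubgroup.index_ker, AddMonoidHom.range_eq_top.2 hf]
  have : finrank ℚ_[p] L = Fintype.card ι := by
    rw [← finrank_eq_card_basis b, hr]
  rw [this]
  simp [Nat.card_eq_fintype_card, ι]

end Integral

/-- The ball of radius `r` for the modulus of a finite extension of `ℚ_[p]`. -/
def padicBall (p : ℕ) [Fact p.Prime] (L : Type*) [Field L] [Algebra ℚ_[p] L]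
    [FiniteDimensional ℚ_[p] L] (r : ℝ) : AddSubgroup L where
  carrier := {x | padicModulus p L x ≤ max r 0}
  zero_mem' := by simp [padicModulus_zero]
  add_mem' {x y} hx hy := (padicModulus_add_le_max x y).trans (max_le hx hy)
  neg_mem' {x} hx := by simpa [padicModulus_neg] using hx

lemma mem_padicBall {r : ℝ} (hr : 0 ≤ r) {x : L} : x ∈ padicBall p L r ↔ padicModulus p L x ≤ r := by
  change padicModulus p L x ≤ max r 0 ↔ _
  rw [max_eq_left hr]

lemma padicModulus_p_mul_le_iff (x : L) : padicModulus p L ((p : L) * x) ≤ padicModulus p L (p : L) ↔ padicModulus p L x ≤ 1 := by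
  rw [padicModulus_mul]
  have := padicModulus_p (p := p) (L := L)
  have hp : (0 : ℝ) < p := by exact_mod_cast (Fact.out : p.Prime).pos
  exact mul_le_iff_le_one_right (by rw [this]; positivity)

lemma relIndex_padicBall_p :
    (padicBall p L (padicModulus p L (p : L))).relIndex (padicBall p L 1) = p ^ finrank ℚ_[p] L := by
  let : Algebra ℤ_[p] L := Algebra.compHom L (algebraMap ℤ_[p] ℚ_[p])
  have : IsScalarTower ℤ_[p] ℚ_[p] L := IsScalarTower.of_algebraMap_eq fun _ => rfl
  have : CharZero L := charZero_of_injective_algebraMap (algebraMap ℚ_[p] L).injective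
  have hp0 : (p : L) ≠ 0 := by exact_mod_cast (Fact.out : p.Prime).ne_zero
  let f : integralClosure ℤ_[p] L →+ L := (integralClosure ℤ_[p] L).val.toRingHom.toAddMonoidHom
  have hf : Function.Injective f := Subtype.val_injective
  have h1 : padicBall p L 1 = AddSubgroup.map f ⊤ := by
    ext x
    rw [mem_padicBall zero_le_one, padicModulus_le_one_iff]
    exact ⟨fun h => ⟨⟨x, h⟩, trivial, rfl⟩, by rintro ⟨y, -, rfl⟩; exact y.2⟩
  have h2 : padicBall p L (padicModulus p L (p : L)) =
      AddSubgroup.map f (Ideal.span {(p : integralClosure ℤ_[p] L)}).toAddSubgroup := by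
    ext x
    rw [mem_padicBall (padicModulus_nonneg _)]
    constructor
    · intro h
      have hx : x = (p : L) * ((p : L)⁻¹ * x) := by field_simp
      rw [hx, padicModulus_p_mul_le_iff, padicModulus_le_one_iff] at h
      refine ⟨⟨_, h⟩ * p, Ideal.mul_mem_left _ _ (Ideal.mem_span_singleton_self _), ?_⟩
      change (p : L)⁻¹ * x * ((p : integralClosure ℤ_[p] L) : L) = x
      push_cast
      field_simp
    · rintro ⟨y, hy, rfl⟩
      obtain ⟨a, rfl⟩ := Ideal.mem_span_singleton'.1 hy
      change padicModulus p L (((a * p : integralClosure ℤ_[p] L) : L)) ≤ _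
      push_cast
      rw [mul_comm, padicModulus_p_mul_le_iff, padicModulus_le_one_iff]
      exact a.2
  rw [h1, h2, AddSubgroup.relIndex_map_map_of_injective _ _ hf, AddSubgroup.relIndex_top_right,
    index_span_p_integralClosure]

lemma padicModulus_lt_pow_iff {x : L} {r : ℝ} (hr : 0 ≤ r) :
    padicModulus p L x < r ^ finrank ℚ_[p] L ↔ spectralNorm ℚ_[p] L x < r := by
  rw [padicModulus_eq]
  exact pow_lt_pow_iff_left₀ (spectralNorm_nonneg _) hr finrank_pos.ne'

lemma isTopologicalRing_of_padicModulus [t : TopologicalSpace L]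
    (ht : ∀ s : Set L, IsOpen s ↔ ∀ c ∈ s, ∃ ε > 0, {x | padicModulus p L (x - c) < ε} ⊆ s) :
    IsTopologicalRing L ∧ SecondCountableTopology L ∧ ∀ r, IsCompact {x : L | padicModulus p L x ≤ r} := by
  have hN : finrank ℚ_[p] L ≠ 0 := finrank_pos.ne'
  let inst : NormedField L := spectralNorm.normedField ℚ_[p] L
  have hball : ∀ (c : L) (r : ℝ), Metric.ball c r = {x | spectralNorm ℚ_[p] L (x - c) < r} :=
    fun c r => by ext x; rw [mem_ball_iff_norm]; rfl
  have heq : t = inst.toMetricSpace.toUniformSpace.toTopologicalSpace := by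
    ext s
    rw [ht, Metric.isOpen_iff]
    refine forall₂_congr fun c _ => ?_
    constructor
    · rintro ⟨ε, hε, h⟩
      refine ⟨ε ^ ((finrank ℚ_[p] L : ℝ)⁻¹), Real.rpow_pos_of_pos hε _, ?_⟩
      rw [hball]
      refine subset_trans (fun x hx => ?_) h
      rw [Set.mem_ofPred_eq, ← padicModulus_lt_pow_iff (Real.rpow_nonneg hε.le _),
        Real.rpow_inv_natCast_pow hε.le hN] at hx
      exact hx
    · rintro ⟨ε, hε, h⟩
      refine ⟨ε ^ finrank ℚ_[p] L, pow_pos hε _, subset_trans (fun x hx => ?_) h⟩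
      rw [hball]
      exact (padicModulus_lt_pow_iff hε.le).1 hx
  subst heq
  let : NormedSpace ℚ_[p] L := spectralNorm.normedSpace ℚ_[p] L
  have : ProperSpace L := FiniteDimensional.proper ℚ_[p] L
  refine ⟨inferInstance, inferInstance, fun r => ?_⟩
  rcases lt_or_ge r 0 with hr | hr
  · convert isCompact_empty
    ext x
    simpa using hr.trans_le (padicModulus_nonneg x)
  · convert isCompact_closedBall (0 : L) (r ^ ((finrank ℚ_[p] L : ℝ)⁻¹)) using 1
    ext x
    rw [mem_closedBall_zero_iff]
    change _ ↔ spectralNorm ℚ_[p] L x ≤ _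
    rw [Set.mem_ofPred_eq, ← not_lt, ← not_lt, not_iff_not, padicModulus_eq]
    conv_lhs => rw [← Real.rpow_inv_natCast_pow hr hN]
    exact pow_lt_pow_iff_left₀ (Real.rpow_nonneg hr _) (spectralNorm_nonneg _) hN

lemma mem_padicBall_mul_iff {w : L} (hw : w ≠ 0) {r : ℝ} (hr : 0 ≤ r) (x : L) :
    w * x ∈ padicBall p L (padicModulus p L w * r) ↔ x ∈ padicBall p L r := by
  rw [mem_padicBall (mul_nonneg (padicModulus_nonneg _) hr), mem_padicBall hr, padicModulus_mul]
  exact mul_le_mul_iff_right₀ (padicModulus_pos hw)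

lemma padicBall_eq_map {w : L} (hw : w ≠ 0) {r : ℝ} (hr : 0 ≤ r) :
    padicBall p L (padicModulus p L w * r) = (padicBall p L r).map (AddMonoidHom.mulLeft w) := by
  ext x
  constructor
  · intro h
    have hx : x = w * (w⁻¹ * x) := by field_simp
    rw [hx, mem_padicBall_mul_iff hw hr] at h
    exact ⟨_, h, hx.symm⟩
  · rintro ⟨y, hy, rfl⟩
    exact (mem_padicBall_mul_iff hw hr y).2 hy

lemma relIndex_padicBall_mul {w : L} (hw : w ≠ 0) {r s : ℝ} (hr : 0 ≤ r) (hs : 0 ≤ s) :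
    (padicBall p L (padicModulus p L w * r)).relIndex (padicBall p L (padicModulus p L w * s)) =
      (padicBall p L r).relIndex (padicBall p L s) := by
  rw [padicBall_eq_map hw hr, padicBall_eq_map hw hs]
  exact AddSubgroup.relIndex_map_map_of_injective _ _ (mul_right_injective₀ hw)

lemma padicBall_mono {r s : ℝ} (hrs : r ≤ s) : padicBall p L r ≤ padicBall p L s :=
  fun _ hx => le_trans hx (max_le_max_right 0 hrs)

section ValueGroup

variable {Q : ℝ} (hQ : IsGreatest {r | (∃ x : L, padicModulus p L x = r) ∧ r < 1} Q⁻¹)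
include hQ

lemma one_lt_of_isGreatest_padicModulus : 1 < Q := by
  have hp := (Fact.out : p.Prime).one_lt
  have h : (1 : ℝ) < (p : ℝ) ^ finrank ℚ_[p] L :=
    one_lt_pow₀ (by exact_mod_cast hp) finrank_pos.ne'
  have h1 := hQ.2 ⟨⟨(p : L), rfl⟩, by rw [padicModulus_p]; exact inv_lt_one_of_one_lt₀ h⟩
  have h2 : 0 < Q⁻¹ := lt_of_lt_of_le (by rw [padicModulus_p]; positivity) h1
  exact (inv_lt_one₀ (inv_pos.1 h2)).1 hQ.1.2

lemma exists_padicModulus_eq_zpow (i : ℤ) : ∃ x : L, x ≠ 0 ∧ padicModulus p L x = Q ^ i := by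
  have h1 := one_lt_of_isGreatest_padicModulus hQ
  obtain ⟨⟨w, hw⟩, -⟩ := hQ.1
  have hw0 : w ≠ 0 := by
    rintro rfl
    rw [padicModulus_zero] at hw
    have : 0 < Q⁻¹ := by positivity
    exact this.ne hw
  let f : L →*₀ ℝ :=
    { toFun := padicModulus p L
      map_zero' := padicModulus_zero
      map_one' := padicModulus_one
      map_mul' := padicModulus_mul }
  refine ⟨w ^ (-i), zpow_ne_zero _ hw0, ?_⟩
  have : f (w ^ (-i)) = f w ^ (-i) := map_zpow₀ f w (-i)
  change padicModulus p L (w ^ (-i)) = padicModulus p L w ^ (-i) at this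
  rw [this, hw, inv_zpow, zpow_neg, inv_inv]

lemma padicModulus_eq_zpow {x : L} (hx : x ≠ 0) : ∃ j : ℤ, padicModulus p L x = Q ^ j := by
  have h1 := one_lt_of_isGreatest_padicModulus hQ
  have h0 : 0 < Q := by positivity
  obtain ⟨j, hj⟩ := exists_mem_Ico_zpow (padicModulus_pos (p := p) hx) h1
  obtain ⟨w, hw0, hw⟩ := exists_padicModulus_eq_zpow hQ (-(j + 1))
  have hy : padicModulus p L (x * w) = padicModulus p L x * Q ^ (-(j + 1)) := by rw [padicModulus_mul, hw]
  have hlt : padicModulus p L (x * w) < 1 := by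
    rw [hy, zpow_neg, ← div_eq_mul_inv, div_lt_one (zpow_pos h0 _)]
    exact hj.2
  have hle := hQ.2 ⟨⟨_, rfl⟩, hlt⟩
  rw [hy, zpow_neg, ← div_eq_mul_inv, div_le_iff₀ (zpow_pos h0 _), zpow_add_one₀ h0.ne',
    mul_comm (Q ^ j), inv_mul_cancel_left₀ h0.ne'] at hle
  exact ⟨j, le_antisymm hle hj.1⟩

lemma relIndex_padicBall_zpow (i : ℤ) :
    ((padicBall p L (Q ^ i)).relIndex (padicBall p L (Q ^ (i + 1))) : ℝ) = Q := by
  have h1 := one_lt_of_isGreatest_padicModulus hQ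
  have h0 : 0 < Q := by positivity
  set r := (padicBall p L Q⁻¹).relIndex (padicBall p L 1) with hr
  have hstep : ∀ i : ℤ, (padicBall p L (Q ^ i)).relIndex (padicBall p L (Q ^ (i + 1))) = r := by
    intro i
    obtain ⟨w, hw0, hw⟩ := exists_padicModulus_eq_zpow hQ (i + 1)
    rw [hr, ← relIndex_padicBall_mul hw0 (by positivity) zero_le_one, hw, mul_one,
      zpow_add_one₀ h0.ne', mul_inv_cancel_right₀ h0.ne']
  have hpow : ∀ e : ℕ, (padicBall p L (Q ^ (-(e : ℤ)))).relIndex (padicBall p L 1) = r ^ e := by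
    intro e
    induction e with
    | zero => simp
    | succ e ih =>
      rw [← AddSubgroup.relIndex_mul_relIndex _ (padicBall p L (Q ^ (-(e : ℤ)))) _
        (padicBall_mono (zpow_le_zpow_right₀ h1.le (by push_cast; lia)))
        (padicBall_mono (zpow_le_one_of_nonpos₀ h1.le (by lia))), ih, pow_succ', ← hstep]
      congr 4
      push_cast
      ring
  have : CharZero L := charZero_of_injective_algebraMap (algebraMap ℚ_[p] L).injective
  have hp0 : (p : L) ≠ 0 := by exact_mod_cast (Fact.out : p.Prime).ne_zero
  have hp1 : (1 : ℝ) < (p : ℝ) ^ finrank ℚ_[p] L :=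
    one_lt_pow₀ (by exact_mod_cast (Fact.out : p.Prime).one_lt) finrank_pos.ne'
  obtain ⟨j, hj⟩ := padicModulus_eq_zpow hQ hp0
  have hj0 : j < 0 := by
    by_contra! hcon
    have : 1 ≤ Q ^ j := one_le_zpow₀ h1.le hcon
    rw [← hj, padicModulus_p] at this
    exact absurd (inv_lt_one_of_one_lt₀ hp1) this.not_gt
  obtain ⟨e, rfl⟩ : ∃ e : ℕ, j = -(e : ℤ) := ⟨j.natAbs, by lia⟩
  have he : e ≠ 0 := by lia
  have hre : (r : ℝ) ^ e = Q ^ e := by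
    have h2 := relIndex_padicBall_p (p := p) (L := L)
    rw [hj, hpow] at h2
    rw [padicModulus_p, zpow_neg, inv_inj, zpow_natCast] at hj
    rw [← hj]
    exact_mod_cast h2
  rw [hstep]
  exact (pow_left_inj₀ (Nat.cast_nonneg _) h0.le he).1 hre

end ValueGroup

end PadicModulus

lemma measure_eq_relIndex_mul {G : Type*} [AddGroup G] [MeasurableSpace G] [MeasurableAdd G]
    (ν : Measure G) [ν.IsAddLeftInvariant] {H K : AddSubgroup G} (hHK : H ≤ K)
    (hH : MeasurableSet (H : Set G)) (hK : MeasurableSet (K : Set G)) (h0 : H.relIndex K ≠ 0) :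
    ν K = H.relIndex K * ν H := by
  have : (H.addSubgroupOf K).FiniteIndex := ⟨h0⟩
  have hemb : MeasurableEmbedding (K.subtype : K → G) := MeasurableEmbedding.subtype_coe hK
  have : MeasurableAdd K :=
    { measurable_const_add := fun c =>
        ((measurable_const_add (c : G)).comp measurable_subtype_coe).subtype_mk
      measurable_add_const := fun c =>
        ((measurable_add_const (c : G)).comp measurable_subtype_coe).subtype_mk }
  have : (ν.comap (K.subtype : K → G)).IsAddLeftInvariant :=
    Measure.IsAddLeftInvariant.comap ν hemb
  have hm : MeasurableSet ((H.addSubgroupOf K : AddSubgroup K) : Set K) :=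
    measurable_subtype_coe hH
  have h := AddSubgroup.index_mul_measure (H.addSubgroupOf K) hm (ν.comap (K.subtype : K → G))
  rw [hemb.comap_apply, hemb.comap_apply] at h
  have h1 : (K.subtype : K → G) '' ((H.addSubgroupOf K : AddSubgroup K) : Set K) = H := by
    ext x
    exact ⟨by rintro ⟨y, hy, rfl⟩; exact hy, fun hx => ⟨⟨x, hHK hx⟩, hx, rfl⟩⟩
  have h2 : (K.subtype : K → G) '' Set.univ = K := by
    simp
  rw [h1, h2] at h
  exact h.symm

section PadicScaled

variable {p : ℕ} [Fact p.Prime] {L : Type*} [Field L] [Algebra ℚ_[p] L] [FiniteDimensional ℚ_[p] L]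
  [TopologicalSpace L] [MeasurableSpace L] [BorelSpace L] {Q : ℝ} {ν : Measure L}
  [ν.IsAddLeftInvariant]

omit [MeasurableSpace L] [BorelSpace L] in
lemma isOpen_ball_of_padicModulus
    (ht : ∀ s : Set L, IsOpen s ↔ ∀ c ∈ s, ∃ ε > 0, {x | padicModulus p L (x - c) < ε} ⊆ s)
    (c : L) {r : ℝ} (hr : 0 < r) : IsOpen {x | padicModulus p L (x - c) ≤ r} := by
  rw [ht]
  intro c' hc'
  refine ⟨r, hr, fun x hx => ?_⟩
  have h := padicModulus_add_le_max (p := p) (x - c') (c' - c)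
  rw [sub_add_sub_cancel] at h
  exact h.trans (max_le hx.le hc')

lemma measure_padicBall_zpow [IsTopologicalRing L]
    (ht : ∀ s : Set L, IsOpen s ↔ ∀ c ∈ s, ∃ ε > 0, {x | padicModulus p L (x - c) < ε} ⊆ s)
    (hQ : IsGreatest {r | (∃ x : L, padicModulus p L x = r) ∧ r < 1} Q⁻¹)
    (hν : ν {x | padicModulus p L x ≤ 1} = 1) (i : ℤ) :
    ν {x | padicModulus p L x ≤ Q ^ i} = ENNReal.ofReal (Q ^ i) := by
  have h1 := one_lt_of_isGreatest_padicModulus hQ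
  have h0 : 0 < Q := by positivity
  have hcoe : ∀ i : ℤ, (padicBall p L (Q ^ i) : Set L) = {x | padicModulus p L x ≤ Q ^ i} := by
    intro i
    ext x
    exact mem_padicBall (zpow_pos h0 i).le
  have hmeas : ∀ i : ℤ, MeasurableSet (padicBall p L (Q ^ i) : Set L) := by
    intro i
    rw [hcoe]
    simpa using (isOpen_ball_of_padicModulus ht 0 (zpow_pos h0 i)).measurableSet
  have hstep : ∀ i : ℤ, ν {x | padicModulus p L x ≤ Q ^ (i + 1)} =
      ENNReal.ofReal Q * ν {x | padicModulus p L x ≤ Q ^ i} := by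
    intro i
    have hr := relIndex_padicBall_zpow hQ i
    have hne : (padicBall p L (Q ^ i)).relIndex (padicBall p L (Q ^ (i + 1))) ≠ 0 := by
      intro h
      rw [h, Nat.cast_zero] at hr
      exact h0.ne hr
    rw [← hcoe, ← hcoe, measure_eq_relIndex_mul ν
      (padicBall_mono (zpow_le_zpow_right₀ h1.le (by lia))) (hmeas _) (hmeas _) hne]
    congr 1
    rw [← hr, ENNReal.ofReal_natCast, hr]
  induction i with
  | zero => simpa using hν
  | succ i ih =>
    rw [hstep, ih, ← ENNReal.ofReal_mul h0.le, zpow_add_one₀ h0.ne', mul_comm]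
  | pred i ih =>
    have h := hstep (-(i : ℤ) - 1)
    rw [sub_add_cancel, ih] at h
    have hQ0 : ENNReal.ofReal Q ≠ 0 := (ENNReal.ofReal_pos.2 h0).ne'
    rw [← ENNReal.mul_right_inj hQ0 ENNReal.ofReal_ne_top, ← h, ← ENNReal.ofReal_mul h0.le,
      zpow_sub_one₀ h0.ne', mul_comm Q, inv_mul_cancel_right₀ h0.ne']

lemma isScaledModulus_padicModulus
    (ht : ∀ s : Set L, IsOpen s ↔ ∀ c ∈ s, ∃ ε > 0, {x | padicModulus p L (x - c) < ε} ⊆ s)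
    (hQ : IsGreatest {r | (∃ x : L, padicModulus p L x = r) ∧ r < 1} Q⁻¹)
    (hν : ν {x | padicModulus p L x ≤ 1} = 1) :
    IsScaledModulus (padicModulus p L) Q ν := by
  have h1 := one_lt_of_isGreatest_padicModulus hQ
  have h0 : 0 < Q := by positivity
  obtain ⟨hring, -, hcpt⟩ := isTopologicalRing_of_padicModulus ht
  exact
    { one_lt := h1
      map_zero := padicModulus_zero
      map_neg := padicModulus_neg
      map_mul := padicModulus_mul
      add_le_max := padicModulus_add_le_max
      eq_zpow := fun x hx => padicModulus_eq_zpow hQ hx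
      exists_eq_inv := hQ.1.1
      isOpen_ball := fun c i => isOpen_ball_of_padicModulus ht c (zpow_pos h0 i)
      exists_ball_subset := by
        intro c U hU hc
        obtain ⟨ε, hε, h⟩ := (ht U).1 hU c hc
        obtain ⟨n, hn⟩ := exists_pow_lt_of_lt_one hε (inv_lt_one_of_one_lt₀ h1)
        refine ⟨-(n : ℤ), subset_trans (fun x hx => ?_) h⟩
        rw [inv_pow, ← zpow_natCast, ← zpow_neg] at hn
        exact lt_of_le_of_lt hx hn
      isCompact_ball := fun i => hcpt _
      vol_ball := measure_padicBall_zpow ht hQ hν }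

end PadicScaled

section RelativeModulus

variable (p : ℕ) [Fact p.Prime] {k : Type} [Field k] [Algebra ℚ_[p] k] [FiniteDimensional ℚ_[p] k]
  {L : Type} [Field L] [Algebra k L]

omit [FiniteDimensional ℚ_[p] k] in
lemma absk_eq_padicModulus (x : k) : absk p k x = padicModulus p k x := rfl

lemma padicModulus_eq_absk_norm [FiniteDimensional k L] [Algebra ℚ_[p] L]
    [IsScalarTower ℚ_[p] k L] (x : L) :
    padicModulus p L x = absk p k (Algebra.norm k x) := by
  rw [padicModulus, absk, Algebra.norm_norm]

lemma absk_lt_one_or_le {q₁ : ℝ} (hq₁ : ∀ x : k, absk p k x < 1 → absk p k x ≤ q₁⁻¹)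
    {u : k} (hu : 1 < absk p k u) : q₁ ≤ absk p k u := by
  have hu0 : u ≠ 0 := by
    rintro rfl
    rw [absk_eq_padicModulus, padicModulus_zero] at hu
    linarith
  have hmul : absk p k u * absk p k u⁻¹ = 1 := by
    rw [absk_eq_padicModulus, absk_eq_padicModulus, ← padicModulus_mul, mul_inv_cancel₀ hu0,
      padicModulus_one]
  have hinv : absk p k u⁻¹ = (absk p k u)⁻¹ := eq_inv_of_mul_eq_one_right hmul
  have h := hq₁ u⁻¹ (by rw [hinv]; exact inv_lt_one_of_one_lt₀ hu)
  have hpos : 0 < absk p k u := by linarith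
  rw [hinv] at h
  exact (inv_le_inv₀ hpos (inv_pos.1 ((inv_pos.2 hpos).trans_le h))).1 h

/-- An additive character of rank zero of `k`, composed with the normalized trace, is a character
of the finite extension `L` whose annihilator of the unit ball is the ball of radius `q ^ D`. -/
lemma isBallCharacter_normalized_trace [FiniteDimensional k L] [Algebra ℚ_[p] L]
    [IsScalarTower ℚ_[p] k L] [FiniteDimensional ℚ_[p] L]
    {q q₁ : ℝ} (hq : 0 < q) {χ : k → ℂ} (hχadd : ∀ x y : k, χ (x + y) = χ x * χ y)
    (hχnorm : ∀ x : k, ‖χ x‖ = 1) (hχtriv : ∀ x : k, absk p k x ≤ 1 → χ x = 1)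
    (hq₁ : ∀ x : k, absk p k x < 1 → absk p k x ≤ q₁⁻¹)
    (hχrank : ∃ x : k, absk p k x ≤ q₁ ∧ χ x ≠ 1) {d : ℕ} {j : ℤ}
    (hd : ∀ x : L, padicModulus p L x ≤ q ^ d ↔
      ∀ y : L, padicModulus p L y ≤ 1 → absk p k (Algebra.trace k L (x * y)) ≤ 1)
    (hj : padicModulus p L (finrank k L : L) = q ^ j) :
    IsBallCharacter (padicModulus p L) q
      (fun x => χ ((finrank k L : k)⁻¹ * Algebra.trace k L x)) (d + j) where
  map_add x y := by rw [map_add, mul_add, hχadd]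
  norm_eq x := hχnorm _
  annihilator b := by
    have hk0 : CharZero k := charZero_of_injective_algebraMap (algebraMap ℚ_[p] k).injective
    have hL0 : CharZero L := charZero_of_injective_algebraMap (algebraMap ℚ_[p] L).injective
    have hm : (finrank k L : k) ≠ 0 := by exact_mod_cast finrank_pos.ne'
    have hmL : (finrank k L : L) ≠ 0 := by exact_mod_cast finrank_pos.ne'
    set x : L := algebraMap k L (finrank k L : k)⁻¹ * b with hx
    have hbx : b = (finrank k L : L) * x := by
      rw [hx, map_inv₀, map_natCast, mul_inv_cancel_left₀ hmL]
    have htr : ∀ (c : k) (y : L), (finrank k L : k)⁻¹ * Algebra.trace k L (c • y * b) =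
        c * Algebra.trace k L (x * y) := by
      intro c y
      have : c • y * b = (c * (finrank k L : k)) • (x * y) := by
        rw [hbx, Algebra.smul_def, Algebra.smul_def, _root_.map_mul, map_natCast]
        ring
      rw [this, map_smul, smul_eq_mul]
      field_simp
    have hle : padicModulus p L b ≤ q ^ (d + j : ℤ) ↔ padicModulus p L x ≤ q ^ d := by
      rw [hbx, padicModulus_mul, hj, zpow_add₀ hq.ne', mul_comm, zpow_natCast]
      exact mul_le_mul_iff_left₀ (zpow_pos hq j)
    rw [hle, hd]
    constructor
    · intro h y hy
      by_contra! hu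
      obtain ⟨v, hv, hχv⟩ := hχrank
      set u := Algebra.trace k L (x * y)
      have hu0 : u ≠ 0 := by
        intro h0
        rw [h0, absk_eq_padicModulus, padicModulus_zero] at hu
        linarith
      have hc : absk p k (v / u) ≤ 1 := by
        have h1 : absk p k (v / u) * absk p k u = absk p k v := by
          rw [absk_eq_padicModulus, absk_eq_padicModulus, ← padicModulus_mul,
            div_mul_cancel₀ _ hu0]
          rfl
        have h2 := hv.trans (absk_lt_one_or_le p hq₁ hu)
        rw [← h1] at h2
        exact (mul_le_iff_le_one_left (by linarith)).1 h2
      have h1 := h ((v / u) • y) (by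
        rw [Algebra.smul_def, padicModulus_mul, padicModulus_eq_absk_norm (k := k) p
          (algebraMap k L _), Algebra.norm_algebraMap]
        refine mul_le_one₀ ?_ (padicModulus_nonneg _) hy
        rw [absk, map_pow, norm_pow]
        exact pow_le_one₀ (norm_nonneg _) hc)
      refine hχv ?_
      rwa [htr, div_mul_cancel₀ _ hu0] at h1
    · intro h a ha
      have h1 := htr 1 a
      rw [one_smul, one_mul] at h1
      change χ _ = 1
      rw [h1]
      exact hχtriv _ (h a ha)

section RootModulus

variable [FiniteDimensional k L]

lemma rpow_absk_norm_add_le_max (x y : L) {r : ℝ} (hr : 0 ≤ r) :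
    absk p k (Algebra.norm k (x + y)) ^ r ≤
      max (absk p k (Algebra.norm k x) ^ r) (absk p k (Algebra.norm k y) ^ r) := by
  let : Algebra ℚ_[p] L := Algebra.compHom L (algebraMap ℚ_[p] k)
  have : IsScalarTower ℚ_[p] k L := IsScalarTower.of_algebraMap_eq fun _ => rfl
  have : FiniteDimensional ℚ_[p] L := FiniteDimensional.trans ℚ_[p] k L
  simp only [← padicModulus_eq_absk_norm]
  rcases le_max_iff.1 (padicModulus_add_le_max (p := p) x y) with h | h
  · exact le_max_of_le_left (Real.rpow_le_rpow (padicModulus_nonneg _) h hr)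
  · exact le_max_of_le_right (Real.rpow_le_rpow (padicModulus_nonneg _) h hr)

end RootModulus

/-- The hyper-singular integral representation for a finite extension `L` of the local field `k`,
with `π : Ω → L` in place of the projection of the projective limit. -/
lemma hypersingular_integral_eq [FiniteDimensional k L]
    [TopologicalSpace L] [MeasurableSpace L] [BorelSpace L] {N : L → ℝ}
    (hN : ∀ x, N x = absk p k (Algebra.norm k x) ^ ((finrank k L : ℝ)⁻¹))
    (ht : ∀ s : Set L, IsOpen s ↔ ∀ c ∈ s, ∃ ε > 0, {x | N (x - c) < ε} ⊆ s)
    {q q₁ : ℝ}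
    (hq : IsGreatest {r : ℝ | (∃ x : L, N x ^ (finrank k L : ℝ) = r) ∧ r < 1} q⁻¹)
    {χ : k → ℂ} (hχadd : ∀ x y : k, χ (x + y) = χ x * χ y)
    (hχnorm : ∀ x : k, ‖χ x‖ = 1) (hχtriv : ∀ x : k, absk p k x ≤ 1 → χ x = 1)
    (hq₁ : ∀ x : k, absk p k x < 1 → absk p k x ≤ q₁⁻¹)
    (hχrank : ∃ x : k, absk p k x ≤ q₁ ∧ χ x ≠ 1) {d : ℕ}
    (hd : ∀ x : L, N x ^ (finrank k L : ℝ) ≤ q ^ (d : ℝ) ↔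
      ∀ y : L, N y ≤ 1 → absk p k (Algebra.trace k L (x * y)) ≤ 1)
    {vol : Measure L}
    (hinv : ∀ (a : L) (s : Set L), MeasurableSet s → vol ((fun z => a + z) ⁻¹' s) = vol s)
    (hvol : vol {x | N x ≤ 1} = 1)
    {Ω : Type*} [MeasurableSpace Ω] {μ : Measure Ω} [IsProbabilityMeasure μ] {π : Ω → L}
    (hπ : Measurable π)
    (hμ : ∀ a : L, ∫ y, χ ((finrank k L : k)⁻¹ * Algebra.trace k L (a * π y)) ∂μ =
      if N a ≤ 1 then (1 : ℂ) else 0)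
    {α : ℝ} (hα : 0 < α) {φ : L → ℂ} (hφ : IsLocallyConstant φ) {z : L}
    (hz : N z ≤ q ^ ((d : ℝ) / (finrank k L : ℝ)) * absk p k (finrank k L : k)) :
    (∫ ξ : L, χ ((finrank k L : k)⁻¹ * Algebra.trace k L (-(z * ξ))) *
        (if 1 < N ξ then ((N ξ ^ α : ℝ) : ℂ) else 0) *
        (∫ y, χ ((finrank k L : k)⁻¹ * Algebra.trace k L (ξ * π y)) * φ (π y) ∂μ) ∂vol) =
      ((q ^ ((d : ℝ) * α / (finrank k L : ℝ)) *
          ((1 - q ^ (α / (finrank k L : ℝ))) / (1 - q ^ (-1 - α / (finrank k L : ℝ)))) *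
          absk p k (finrank k L : k) ^ (-(finrank k L : ℝ)) : ℝ) : ℂ) *
        ∫ x in {x : L | N x ≤ q ^ ((d : ℝ) / (finrank k L : ℝ)) * absk p k (finrank k L : k)},
          ((N x ^ (-(finrank k L : ℝ) - α) *
              absk p k (finrank k L : k) ^ ((finrank k L : ℝ) + α) +
              ((1 - q⁻¹) / (q ^ (α / (finrank k L : ℝ)) - 1)) *
                q ^ (-((d : ℝ) * (1 + α / (finrank k L : ℝ)))) : ℝ) : ℂ) *
            (φ (z - x) - φ z) ∂vol := by
  let : Algebra ℚ_[p] L := Algebra.compHom L (algebraMap ℚ_[p] k)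
  have : IsScalarTower ℚ_[p] k L := IsScalarTower.of_algebraMap_eq fun _ => rfl
  have : FiniteDimensional ℚ_[p] L := FiniteDimensional.trans ℚ_[p] k L
  have hk0 : CharZero k := charZero_of_injective_algebraMap (algebraMap ℚ_[p] k).injective
  have hL0 : CharZero L := charZero_of_injective_algebraMap (algebraMap ℚ_[p] L).injective
  set m : ℝ := (finrank k L : ℝ) with hm
  have hm0 : 0 < m := Nat.cast_pos.2 finrank_pos
  set A := padicModulus p L with hA
  have hA0 : ∀ x, 0 ≤ A x := padicModulus_nonneg
  have hNA : ∀ x, N x = A x ^ m⁻¹ := fun x => by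
    rw [hN, hA, padicModulus_eq_absk_norm (k := k) p]
  have hNm : ∀ x, N x ^ m = A x := fun x => by
    rw [hNA, Real.rpow_inv_rpow (hA0 x) hm0.ne']
  have hN0 : ∀ x, 0 ≤ N x := fun x => by rw [hNA]; exact Real.rpow_nonneg (hA0 x) _
  have hNle : ∀ {x r}, 0 ≤ r → (N x ≤ r ↔ A x ≤ r ^ m) := fun {x r} hr => by
    rw [← hNm, Real.rpow_le_rpow_iff (hN0 x) hr hm0]
  have hNlt : ∀ {x r}, 0 ≤ r → (N x < r ↔ A x < r ^ m) := fun {x r} hr => by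
    rw [← hNm, Real.rpow_lt_rpow_iff (hN0 x) hr hm0]
  have hNle1 : ∀ x, N x ≤ 1 ↔ A x ≤ 1 := fun x => by
    rw [hNle zero_le_one, Real.one_rpow]
  have hNpow : ∀ x β, N x ^ β = A x ^ (β / m) := fun x β => by
    rw [hNA, ← Real.rpow_mul (hA0 x), inv_mul_eq_div]
  have htA : ∀ s : Set L, IsOpen s ↔ ∀ c ∈ s, ∃ ε > 0, {x | A (x - c) < ε} ⊆ s := by
    intro s
    rw [ht]
    refine forall₂_congr fun c _ => ⟨?_, ?_⟩
    · rintro ⟨ε, hε, h⟩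
      refine ⟨ε ^ m, Real.rpow_pos_of_pos hε _, subset_trans (fun x hx => ?_) h⟩
      exact (hNlt hε.le).2 hx
    · rintro ⟨ε, hε, h⟩
      refine ⟨ε ^ m⁻¹, Real.rpow_pos_of_pos hε _, subset_trans (fun x hx => ?_) h⟩
      have := (hNlt (Real.rpow_nonneg hε.le _)).1 hx
      rwa [Real.rpow_inv_rpow hε.le hm0.ne'] at this
  simp only [hNm] at hq hd
  simp only [hNle1, Real.rpow_natCast] at hd
  simp only [hNle1] at hvol hμ
  obtain ⟨_, _, -⟩ := isTopologicalRing_of_padicModulus htA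
  have : vol.IsAddLeftInvariant := ⟨fun a => Measure.ext fun s hs => by
    rw [Measure.map_apply (measurable_const_add a) hs, hinv a s hs]⟩
  have hmod := isScaledModulus_padicModulus htA hq hvol
  have hq0 := hmod.q_pos
  have hmL : (finrank k L : L) ≠ 0 := by exact_mod_cast finrank_pos.ne'
  obtain ⟨j, hj⟩ := hmod.eq_zpow _ hmL
  have he := isBallCharacter_normalized_trace p hq0 hχadd hχnorm hχtriv hq₁ hχrank hd hj
  set c := absk p k (finrank k L : k) with hc
  have hc0 : 0 < c := padicModulus_pos (by exact_mod_cast finrank_pos.ne')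
  have hcm : c ^ m = q ^ j := by
    have : (finrank k L : L) = algebraMap k L (finrank k L : k) := by simp
    rw [← hj, this, padicModulus_eq_absk_norm (k := k) p, Algebra.norm_algebraMap, hm,
      Real.rpow_natCast, hc, absk, absk, map_pow, norm_pow]
  have hR0 : 0 < q ^ ((d : ℝ) / m) * c := by positivity
  have hRm : (q ^ ((d : ℝ) / m) * c) ^ m = q ^ (d + j : ℤ) := by
    rw [Real.mul_rpow (by positivity) hc0.le, hcm, ← Real.rpow_mul hq0.le,
      div_mul_cancel₀ _ hm0.ne', zpow_add₀ hq0.ne', Real.rpow_natCast, zpow_natCast]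
  have hball : ∀ x, N x ≤ q ^ ((d : ℝ) / m) * c ↔ A x ≤ q ^ (d + j : ℤ) := fun x => by
    rw [hNle hR0.le, hRm]
  have hem : ∀ a, Measurable fun y => χ ((finrank k L : k)⁻¹ * Algebra.trace k L (a * y)) := by
    intro a
    simpa only [mul_comm a] using he.measurable_mul hmod a
  have hν : ∀ a : L, ∫ y, χ ((finrank k L : k)⁻¹ * Algebra.trace k L (a * y)) ∂μ.map π =
      if A a ≤ 1 then (1 : ℂ) else 0 := by
    intro a
    rw [integral_map hπ.aemeasurable (hem a).aestronglyMeasurable, hμ]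
  have hφν : ∀ ξ : L, ∫ y, χ ((finrank k L : k)⁻¹ * Algebra.trace k L (ξ * π y)) * φ (π y) ∂μ =
      ∫ y, χ ((finrank k L : k)⁻¹ * Algebra.trace k L (ξ * y)) * φ y ∂μ.map π := by
    intro ξ
    rw [integral_map hπ.aemeasurable]
    exact ((hem ξ).mul hφ.continuous.measurable).aestronglyMeasurable
  have : IsProbabilityMeasure (μ.map π) := Measure.isProbabilityMeasure_map hπ.aemeasurable
  have hmain := he.integral_radialWeight_eq hmod hν hφ (div_pos hα hm0) ((hball z).1 hz)
  have hw : ∀ ξ, (if 1 < N ξ then ((N ξ ^ α : ℝ) : ℂ) else 0) = radialWeight A (α / m) ξ := by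
    intro ξ
    rw [radialWeight, hNpow]
    simp only [← not_le, hNle1]
  simp only [hw, hφν]
  rw [hmain]
  have hset : {x | N x ≤ q ^ ((d : ℝ) / m) * c} = {x | A x ≤ q ^ (d + j : ℤ)} :=
    Set.ext fun x => hball x
  have hqD : q ^ (-(d + j) : ℤ) = q ^ (-(d : ℝ)) * c ^ (-m) := by
    rw [zpow_neg, ← hRm, Real.mul_rpow (by positivity) hc0.le, ← Real.rpow_mul hq0.le,
      div_mul_cancel₀ _ hm0.ne', mul_inv, ← Real.rpow_neg hq0.le, ← Real.rpow_neg hc0.le]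
  set a := α / m with ha
  have hαa : α = a * m := by rw [ha, div_mul_cancel₀ _ hm0.ne']
  set w : ℝ := q ^ (-((d : ℝ) * (1 + a))) with hw_def
  have hint : ∀ x, ((N x ^ (-m - α) * c ^ (m + α) + (1 - q⁻¹) / (q ^ a - 1) * w : ℝ) : ℂ) *
      (φ (z - x) - φ z) = (w : ℂ) *
        ((((A x * q ^ (-(d + j) : ℤ)) ^ (-1 - a) + (1 - q⁻¹) / (q ^ a - 1) : ℝ) : ℂ) *
          (φ (z - x) - φ z)) := by
    intro x
    have hexp : (-m - α) / m = -1 - a := by rw [hαa]; field_simp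
    have hc' : (c ^ (-m)) ^ (-1 - a) = c ^ (m + α) := by
      rw [← Real.rpow_mul hc0.le, hαa]
      ring_nf
    have hq' : w * (q ^ (-(d : ℝ))) ^ (-1 - a) = 1 := by
      rw [hw_def, ← Real.rpow_mul hq0.le, ← Real.rpow_add hq0]
      convert Real.rpow_zero q using 2
      ring
    have hterm : N x ^ (-m - α) * c ^ (m + α) = w * (A x * q ^ (-(d + j) : ℤ)) ^ (-1 - a) := by
      rw [hNpow, hexp, hqD, Real.mul_rpow (hA0 x) (by positivity),
        Real.mul_rpow (by positivity) (by positivity), hc']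
      linear_combination (-(A x ^ (-1 - a) * c ^ (m + α))) * hq'
    rw [hterm]
    push_cast
    ring
  simp only [hint]
  rw [integral_const_mul, ← mul_assoc, hset]
  congr 1
  rw [← Complex.ofReal_mul]
  congr 1
  have hpow : q ^ (-1 - a) = (q ^ a * q)⁻¹ := by
    rw [← Real.rpow_add_one hq0.ne', ← Real.rpow_neg hq0.le]
    ring_nf
  have hw' : q ^ ((d : ℝ) * α / m) * w = q ^ (-(d : ℝ)) := by
    rw [hw_def, ← Real.rpow_add hq0, hαa]
    congr 1
    field_simp
    ring
  rw [hqD, hpow, ← hw']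
  ring

end RelativeModulus

section UltrametricTopology

variable {X : Type} [AddCommGroup X] {f : X → ℝ}

open Topology in
lemma isOpen_normTopology_iff (hadd : ∀ x y, f (x + y) ≤ max (f x) (f y)) (h0 : f 0 = 0)
    (s : Set X) : IsOpen[normTopology f] s ↔ ∀ c ∈ s, ∃ ε > 0, {x | f (x - c) < ε} ⊆ s := by
  constructor
  · intro hs
    induction hs with
    | basic s hs =>
      obtain ⟨x, ε, hε, rfl⟩ := hs
      refine fun c hc => ⟨ε, hε, fun y hy => ?_⟩
      have h := hadd (y - c) (c - x)
      rw [sub_add_sub_cancel] at h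
      exact h.trans_lt (max_lt hy hc)
    | univ => exact fun c _ => ⟨1, one_pos, Set.subset_univ _⟩
    | inter s t _ _ ihs iht =>
      intro c hc
      obtain ⟨ε, hε, h⟩ := ihs c hc.1
      obtain ⟨δ, hδ, h'⟩ := iht c hc.2
      exact ⟨min ε δ, lt_min hε hδ, fun x (hx : f (x - c) < min ε δ) =>
        ⟨h (hx.trans_le (min_le_left _ _)), h' (hx.trans_le (min_le_right _ _))⟩⟩
    | sUnion S _ ih =>
      rintro c ⟨s, hs, hc⟩
      obtain ⟨ε, hε, h⟩ := ih s hs c hc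
      exact ⟨ε, hε, h.trans (Set.subset_sUnion_of_mem hs)⟩
  · intro h
    let := normTopology f
    refine isOpen_iff_forall_mem_open.2 fun c hc => ?_
    obtain ⟨ε, hε, hsub⟩ := h c hc
    exact ⟨_, hsub, TopologicalSpace.isOpen_generateFrom_of_mem ⟨c, ε, hε, rfl⟩, by simpa [h0]⟩

open Topology in
lemma isOpen_induced_normTopology_iff {Y : Type} [AddCommGroup Y] (i : Y →+ X)
    (hadd : ∀ x y, f (x + y) ≤ max (f x) (f y)) (h0 : f 0 = 0)
    (s : Set Y) :
    IsOpen[TopologicalSpace.induced i (normTopology f)] s ↔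
      ∀ c ∈ s, ∃ ε > 0, {x | f (i (x - c)) < ε} ⊆ s := by
  let := normTopology f
  let := TopologicalSpace.induced i (normTopology f)
  constructor
  · rintro ⟨t, ht, rfl⟩ c hc
    obtain ⟨ε, hε, h⟩ := (isOpen_normTopology_iff hadd h0 t).1 ht _ hc
    refine ⟨ε, hε, fun x hx => h ?_⟩
    rwa [Set.mem_ofPred_eq, map_sub] at hx
  · intro h
    refine isOpen_iff_forall_mem_open.2 fun c hc => ?_
    obtain ⟨ε, hε, hsub⟩ := h c hc
    refine ⟨_, hsub, ⟨{y | f (y - i c) < ε},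
      TopologicalSpace.isOpen_generateFrom_of_mem ⟨i c, ε, hε, rfl⟩, ?_⟩, by simpa [h0]⟩
    ext x
    simp

end UltrametricTopology

theorem statement_17
    (p : ℕ) [Fact (Nat.Prime p)]
    (k : Type) [Field k] [Algebra ℚ_[p] k] [FiniteDimensional ℚ_[p] k]
    (K : Type) [Field K] [Algebra k K] [CharZero K]
    (Kn : ℕ → IntermediateField k K)
    (hbot : Kn 1 = ⊥) (hmono : Monotone Kn)
    [hfd : ∀ n, FiniteDimensional k (Kn n)]
    (hunion : ∀ x : K, ∃ n, x ∈ Kn n)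
    (T : ℕ → K →ₗ[k] K)
    (hTmem : ∀ (n : ℕ) (x : K), T n x ∈ Kn n)
    (hTdef : ∀ (n ν : ℕ) (h : n ≤ ν) (x : K) (hx : x ∈ Kn ν),
      T n x = ((finrank k (Kn n) : K) / (finrank k (Kn ν) : K)) *
        (relTrace k K (Kn n) (Kn ν) (hmono h) ⟨x, hx⟩ : K))
    (Knorm : K → ℝ)
    (hKnorm : ∀ (n : ℕ) (x : K) (hx : x ∈ Kn n),
      Knorm x = absk p k (Algebra.norm k (⟨x, hx⟩ : Kn n)) ^ ((finrank k (Kn n) : ℝ)⁻¹))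
    (pairing : K → ProjLim k K Kn T → k)
    (hpair : ∀ (n : ℕ) (a : K) (ha : a ∈ Kn n) (x : ProjLim k K Kn T),
      pairing a x = (finrank k (Kn n) : k)⁻¹ *
        Algebra.trace k (Kn n) (⟨a * x.1 n, mul_mem ha (x.2.1 n)⟩ : Kn n))
    (q : ℕ → ℕ)
    (hq : ∀ n : ℕ, IsGreatest
      {r : ℝ | (∃ x : Kn n, Knorm ↑x ^ (finrank k (Kn n) : ℝ) = r) ∧ r < 1} ((q n : ℝ)⁻¹))
    (χ : k → ℂ)
    (hχadd : ∀ x y : k, χ (x + y) = χ x * χ y)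
    (hχnorm : ∀ x : k, ‖χ x‖ = 1)
    (hχcont : @Continuous _ _ (kTop p k) _ χ)
    (hχtriv : ∀ x : k, absk p k x ≤ 1 → χ x = 1)
    (hχrank : ∃ x : k, absk p k x ≤ (q 1 : ℝ) ∧ χ x ≠ 1)
    (d : ℕ → ℕ)
    (hd : ∀ (n : ℕ) (x : Kn n),
      Knorm ↑x ^ (finrank k (Kn n) : ℝ) ≤ (q n : ℝ) ^ (d n : ℝ) ↔
        ∀ y : Kn n, Knorm ↑y ≤ 1 → absk p k (Algebra.trace k (Kn n) (x * y)) ≤ 1)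
    (vol : ∀ n : ℕ, @MeasureTheory.Measure (Kn n) (KnMeas k K Kn Knorm n))
    (hvolinv : ∀ (n : ℕ) (a : Kn n) (A : Set (Kn n)),
      MeasurableSet[KnMeas k K Kn Knorm n] A → vol n ((fun z => a + z) ⁻¹' A) = vol n A)
    (hvolnorm : ∀ n : ℕ, vol n {z : Kn n | Knorm ↑z ≤ 1} = 1)
    (μ : @MeasureTheory.Measure (ProjLim k K Kn T) (projMeas k K Kn T Knorm))
    (hμprob : MeasureTheory.IsProbabilityMeasure μ)
    (hμradon : ∀ A : Set (ProjLim k K Kn T), MeasurableSet[projMeas k K Kn T Knorm] A →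
      μ A = ⨆ (C : Set (ProjLim k K Kn T))
        (_ : C ⊆ A ∧ @IsCompact _ (projTop k K Kn T Knorm) C), μ C)
    (hμchar : ∀ a : K, ∫ x, χ (pairing a x) ∂μ = if Knorm a ≤ 1 then (1 : ℂ) else 0)
    (α : ℝ) (hα : 0 < α)
    (n : ℕ) (hn : 1 ≤ n) (φ : Kn n → ℂ)
    (hφ : @IsLocallyConstant _ _ (KnTop k K Kn Knorm n) φ) :
    ∀ z : Kn n,
      Knorm ↑z ≤ (q n : ℝ) ^ ((d n : ℝ) / (finrank k (Kn n) : ℝ)) *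
          absk p k (finrank k (Kn n) : k) →
      (∫ ξ : Kn n,
          χ ((finrank k (Kn n) : k)⁻¹ *
              Algebra.trace k (Kn n) (-(z * ξ))) *
            (if 1 < Knorm ↑ξ then ((Knorm ↑ξ ^ α : ℝ) : ℂ) else 0) *
            (∫ y, χ (pairing (↑ξ) y) * φ ⟨y.1 n, y.2.1 n⟩ ∂μ) ∂(vol n))
        = (((q n : ℝ) ^ ((d n : ℝ) * α / (finrank k (Kn n) : ℝ)) *
              ((1 - (q n : ℝ) ^ (α / (finrank k (Kn n) : ℝ))) /
                (1 - (q n : ℝ) ^ (-1 - α / (finrank k (Kn n) : ℝ)))) *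
              absk p k (finrank k (Kn n) : k) ^ (-(finrank k (Kn n) : ℝ)) : ℝ) : ℂ) *
            ∫ x in {x : Kn n |
                Knorm ↑x ≤ (q n : ℝ) ^ ((d n : ℝ) / (finrank k (Kn n) : ℝ)) *
                  absk p k (finrank k (Kn n) : k)},
              ((Knorm ↑x ^ (-(finrank k (Kn n) : ℝ) - α) *
                  absk p k (finrank k (Kn n) : k) ^ ((finrank k (Kn n) : ℝ) + α) +
                  ((1 - (q n : ℝ)⁻¹) / ((q n : ℝ) ^ (α / (finrank k (Kn n) : ℝ)) - 1)) *
                    (q n : ℝ) ^ (-((d n : ℝ) * (1 + α / (finrank k (Kn n) : ℝ)))) : ℝ) : ℂ) *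
                (φ (z - x) - φ z) ∂(vol n) := by

  have hadd : ∀ x y, Knorm (x + y) ≤ max (Knorm x) (Knorm y) := by
    intro x y
    obtain ⟨a, ha⟩ := hunion x
    obtain ⟨b, hb⟩ := hunion y
    have hx := hmono (le_max_left a b) ha
    have hy := hmono (le_max_right a b) hb
    rw [hKnorm _ _ hx, hKnorm _ _ hy, hKnorm _ _ (add_mem hx hy)]
    exact rpow_absk_norm_add_le_max p (⟨x, hx⟩ : Kn (max a b)) ⟨y, hy⟩ (by positivity)
  have hzero : Knorm 0 = 0 := by
    have h0 : Algebra.norm k (⟨0, zero_mem (Kn n)⟩ : Kn n) = 0 := Algebra.norm_zero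
    rw [hKnorm n 0 (zero_mem _), h0, absk_eq_padicModulus, padicModulus_zero]
    exact Real.zero_rpow (inv_ne_zero (Nat.cast_ne_zero.2 finrank_pos.ne'))
  let : TopologicalSpace (Kn n) := KnTop k K Kn Knorm n
  let : MeasurableSpace (Kn n) := KnMeas k K Kn Knorm n
  have : BorelSpace (Kn n) := ⟨rfl⟩
  let : TopologicalSpace (ProjLim k K Kn T) := projTop k K Kn T Knorm
  let : MeasurableSpace (ProjLim k K Kn T) := projMeas k K Kn T Knorm
  have : BorelSpace (ProjLim k K Kn T) := ⟨rfl⟩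
  have ht : ∀ s : Set (Kn n), IsOpen s ↔
      ∀ c ∈ s, ∃ ε > 0, {x : Kn n | Knorm ↑(x - c) < ε} ⊆ s :=
    isOpen_induced_normTopology_iff (Kn n).val.toRingHom.toAddMonoidHom hadd hzero
  have hπ : Measurable fun y : ProjLim k K Kn T => (⟨y.1 n, y.2.1 n⟩ : Kn n) := by
    refine Continuous.measurable ⟨fun s hs => isOpen_iff_forall_mem_open.2 fun y hy => ?_⟩
    obtain ⟨ε, hε, h⟩ := (ht s).1 hs _ hy
    refine ⟨{y' | Knorm (y'.1 n - y.1 n) < ε}, fun y' hy' => h hy',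
      TopologicalSpace.isOpen_generateFrom_of_mem ⟨y, n, ε, hε, rfl⟩, ?_⟩
    simpa [hzero]
  have hq₁ : ∀ x : k, absk p k x < 1 → absk p k x ≤ (q 1 : ℝ)⁻¹ := by
    have hf : finrank k (Kn 1) = 1 := by
      rw [hbot]
      exact IntermediateField.finrank_bot
    intro x hx
    have h1 : Knorm (algebraMap k (Kn 1) x : Kn 1) = absk p k x := by
      rw [hKnorm 1 _ (algebraMap k (Kn 1) x).2]
      change absk p k (Algebra.norm k (algebraMap k (Kn 1) x)) ^ _ = _
      rw [Algebra.norm_algebraMap, hf, pow_one, Nat.cast_one, inv_one, Real.rpow_one]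
    refine (hq 1).2 ⟨⟨algebraMap k (Kn 1) x, ?_⟩, hx⟩
    rw [h1, hf, Nat.cast_one, Real.rpow_one]
  intro z hz
  have hchar : ∀ a : Kn n, ∫ y : ProjLim k K Kn T, χ ((finrank k (Kn n) : k)⁻¹ *
      Algebra.trace k (Kn n) (a * ⟨y.1 n, y.2.1 n⟩)) ∂μ =
      if Knorm (a : K) ≤ 1 then (1 : ℂ) else 0 := by
    intro a
    have h := hμchar a
    simp only [hpair n a a.2] at h
    exact h
  simp only [fun ξ : Kn n => hpair n ξ ξ.2]
  exact hypersingular_integral_eq p (N := fun x : Kn n => Knorm x) (fun x => hKnorm n x x.2) ht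
    (hq n) hχadd hχnorm hχtriv hq₁ hχrank (hd n) (hvolinv n) (hvolnorm n) hπ hchar hα hφ hz
end
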